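/- arXiv:1110.6217 — 2 statements merged into one kernel-verified Lean document; each statement's English description precedes it below -/
import Mathlib

section
/- Let ℓ : ℝ^n × ... × ℝ^n → ℝ be a symmetric m-multilinear form and P : ℂ^n → ℂ^n the degree (m−1) polynomial map P(x) = ℓ(x,...,x,−)ᵀ. If P, viewed as a self-map of ℙ^{n−1}(ℂ), has finitely many fixed points and is generic, the number of fixed points (eigenvectors of ℓ up to scale) is (m−1)^{n−1} + (m−1)^{n−2} + ... + (m−1) + 1. -/
open MvPolynomial
open scoped Matrix

theorem finrank_restrictTotalDegree (σ k : Type*) [Fintype σ] [Field k] (j : ℕ) :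
    Module.finrank k (restrictTotalDegree σ k j) =
      (j + Fintype.card σ).choose (Fintype.card σ) := by
  classical
  have hset : {s : σ →₀ ℕ | (s.sum fun _ e => e) ≤ j} =
      ((Finset.range (j + 1)).biUnion fun i => Finset.univ.finsuppAntidiag i :
          Finset (σ →₀ ℕ)) := by
    ext s
    simp [Finsupp.sum_fintype]
  rw [restrictTotalDegree, Module.finrank_eq_nat_card_basis
    (basisRestrictSupport k {s : σ →₀ ℕ | (s.sum fun _ e => e) ≤ j}), hset,
    Nat.card_coe_set_eq, Set.ncard_coe_finset, Finset.card_biUnion,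
    ← Nat.sum_range_multichoose]
  · simp [Finset.card_finsuppAntidiag_nat_eq_multichoose]
  · intro a _ b _ hab
    refine Finset.disjoint_left.mpr fun s hs ht => hab ?_
    simp only [Finset.mem_finsuppAntidiag] at hs ht
    exact hs.1.symm.trans ht.1

theorem succ_pow_le_factorial_mul_choose (j n : ℕ) :
    (j + 1) ^ n ≤ n.factorial * (j + n).choose n := by
  rw [← Nat.descFactorial_eq_factorial_mul_choose]
  refine le_trans (le_of_eq ?_) (Nat.pow_sub_le_descFactorial _ _)
  congr 1
  omega

theorem factorial_mul_choose_le_pow (j n : ℕ) :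
    n.factorial * (j + n).choose n ≤ (j + n) ^ n := by
  rw [← Nat.descFactorial_eq_factorial_mul_choose]
  exact Nat.descFactorial_le_pow _ _

theorem tendsto_affine_ratio_pow (n d b : ℕ) {c : ℕ} :
    Filter.Tendsto (fun j : ℕ => (((d * j + b : ℕ) : ℝ) / ((j + c : ℕ) : ℝ)) ^ n) Filter.atTop
      (nhds ((d : ℝ) ^ n)) := by
  have := (tendsto_add_mul_div_add_mul_atTop_nhds (b : ℝ) c d one_ne_zero).pow n
  rw [div_one] at this
  refine this.congr fun j => ?_
  push_cast
  ring

theorem le_pow_of_mul_choose_le {n d N C : ℕ}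
    (h : ∀ j, N * (j + n).choose n ≤ (d * j + C + n).choose n) : N ≤ d ^ n := by
  have key : ∀ j : ℕ, (N : ℝ) ≤ (((d * j + (C + n) : ℕ) : ℝ) / ((j + 1 : ℕ) : ℝ)) ^ n := by
    intro j
    rw [div_pow, le_div_iff₀ (by positivity)]
    norm_cast
    calc N * (j + 1) ^ n ≤ N * (n.factorial * (j + n).choose n) :=
          Nat.mul_le_mul_left _ (succ_pow_le_factorial_mul_choose j n)
      _ = n.factorial * (N * (j + n).choose n) := by ring
      _ ≤ n.factorial * (d * j + C + n).choose n := Nat.mul_le_mul_left _ (h j)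
      _ ≤ (d * j + (C + n)) ^ n := by
          rw [← add_assoc]; exact factorial_mul_choose_le_pow _ _
  exact_mod_cast ge_of_tendsto' (tendsto_affine_ratio_pow n d (C + n)) key

theorem pow_le_of_choose_le_mul {n d N C : ℕ}
    (h : ∀ j, (d * j + n).choose n ≤ N * (j + C + n).choose n) : d ^ n ≤ N := by
  have key : ∀ j : ℕ, (((d * j + 1 : ℕ) : ℝ) / ((j + (C + n + 1) : ℕ) : ℝ)) ^ n ≤ N := by
    intro j
    rw [div_pow, div_le_iff₀ (by positivity)]
    norm_cast
    calc (d * j + 1) ^ n ≤ n.factorial * (d * j + n).choose n :=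
          succ_pow_le_factorial_mul_choose _ _
      _ ≤ n.factorial * (N * (j + C + n).choose n) := Nat.mul_le_mul_left _ (h j)
      _ = N * (n.factorial * (j + C + n).choose n) := by ring
      _ ≤ N * (j + C + n) ^ n := Nat.mul_le_mul_left _ (factorial_mul_choose_le_pow _ _)
      _ ≤ N * (j + (C + n + 1)) ^ n := by
          refine Nat.mul_le_mul_left _ (Nat.pow_le_pow_left (by omega) _)
  exact_mod_cast le_of_tendsto' (tendsto_affine_ratio_pow n d 1) key

theorem exists_interpolation {σ k : Type*} [Field k] {Z : Finset (σ → k)} (z : Z) :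
    ∃ e : MvPolynomial σ k, eval (z : σ → k) e = 1 ∧ ∀ w : Z, w ≠ z → eval (w : σ → k) e = 0 := by
  classical
  have h : ∀ w : Z, ∃ l : MvPolynomial σ k, eval (z : σ → k) l = 1 ∧
      (w ≠ z → eval (w : σ → k) l = 0) := by
    intro w
    by_cases hw : w = z
    · exact ⟨1, by simp, fun h => absurd hw h⟩
    · obtain ⟨i, hi⟩ : ∃ i, (z : σ → k) i ≠ (w : σ → k) i :=
        Function.ne_iff.mp fun h => hw (Subtype.ext h.symm)
      refine ⟨C ((z : σ → k) i - (w : σ → k) i)⁻¹ * (X i - C ((w : σ → k) i)), ?_, fun _ => ?_⟩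
      · simp [inv_mul_cancel₀ (sub_ne_zero.mpr hi)]
      · simp
  choose l hl1 hl0 using h
  refine ⟨∏ w, l w, ?_, fun w hw => ?_⟩
  · rw [map_prod]
    exact Finset.prod_eq_one fun v _ => hl1 v
  · rw [map_prod]
    exact Finset.prod_eq_zero (Finset.mem_univ w) (hl0 w hw)

theorem hasStrictFDerivAt_eval {σ : Type*} [Fintype σ] (p : MvPolynomial σ ℂ) (x : σ → ℂ) :
    HasStrictFDerivAt (fun y : σ → ℂ => eval y p)
      (∑ i, eval x (pderiv i p) • (ContinuousLinearMap.proj i : (σ → ℂ) →L[ℂ] ℂ)) x := by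
  classical
  induction p using MvPolynomial.induction_on with
  | C a =>
    simp only [eval_C]
    exact (hasStrictFDerivAt_const a x).congr_fderiv (by ext; simp)
  | add p q hp hq =>
    simp only [map_add]
    refine (hp.add hq).congr_fderiv ?_
    ext v
    simp [add_mul, Finset.sum_add_distrib]
  | mul_X p i hp =>
    have := hp.mul (hasStrictFDerivAt_apply (𝕜 := ℂ) (F' := fun _ : σ => ℂ) i x)
    simp only [map_mul, eval_X]
    refine this.congr_fderiv ?_
    ext v
    simp [pderiv_X, Pi.single_apply, mul_add, Finset.sum_add_distrib, Finset.mul_sum, mul_comm,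
      mul_left_comm, apply_ite]

theorem exists_sub_one_mem_forall_mul_eq_sum {A B ι κ : Type*} [CommRing A] [CommRing B] [Fintype ι]
    [Fintype κ] (φ : A →+* B) (m : Ideal A) (e : ι → B) (s : κ → B)
    (hs : ∀ b, ∃ a : κ → A, b = ∑ k, φ (a k) * s k)
    (he : ∀ b, ∃ c : ι → A, b - ∑ i, φ (c i) * e i ∈ m.map φ) :
    ∃ f : A, f - 1 ∈ m ∧ ∀ b, ∃ c : ι → A, φ f * b = ∑ i, φ (c i) * e i := by
  let _ := φ.toAlgebra
  have hmem : ∀ b : B, b ∈ Submodule.span A (Set.range e) ↔ ∃ c : ι → A, ∑ i, φ (c i) * e i = b :=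
    fun b => Submodule.mem_span_range_iff_exists_fun A
  have hfin : Module.Finite A B := by
    have htop : Submodule.span A (Set.range s) = ⊤ := by
      refine Submodule.eq_top_iff'.mpr fun b => ?_
      obtain ⟨a, ha⟩ := hs b
      exact (Submodule.mem_span_range_iff_exists_fun A).mpr ⟨a, ha.symm⟩
    rw [Module.finite_def, ← htop]
    exact Submodule.fg_span (Set.finite_range s)
  set E : Submodule A B := Submodule.span A (Set.range e)
  obtain ⟨f, hf, hf'⟩ := Submodule.exists_sub_one_mem_and_smul_eq_zero_of_fg_of_le_smul m
    (⊤ : Submodule A (B ⧸ E)) Module.Finite.fg_top (by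
      rintro x -
      obtain ⟨b, rfl⟩ := E.mkQ_surjective x
      obtain ⟨c, hc⟩ := he b
      have h1 : E.mkQ b = E.mkQ (b - ∑ i, φ (c i) * e i) := by
        rw [map_sub, E.mkQ_apply (∑ i, φ (c i) * e i),
          (Submodule.Quotient.mk_eq_zero E).mpr ((hmem _).mpr ⟨c, rfl⟩), sub_zero]
      rw [h1]
      have h2 : b - ∑ i, φ (c i) * e i ∈ m • (⊤ : Submodule A B) := by
        rw [Ideal.smul_top_eq_map]
        exact hc
      have h3 := Submodule.mem_map_of_mem (f := E.mkQ) h2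
      rw [Submodule.map_smul''] at h3
      exact Submodule.smul_mono le_rfl le_top h3)
  refine ⟨f, hf, fun b => ?_⟩
  have := hf' (E.mkQ b) trivial
  rw [← map_smul] at this
  obtain ⟨c, hc⟩ := (hmem _).mp ((Submodule.Quotient.mk_eq_zero E).mp this)
  exact ⟨c, hc.symm⟩

theorem totalDegree_aeval_le {σ τ k : Type*} [Field k] {d : ℕ} {F : τ → MvPolynomial σ k}
    (hF : ∀ i, (F i).totalDegree ≤ d) (a : MvPolynomial τ k) :
    (aeval F a).totalDegree ≤ d * a.totalDegree := by
  rw [aeval_def, eval₂_eq]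
  refine totalDegree_finsetSum_le fun s hs => ?_
  refine (totalDegree_mul _ _).trans ?_
  rw [algebraMap_eq, totalDegree_C, zero_add]
  calc (∏ i ∈ s.support, F i ^ s i).totalDegree
      ≤ ∑ i ∈ s.support, (F i ^ s i).totalDegree := totalDegree_finsetProd _ _
    _ ≤ ∑ i ∈ s.support, d * s i := Finset.sum_le_sum fun i _ =>
        (totalDegree_pow _ _).trans (by rw [mul_comm]; exact Nat.mul_le_mul_right _ (hF i))
    _ = d * ∑ i ∈ s.support, s i := by rw [Finset.mul_sum]
    _ ≤ d * a.totalDegree := Nat.mul_le_mul_left _ (le_totalDegree hs)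

theorem eval_aeval {σ τ k : Type*} [CommSemiring k] (F : τ → MvPolynomial σ k)
    (a : MvPolynomial τ k) (x : σ → k) :
    eval x (aeval F a) = eval (fun i => eval x (F i)) a := by
  induction a using MvPolynomial.induction_on with
  | C a => simp
  | add p q hp hq => simp only [map_add, hp, hq]
  | mul_X p i hp => simp only [map_mul, hp, aeval_X, eval_X]

/-- The `ℂ`-linear map `a ↦ ∑ i, aeval F (a i) * e i`. -/
noncomputable def polyCombination {σ τ ι : Type*} [Fintype ι] (F : τ → MvPolynomial σ ℂ)
    (e : ι → MvPolynomial σ ℂ) : (ι → MvPolynomial τ ℂ) →ₗ[ℂ] MvPolynomial σ ℂ :=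
  ∑ i, LinearMap.mulRight ℂ (e i) ∘ₗ (aeval F).toLinearMap ∘ₗ LinearMap.proj i

theorem polyCombination_apply {σ τ ι : Type*} [Fintype ι] (F : τ → MvPolynomial σ ℂ)
    (e : ι → MvPolynomial σ ℂ) (a : ι → MvPolynomial τ ℂ) :
    polyCombination F e a = ∑ i, aeval F (a i) * e i := by
  simp [polyCombination]

/-- The restriction of `polyCombination F e` to coefficients of total degree at most `j`. -/
noncomputable def boundedCombination {σ τ ι : Type*} [Fintype ι] (F : τ → MvPolynomial σ ℂ)
    (e : ι → MvPolynomial σ ℂ) (j : ℕ) :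
    (ι → restrictTotalDegree τ ℂ j) →ₗ[ℂ] MvPolynomial σ ℂ :=
  polyCombination F e ∘ₗ LinearMap.compLeft (restrictTotalDegree τ ℂ j).subtype ι

theorem mem_range_boundedCombination {σ τ ι : Type*} [Fintype ι] {F : τ → MvPolynomial σ ℂ}
    {e : ι → MvPolynomial σ ℂ} {j : ℕ} {b : MvPolynomial σ ℂ} :
    b ∈ LinearMap.range (boundedCombination F e j) ↔
      ∃ a : ι → MvPolynomial τ ℂ, (∀ i, (a i).totalDegree ≤ j) ∧ b = ∑ i, aeval F (a i) * e i := by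
  constructor
  · rintro ⟨a, rfl⟩
    exact ⟨fun i => a i, fun i => (mem_restrictTotalDegree _ _ _).mp (a i).2,
      polyCombination_apply F e _⟩
  · rintro ⟨a, ha, rfl⟩
    exact ⟨fun i => ⟨a i, (mem_restrictTotalDegree _ _ _).mpr (ha i)⟩,
      polyCombination_apply F e _⟩

theorem finrank_pi_restrictTotalDegree (ι σ : Type*) [Fintype ι] [Fintype σ] (j : ℕ) :
    Module.finrank ℂ (ι → restrictTotalDegree σ ℂ j) =
      Fintype.card ι * (j + Fintype.card σ).choose (Fintype.card σ) := by
  rw [Module.finrank_pi_fintype]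
  simp [finrank_restrictTotalDegree]

theorem exists_local_section {σ : Type*} [Fintype σ] (F : σ → MvPolynomial σ ℂ) (z : σ → ℂ)
    (hz : ∀ i, eval z (F i) = 0)
    (hJ : ∀ w : σ → ℂ, (∀ i, ∑ j, eval z (pderiv j (F i)) * w j = 0) → w = 0) :
    ∃ G : (σ → ℂ) → (σ → ℂ), ContinuousAt G 0 ∧ G 0 = z ∧
      ∀ᶠ y in nhds (0 : σ → ℂ), ∀ i, eval (G y) (F i) = y i := by
  let D : (σ → ℂ) →L[ℂ] (σ → ℂ) := ContinuousLinearMap.pi fun i =>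
    ∑ j, eval z (pderiv j (F i)) • (ContinuousLinearMap.proj j : (σ → ℂ) →L[ℂ] ℂ)
  have hD : Function.Injective (D : (σ → ℂ) →ₗ[ℂ] (σ → ℂ)) := by
    rw [← LinearMap.ker_eq_bot, LinearMap.ker_eq_bot']
    refine fun w hw => hJ w fun i => ?_
    simpa [D] using congrFun hw i
  let D' : (σ → ℂ) ≃L[ℂ] (σ → ℂ) :=
    (LinearEquiv.ofInjectiveEndo _ hD).toContinuousLinearEquiv
  have hF : HasStrictFDerivAt (fun (x : σ → ℂ) i => eval x (F i))
      (D' : (σ → ℂ) →L[ℂ] (σ → ℂ)) z := by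
    have : (D' : (σ → ℂ) →L[ℂ] (σ → ℂ)) = D := by ext; rfl
    rw [this]
    exact hasStrictFDerivAt_pi.mpr fun i => hasStrictFDerivAt_eval (F i) z
  have h0 : (fun i => eval z (F i)) = 0 := funext hz
  refine ⟨hF.localInverse, ?_, ?_, ?_⟩
  · simpa only [h0] using hF.localInverse_continuousAt
  · simpa only [h0] using hF.localInverse_apply_image
  · have := hF.eventually_right_inverse
    simp only [h0] at this
    exact this.mono fun y hy i => congrFun hy i

theorem eq_zero_of_eventually_eval_eq_zero {σ : Type*} [Fintype σ] {a : MvPolynomial σ ℂ}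
    (h : ∀ᶠ y in nhds (0 : σ → ℂ), eval y a = 0) : a = 0 := by
  obtain ⟨r, hr, hball⟩ := Metric.eventually_nhds_iff_ball.mp h
  refine funext_set (fun _ => Metric.ball (0 : ℂ) r)
    (fun _ => infinite_of_mem_nhds 0 (Metric.ball_mem_nhds 0 hr)) fun x hx => ?_
  rw [map_zero]
  refine hball x ?_
  rw [ball_pi _ hr]
  exact hx

theorem polyCombination_injective {σ : Type*} [Fintype σ] {F : σ → MvPolynomial σ ℂ}
    {Z : Finset (σ → ℂ)} (hZ : ∀ z ∈ Z, ∀ i, eval z (F i) = 0)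
    (hJ : ∀ z ∈ Z, ∀ w : σ → ℂ, (∀ i, ∑ j, eval z (pderiv j (F i)) * w j = 0) → w = 0)
    {e : Z → MvPolynomial σ ℂ} (he1 : ∀ z : Z, eval (z : σ → ℂ) (e z) = 1)
    (he0 : ∀ z w : Z, w ≠ z → eval (w : σ → ℂ) (e z) = 0) :
    Function.Injective (polyCombination F e) := by
  classical
  rw [← LinearMap.ker_eq_bot, LinearMap.ker_eq_bot']
  intro a ha
  rw [polyCombination_apply] at ha
  have hG := fun z : Z => exists_local_section F z (hZ z z.2) (hJ z z.2)
  choose G hGc hG0 hGF using hG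
  let M : (σ → ℂ) → Matrix Z Z ℂ := fun y w z => eval (G w y) (e z)
  have hMc : ContinuousAt (fun y => (M y).det) 0 := by
    have : ContinuousAt M 0 := continuousAt_pi.mpr fun w => continuousAt_pi.mpr fun z =>
      ContinuousAt.comp (g := fun x : σ → ℂ => eval x (e z))
        (MvPolynomial.continuous_eval (e z)).continuousAt (hGc w)
    exact (continuous_id.matrix_det (n := Z)).continuousAt.comp this
  have hM0 : M 0 = 1 := by
    ext w z
    by_cases h : w = z
    · subst h
      simp [M, hG0, he1]
    · simp [M, hG0, he0 z w h, h]
  have hdet : ∀ᶠ y in nhds (0 : σ → ℂ), (M y).det ≠ 0 :=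
    hMc.eventually_ne (by rw [hM0, Matrix.det_one]; exact one_ne_zero)
  funext z
  refine eq_zero_of_eventually_eval_eq_zero ?_
  filter_upwards [hdet, Filter.eventually_all.mpr hGF] with y hy hFy
  have hv : M y *ᵥ (fun z => eval y (a z)) = 0 := by
    funext w
    have := congrArg (eval (G w y)) ha
    simp only [map_sum, map_mul, eval_aeval, hFy, map_zero] at this
    simpa [Matrix.mulVec, dotProduct, M, mul_comm] using this
  exact congrFun (Matrix.eq_zero_of_mulVec_eq_zero hy hv) z

/-- The upper bound in the Bézout theorem: polynomials of degree at most `d` in `n` variables have at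
most `d ^ n` nondegenerate common zeros. -/
theorem card_le_pow_of_nondegenerate {σ : Type*} [Fintype σ] {d : ℕ} {F : σ → MvPolynomial σ ℂ}
    (hdeg : ∀ i, (F i).totalDegree ≤ d) {Z : Finset (σ → ℂ)}
    (hZ : ∀ z ∈ Z, ∀ i, eval z (F i) = 0)
    (hJ : ∀ z ∈ Z, ∀ w : σ → ℂ, (∀ i, ∑ j, eval z (pderiv j (F i)) * w j = 0) → w = 0) :
    Z.card ≤ d ^ Fintype.card σ := by
  choose e he1 he0 using fun z : Z => exists_interpolation z
  have hinj := polyCombination_injective hZ hJ he1 he0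
  set C := Finset.univ.sup fun z => (e z).totalDegree with hC
  refine le_pow_of_mul_choose_le (C := C) fun j => ?_
  have hmem : ∀ a, boundedCombination F e j a ∈ restrictTotalDegree σ ℂ (d * j + C) := by
    intro a
    rw [mem_restrictTotalDegree]
    obtain ⟨a', ha', hb⟩ := mem_range_boundedCombination.mp (LinearMap.mem_range_self _ a)
    rw [hb]
    refine totalDegree_finsetSum_le fun z _ => (totalDegree_mul _ _).trans (add_le_add ?_ ?_)
    · exact (totalDegree_aeval_le hdeg _).trans (Nat.mul_le_mul_left _ (ha' z))
    · exact Finset.le_sup (f := fun z => (e z).totalDegree) (Finset.mem_univ z)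
  have hinj' : Function.Injective
      ((boundedCombination F e j).codRestrict (restrictTotalDegree σ ℂ (d * j + C)) hmem) := by
    intro a b hab
    have h1 := hinj (congrArg Subtype.val hab)
    funext z
    exact Subtype.ext (congrFun h1 z)
  have := LinearMap.finrank_le_finrank_of_injective hinj'
  rwa [finrank_pi_restrictTotalDegree, finrank_restrictTotalDegree, Fintype.card_coe] at this

theorem homogeneousComponent_mul_of_isHomogeneous {σ k : Type*} [CommRing k] {d n : ℕ}
    {p : MvPolynomial σ k} (hp : p.IsHomogeneous d) (hdn : d ≤ n) (q : MvPolynomial σ k) :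
    homogeneousComponent n (p * q) = p * homogeneousComponent (n - d) q := by
  have hterm : ∀ i, homogeneousComponent n (p * homogeneousComponent i q) =
      if i = n - d then p * homogeneousComponent i q else 0 := by
    intro i
    rw [homogeneousComponent_of_mem (hp.mul (homogeneousComponent_isHomogeneous i q))]
    exact if_congr (by omega) rfl rfl
  conv_lhs => rw [← sum_homogeneousComponent q, Finset.mul_sum, map_sum]
  simp_rw [hterm]
  rw [Finset.sum_ite_eq']
  split_ifs with h
  · rfl
  · rw [homogeneousComponent_eq_zero, mul_zero]
    simp only [Finset.mem_range, not_lt] at h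
    omega

theorem totalDegree_sub_homogeneousComponent_le {σ k : Type*} [CommRing k] {n : ℕ}
    {p : MvPolynomial σ k} (hp : p.totalDegree ≤ n) :
    (p - homogeneousComponent n p).totalDegree ≤ n - 1 := by
  refine Finset.sup_le fun s hs => ?_
  rw [mem_support_iff, coeff_sub, coeff_homogeneousComponent] at hs
  split_ifs at hs with h
  · simp at hs
  · rw [sub_zero] at hs
    have := (le_totalDegree (mem_support_iff.mpr hs)).trans hp
    rw [Finsupp.degree_apply] at h
    simp only [Finsupp.sum] at this ⊢
    omega

theorem exists_forall_isHomogeneous_mem_span {σ : Type*} [Fintype σ] {P : σ → MvPolynomial σ ℂ}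
    (hP : ∀ x : σ → ℂ, (∀ i, eval x (P i) = 0) → x = 0) :
    ∃ K, ∀ n, K ≤ n → ∀ g : MvPolynomial σ ℂ, g.IsHomogeneous n →
      g ∈ Ideal.span (Set.range P) := by
  set I := Ideal.span (Set.range P)
  have hX : ∀ i, (X i : MvPolynomial σ ℂ) ∈ I.radical := by
    intro i
    rw [← vanishingIdeal_zeroLocus_eq_radical (K := ℂ)]
    intro x hx
    have : x = 0 := hP x fun i => hx _ (Ideal.subset_span ⟨i, rfl⟩)
    simp [this]
  obtain ⟨r, hr⟩ := I.exists_radical_pow_le_of_fg (IsNoetherian.noetherian _)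
  refine ⟨r, fun n hn g hg => hr (Ideal.pow_le_pow_right hn ?_)⟩
  rw [g.as_sum]
  refine Ideal.sum_mem _ fun s hs => ?_
  have hsn : n = ∑ i ∈ s.support, s i := hg.degree_eq_sum_deg_support hs
  rw [monomial_eq, hsn, ← Finset.prod_pow_eq_pow_sum]
  exact Ideal.mul_mem_left _ _ (Ideal.prod_mem_prod fun i _ => Ideal.pow_mem_pow (hX i) _)

/-- Polynomials of degree at most `d * j + K` lie in the `j`-th step of any increasing filtration
that multiplication by each `F i` shifts by one and whose bottom step contains all polynomials of
degree at most `K`, if the top forms of the `F i` generate all forms of degree at least `K`. -/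
theorem mem_filtration_of_totalDegree_le {σ : Type*} [Fintype σ] {d K : ℕ}
    {P F : σ → MvPolynomial σ ℂ} (hd : 0 < d) (hPhom : ∀ i, (P i).IsHomogeneous d)
    (hPF : ∀ i, (F i - P i).totalDegree < d) (hdK : d ≤ K)
    (hK : ∀ n, K ≤ n → ∀ g : MvPolynomial σ ℂ, g.IsHomogeneous n → g ∈ Ideal.span (Set.range P))
    {E : ℕ → Submodule ℂ (MvPolynomial σ ℂ)} (hmono : Monotone E)
    (hmul : ∀ j i, ∀ b ∈ E j, F i * b ∈ E (j + 1)) (h0 : ∀ g, g.totalDegree ≤ K → g ∈ E 0)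
    (n : ℕ) : ∀ (j : ℕ) (g : MvPolynomial σ ℂ), g.totalDegree ≤ n → n ≤ d * j + K → g ∈ E j := by
  induction n using Nat.strong_induction_on with
  | _ n ih =>
  intro j g hg hn
  by_cases hnK : n ≤ K
  · exact hmono (Nat.zero_le j) (h0 g (hg.trans hnK))
  obtain ⟨j, rfl⟩ : ∃ j', j = j' + 1 := by
    refine Nat.exists_eq_succ_of_ne_zero ?_
    rintro rfl
    omega
  obtain ⟨c, hc⟩ := Ideal.mem_span_range_iff_exists_fun.mp
    (hK n (by omega) _ (homogeneousComponent_isHomogeneous n g))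
  set h : σ → MvPolynomial σ ℂ := fun i => homogeneousComponent (n - d) (c i)
  have hh : ∀ i, (h i).totalDegree ≤ n - d := fun i =>
    (homogeneousComponent_isHomogeneous _ _).totalDegree_le
  have hcomp : homogeneousComponent n g = ∑ i, P i * h i := by
    have := congrArg (homogeneousComponent n) hc
    rw [map_sum, homogeneousComponent_eq_self (homogeneousComponent_isHomogeneous n g)] at this
    rw [← this]
    refine Finset.sum_congr rfl fun i _ => ?_
    rw [mul_comm, homogeneousComponent_mul_of_isHomogeneous (hPhom i) (by omega)]
  have hsplit : g = ∑ i, F i * h i +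
      ((g - homogeneousComponent n g) - ∑ i, (F i - P i) * h i) := by
    rw [hcomp]
    simp only [sub_mul, Finset.sum_sub_distrib]
    ring
  rw [hsplit]
  refine Submodule.add_mem _ (Submodule.sum_mem _ fun i _ => hmul j i _ ?_) ?_
  · refine ih (n - d) (by omega) j _ (hh i) ?_
    have : d * (j + 1) = d * j + d := by ring
    omega
  · refine ih (n - 1) (by omega) (j + 1) _ ?_ (by omega)
    refine (totalDegree_sub _ _).trans (max_le (totalDegree_sub_homogeneousComponent_le hg) ?_)
    refine totalDegree_finsetSum_le fun i _ => (totalDegree_mul _ _).trans ?_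
    have := hh i
    have := hPF i
    omega

theorem sub_linearization_mem_sq {σ : Type*} [Fintype σ] (z : σ → ℂ) (p : MvPolynomial σ ℂ) :
    p - (C (eval z p) + ∑ j, C (eval z (pderiv j p)) * (X j - C (z j))) ∈
      (vanishingIdeal ℂ {z} : Ideal (MvPolynomial σ ℂ)) ^ 2 := by
  classical
  induction p using MvPolynomial.induction_on with
  | C a => simp
  | add p q hp hq =>
    convert Ideal.add_mem _ hp hq using 1
    simp only [map_add, add_mul, Finset.sum_add_distrib]
    ring
  | mul_X p i hp =>
    have h1 : (X i - C (z i)) * (p - C (eval z p)) ∈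
        (vanishingIdeal ℂ {z} : Ideal (MvPolynomial σ ℂ)) ^ 2 := by
      rw [pow_two]
      refine Ideal.mul_mem_mul ?_ ?_ <;> simp
    convert Ideal.add_mem _ (Ideal.mul_mem_left _ (C (z i)) hp) h1 using 1
    have : ∑ j, C (eval z (pderiv j (p * X i))) * (X j - C (z j)) =
        C (z i) * ∑ j, C (eval z (pderiv j p)) * (X j - C (z j)) +
          C (eval z p) * (X i - C (z i)) := by
      simp only [Derivation.leibniz, pderiv_X, smul_eq_mul, map_add, map_mul, eval_X, add_mul,
        Finset.sum_add_distrib, Finset.mul_sum]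
      rw [add_comm]
      congr 1
      · exact Finset.sum_congr rfl fun j _ => by ring
      · rw [Finset.sum_eq_single i]
        · simp
        · intro j _ hj
          simp [hj]
        · simp
    rw [this]
    simp only [map_mul, eval_X]
    ring

theorem vanishingIdeal_singleton_le_sup_sq {σ : Type*} [Fintype σ] {F : σ → MvPolynomial σ ℂ}
    {z : σ → ℂ} (hz : ∀ i, eval z (F i) = 0)
    (hJ : ∀ w : σ → ℂ, (∀ i, ∑ j, eval z (pderiv j (F i)) * w j = 0) → w = 0) :
    (vanishingIdeal ℂ {z} : Ideal (MvPolynomial σ ℂ)) ≤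
      Ideal.span (Set.range F) ⊔ vanishingIdeal ℂ {z} ^ 2 := by
  classical
  set I := Ideal.span (Set.range F)
  set m : Ideal (MvPolynomial σ ℂ) := vanishingIdeal ℂ {z}
  let J : Matrix σ σ ℂ := fun i j => eval z (pderiv j (F i))
  have hJu : IsUnit J := by
    rw [← Matrix.mulVec_injective_iff_isUnit]
    refine (injective_iff_map_eq_zero (Matrix.mulVecLin J)).mpr fun w hw => hJ w fun i => ?_
    exact congrFun hw i
  have hlin : ∀ i, ∑ j, C (J i j) * (X j - C (z j)) ∈ I ⊔ m ^ 2 := by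
    intro i
    have h1 : F i ∈ I ⊔ m ^ 2 := Ideal.mem_sup_left (Ideal.subset_span ⟨i, rfl⟩)
    have h2 := Ideal.mem_sup_right (S := I) (sub_linearization_mem_sq z (F i))
    have := Ideal.sub_mem _ h1 h2
    rwa [hz i, map_zero, zero_add, sub_sub_cancel] at this
  have hX : ∀ j, (X j - C (z j) : MvPolynomial σ ℂ) ∈ I ⊔ m ^ 2 := by
    intro j
    have h1 : (X j - C (z j) : MvPolynomial σ ℂ) =
        ∑ i, C (J⁻¹ j i) * ∑ k, C (J i k) * (X k - C (z k)) := by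
      have hinv : ∀ k, ∑ i, J⁻¹ j i * J i k = (1 : Matrix σ σ ℂ) j k := fun k => by
        rw [← Matrix.nonsing_inv_mul J ((Matrix.isUnit_iff_isUnit_det J).mp hJu), Matrix.mul_apply]
      simp_rw [Finset.mul_sum]
      rw [Finset.sum_comm]
      simp_rw [← mul_assoc, ← Finset.sum_mul, ← map_mul, ← map_sum, hinv]
      rw [Finset.sum_eq_single j]
      · simp
      · intro k _ hk
        simp [Matrix.one_apply_ne (Ne.symm hk)]
      · simp
    rw [h1]
    exact Ideal.sum_mem _ fun i _ => Ideal.mul_mem_left _ _ (hlin i)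
  intro p hp
  have h0 : eval z p = 0 := by simpa [m] using hp
  have h1 := Ideal.mem_sup_right (S := I) (sub_linearization_mem_sq z p)
  have h2 : ∑ j, C (eval z (pderiv j p)) * (X j - C (z j)) ∈ I ⊔ m ^ 2 :=
    Ideal.sum_mem _ fun j _ => Ideal.mul_mem_left _ _ (hX j)
  have := Ideal.add_mem _ h1 h2
  rwa [h0, map_zero, zero_add, sub_add_cancel] at this

theorem Ideal.prod_sup_le_sup_prod {R ι : Type*} [CommRing R] (I : Ideal R) (a : ι → Ideal R)
    (s : Finset ι) : ∏ i ∈ s, (I ⊔ a i) ≤ I ⊔ ∏ i ∈ s, a i := by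
  classical
  induction s using Finset.induction_on with
  | empty => simp
  | insert i s hi ih =>
    rw [Finset.prod_insert hi, Finset.prod_insert hi]
    refine (Ideal.mul_mono_right ih).trans ?_
    rw [Ideal.mul_sup, Ideal.sup_mul, Ideal.sup_mul]
    exact sup_le (le_sup_of_le_left (sup_le Ideal.mul_le_left Ideal.mul_le_right))
      (sup_le_sup Ideal.mul_le_left le_rfl)

theorem Ideal.radical_le_of_radical_le_sup_sq {R : Type*} [CommRing R] [IsNoetherianRing R]
    {I : Ideal R} (h : I.radical ≤ I ⊔ I.radical ^ 2) : I.radical ≤ I := by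
  obtain ⟨r, hr⟩ := I.exists_radical_pow_le_of_fg (IsNoetherian.noetherian _)
  have key : ∀ k, I.radical ≤ I ⊔ I.radical ^ (k + 1) := by
    intro k
    induction k with
    | zero => simp
    | succ k ih =>
      refine ih.trans (sup_le le_sup_left ?_)
      calc I.radical ^ (k + 1) = I.radical ^ k * I.radical := pow_succ _ _
        _ ≤ I.radical ^ k * (I ⊔ I.radical ^ 2) := Ideal.mul_mono_right h
        _ = I.radical ^ k * I ⊔ I.radical ^ (k + 1 + 1) := by rw [Ideal.mul_sup, ← pow_add]
        _ ≤ I ⊔ I.radical ^ (k + 1 + 1) := sup_le_sup_right Ideal.mul_le_right _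
  exact (key r).trans (sup_le le_rfl ((Ideal.pow_le_pow_right (Nat.le_succ r)).trans hr))

theorem mem_span_of_nondegenerate {σ : Type*} [Fintype σ] {F : σ → MvPolynomial σ ℂ}
    {Z : Finset (σ → ℂ)} (hZ : ∀ z, z ∈ Z ↔ ∀ i, eval z (F i) = 0)
    (hJ : ∀ z ∈ Z, ∀ w : σ → ℂ, (∀ i, ∑ j, eval z (pderiv j (F i)) * w j = 0) → w = 0)
    {b : MvPolynomial σ ℂ} (hb : ∀ z ∈ Z, eval z b = 0) : b ∈ Ideal.span (Set.range F) := by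
  set I := Ideal.span (Set.range F) with hI
  have hloc : zeroLocus ℂ I = Z := by
    rw [hI, zeroLocus_span]
    ext z
    simp [hZ]
  have hrad : I.radical = ∏ z ∈ Z, (vanishingIdeal ℂ {z} : Ideal (MvPolynomial σ ℂ)) := by
    rw [Ideal.prod_eq_iInf_of_pairwise_isCoprime, ← vanishingIdeal_zeroLocus_eq_radical (K := ℂ),
      hloc]
    · ext p
      simp
    · intro z _ w _ hzw
      refine Ideal.isCoprime_of_isMaximal fun h => hzw ?_
      funext i
      have h' : (vanishingIdeal ℂ {z} : Ideal (MvPolynomial σ ℂ)) = vanishingIdeal ℂ {w} := h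
      have : (X i - C (z i) : MvPolynomial σ ℂ) ∈ (vanishingIdeal ℂ {w} : Ideal _) := by
        rw [← h']
        simp
      rw [mem_vanishingIdeal_singleton_iff] at this
      simpa [sub_eq_zero, eq_comm] using this
  refine Ideal.radical_le_of_radical_le_sup_sq ?_ ?_
  · calc I.radical = ∏ z ∈ Z, (vanishingIdeal ℂ {z} : Ideal (MvPolynomial σ ℂ)) := hrad
      _ ≤ ∏ z ∈ Z, (I ⊔ (vanishingIdeal ℂ {z} : Ideal (MvPolynomial σ ℂ)) ^ 2) :=
        Finset.prod_le_prod' fun z hz =>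
          vanishingIdeal_singleton_le_sup_sq ((hZ z).mp hz) (hJ z hz)
      _ ≤ I ⊔ ∏ z ∈ Z, (vanishingIdeal ℂ {z} : Ideal (MvPolynomial σ ℂ)) ^ 2 :=
        Ideal.prod_sup_le_sup_prod _ _ _
      _ = I ⊔ I.radical ^ 2 := by rw [Finset.prod_pow, hrad]
  · rw [← vanishingIdeal_zeroLocus_eq_radical (K := ℂ), hloc]
    exact fun z hz => by simpa using hb z hz

/-- The lower bound in the Bézout theorem: polynomials of degree `d` without common zeros at infinity,
all of whose common zeros are nondegenerate, have at least `d ^ n` common zeros if they have any. -/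
theorem pow_le_card {σ : Type*} [Fintype σ] {d : ℕ} {P F : σ → MvPolynomial σ ℂ} (hd : 0 < d)
    (hPhom : ∀ i, (P i).IsHomogeneous d)
    (hP : ∀ x : σ → ℂ, (∀ i, eval x (P i) = 0) → x = 0)
    (hPF : ∀ i, (F i - P i).totalDegree < d) {Z : Finset (σ → ℂ)}
    (hZ : ∀ z, z ∈ Z ↔ ∀ i, eval z (F i) = 0) (hZne : Z.Nonempty)
    (hJ : ∀ z ∈ Z, ∀ w : σ → ℂ, (∀ i, ∑ j, eval z (pderiv j (F i)) * w j = 0) → w = 0) :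
    d ^ Fintype.card σ ≤ Z.card := by
  obtain ⟨K, hdK, hK⟩ : ∃ K, d ≤ K ∧ ∀ n, K ≤ n → ∀ g : MvPolynomial σ ℂ, g.IsHomogeneous n →
      g ∈ Ideal.span (Set.range P) := by
    obtain ⟨K, hK⟩ := exists_forall_isHomogeneous_mem_span hP
    exact ⟨max K d, le_max_right _ _, fun n hn => hK n ((le_max_left _ _).trans hn)⟩
  let B := Module.finBasis ℂ (restrictTotalDegree σ ℂ K)
  let s : _ → MvPolynomial σ ℂ := fun k => (B k : MvPolynomial σ ℂ)
  have hB : ∀ g : MvPolynomial σ ℂ, g.totalDegree ≤ K →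
      ∃ c : Fin _ → ℂ, g = ∑ k, c k • s k := by
    intro g hg
    refine ⟨B.repr ⟨g, (mem_restrictTotalDegree _ _ _).mpr hg⟩, ?_⟩
    have := congrArg Subtype.val (B.sum_repr ⟨g, (mem_restrictTotalDegree _ _ _).mpr hg⟩)
    rw [AddSubmonoidClass.coe_finsetSum] at this
    exact this.symm
  have hs : ∀ b : MvPolynomial σ ℂ, ∃ a : _ → MvPolynomial σ ℂ,
      b = ∑ k, (aeval F : MvPolynomial σ ℂ →ₐ[ℂ] _).toRingHom (a k) * s k := by
    intro b
    have := mem_filtration_of_totalDegree_le hd hPhom hPF hdK hK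
      (E := fun _ => LinearMap.range (polyCombination F s)) monotone_const ?_ ?_
      b.totalDegree b.totalDegree b le_rfl
      ((Nat.le_mul_of_pos_left _ hd).trans (Nat.le_add_right _ _))
    · obtain ⟨a, rfl⟩ := this
      exact ⟨a, polyCombination_apply F s a⟩
    · rintro - i _ ⟨a, rfl⟩
      refine ⟨fun k => X i * a k, ?_⟩
      simp only [polyCombination_apply, map_mul, aeval_X, Finset.mul_sum, mul_assoc]
    · intro g hg
      obtain ⟨c, hc⟩ := hB g hg
      refine ⟨fun k => C (c k), ?_⟩
      rw [polyCombination_apply, hc]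
      simp [smul_eq_C_mul]
  choose e he1 he0 using fun z : Z => exists_interpolation z
  have hIm : Ideal.span (Set.range F) ≤
      (RingHom.ker (eval (0 : σ → ℂ))).map (aeval F : _ →ₐ[ℂ] _).toRingHom := by
    rw [Ideal.span_le]
    rintro _ ⟨i, rfl⟩
    have := Ideal.mem_map_of_mem (aeval F : MvPolynomial σ ℂ →ₐ[ℂ] MvPolynomial σ ℂ).toRingHom
      (show (X i : MvPolynomial σ ℂ) ∈ RingHom.ker (eval (0 : σ → ℂ)) by simp [RingHom.mem_ker])
    simpa using this
  obtain ⟨f, hf, hfe⟩ := exists_sub_one_mem_forall_mul_eq_sum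
    (aeval F : MvPolynomial σ ℂ →ₐ[ℂ] MvPolynomial σ ℂ).toRingHom
    (RingHom.ker (eval (0 : σ → ℂ))) e s hs (fun b => ⟨fun z => C (eval (z : σ → ℂ) b), by
      refine hIm (mem_span_of_nondegenerate hZ hJ fun w hw => ?_)
      rw [map_sub, map_sum, Finset.sum_eq_single ⟨w, hw⟩]
      · simp [he1 ⟨w, hw⟩]
      · intro z _ hz
        simp [he0 z ⟨w, hw⟩ hz.symm]
      · simp⟩)
  have hf0 : aeval F f ≠ 0 := by
    obtain ⟨z, hz⟩ := hZne
    intro h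
    have h1 := congrArg (eval z) h
    rw [eval_aeval, funext ((hZ z).mp hz), map_zero] at h1
    have h2 : eval (0 : σ → ℂ) f = 0 := h1
    rw [RingHom.mem_ker, map_sub, map_one, h2] at hf
    norm_num at hf
  choose a ha using fun k => hfe (s k)
  let c := Finset.univ.sup fun k => Finset.univ.sup fun z => (a k z).totalDegree
  have hfilt : ∀ j, ∀ g : MvPolynomial σ ℂ, g.totalDegree ≤ d * j + K →
      aeval F f * g ∈ LinearMap.range (boundedCombination F e (j + c)) := by
    intro j g hg
    refine mem_filtration_of_totalDegree_le hd hPhom hPF hdK hK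
      (E := fun j => (LinearMap.range (boundedCombination F e (j + c))).comap
        (LinearMap.mulLeft ℂ (aeval F f))) ?_ ?_ ?_ _ j g hg le_rfl
    · intro j j' hj g hg
      obtain ⟨a, ha, hb⟩ := mem_range_boundedCombination.mp hg
      exact mem_range_boundedCombination.mpr ⟨a, fun z => (ha z).trans (by omega), hb⟩
    · intro j i b hb
      obtain ⟨a, ha, hb⟩ := mem_range_boundedCombination.mp hb
      refine mem_range_boundedCombination.mpr ⟨fun z => X i * a z, fun z => ?_, ?_⟩
      · refine (totalDegree_mul _ _).trans ?_
        rw [totalDegree_X]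
        have := ha z
        omega
      · simp only [LinearMap.mulLeft_apply] at hb ⊢
        rw [mul_left_comm, hb, Finset.mul_sum]
        simp [mul_assoc]
    · intro g hg
      obtain ⟨b, rfl⟩ := hB g hg
      refine Submodule.sum_mem _ fun k _ => Submodule.smul_mem _ _ ?_
      refine mem_range_boundedCombination.mpr ⟨a k, fun z => ?_, ha k⟩
      rw [zero_add]
      exact (Finset.le_sup (f := fun z => (a k z).totalDegree) (Finset.mem_univ z)).trans
        (Finset.le_sup (f := fun k => Finset.univ.sup fun z => (a k z).totalDegree)
          (Finset.mem_univ k))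
  refine pow_le_of_choose_le_mul (C := c) fun j => ?_
  let T : restrictTotalDegree σ ℂ (d * j) →ₗ[ℂ] LinearMap.range (boundedCombination F e (j + c)) :=
    (LinearMap.mulLeft ℂ (aeval F f) ∘ₗ (restrictTotalDegree σ ℂ (d * j)).subtype).codRestrict _
      fun g => hfilt j g (((mem_restrictTotalDegree _ _ _).mp g.2).trans (Nat.le_add_right _ _))
  have hT : Function.Injective T := fun g g' h =>
    Subtype.ext (mul_left_cancel₀ hf0 (congrArg Subtype.val h))
  have h1 := LinearMap.finrank_le_finrank_of_injective hT
  have h2 := LinearMap.finrank_range_le (boundedCombination F e (j + c))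
  rw [finrank_pi_restrictTotalDegree, Fintype.card_coe] at h2
  rw [finrank_restrictTotalDegree] at h1
  exact h1.trans h2

/-- The Bézout theorem for polynomials without common zeros at infinity, all of whose common zeros are
nondegenerate. -/
theorem exists_zero_finset_card_eq_pow {σ : Type*} [Fintype σ] {d : ℕ} {P F : σ → MvPolynomial σ ℂ}
    (hd : 0 < d) (hPhom : ∀ i, (P i).IsHomogeneous d)
    (hP : ∀ x : σ → ℂ, (∀ i, eval x (P i) = 0) → x = 0)
    (hPF : ∀ i, (F i - P i).totalDegree < d) (hne : ∃ z : σ → ℂ, ∀ i, eval z (F i) = 0)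
    (hJ : ∀ z : σ → ℂ, (∀ i, eval z (F i) = 0) →
      ∀ w : σ → ℂ, (∀ i, ∑ j, eval z (pderiv j (F i)) * w j = 0) → w = 0) :
    ∃ Z : Finset (σ → ℂ), (∀ z, z ∈ Z ↔ ∀ i, eval z (F i) = 0) ∧ Z.card = d ^ Fintype.card σ := by
  have hdeg : ∀ i, (F i).totalDegree ≤ d := fun i => by
    rw [← sub_add_cancel (F i) (P i)]
    exact (totalDegree_add _ _).trans (max_le (hPF i).le (hPhom i).totalDegree_le)
  have hfin : {z : σ → ℂ | ∀ i, eval z (F i) = 0}.Finite := by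
    by_contra hinf
    obtain ⟨Z, hZ, hcard⟩ := Set.Infinite.exists_subset_card_eq hinf (d ^ Fintype.card σ + 1)
    have := card_le_pow_of_nondegenerate hdeg (fun z hz => hZ hz) fun z hz => hJ z (hZ hz)
    omega
  have hZ : ∀ z, z ∈ hfin.toFinset ↔ ∀ i, eval z (F i) = 0 := fun z => by simp
  refine ⟨hfin.toFinset, hZ, le_antisymm ?_ ?_⟩
  · exact card_le_pow_of_nondegenerate hdeg (fun z hz => (hZ z).mp hz)
      fun z hz => hJ z ((hZ z).mp hz)
  · exact pow_le_card hd hPhom hP hPF hZ (hne.imp fun z hz => (hZ z).mpr hz)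
      fun z hz => hJ z ((hZ z).mp hz)

theorem MvPolynomial.IsHomogeneous.eval_smul {σ k : Type*} [CommRing k] {d : ℕ}
    {p : MvPolynomial σ k} (hp : p.IsHomogeneous d) (t : k) (x : σ → k) :
    eval (t • x) p = t ^ d * eval x p := by
  rw [eval_eq, eval_eq, Finset.mul_sum]
  refine Finset.sum_congr rfl fun s hs => ?_
  have hd : d = ∑ i ∈ s.support, s i := hp.degree_eq_sum_deg_support hs
  simp only [Pi.smul_apply, smul_eq_mul, mul_pow, Finset.prod_mul_distrib,
    Finset.prod_pow_eq_pow_sum, ← hd]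
  ring

/-- `x` is an eigenvector with eigenvalue `μ` of the polynomial self-map `p` of `σ → ℂ`. -/
def IsEigenpair {σ : Type*} (p : σ → MvPolynomial σ ℂ) (x : σ → ℂ) (μ : ℂ) : Prop :=
  x ≠ 0 ∧ ∀ i, eval x (p i) = μ * x i

/-- The lines spanned by the eigenvectors of `p`. -/
def eigenlines {σ : Type*} (p : σ → MvPolynomial σ ℂ) : Set (Submodule ℂ (σ → ℂ)) :=
  {L | ∃ x μ, IsEigenpair p x μ ∧ L = Submodule.span ℂ {x}}

/-- Every eigenvector of `p` is a nondegenerate fixed point of the induced self-map of projective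
space. -/
def IsNondegenerate {σ : Type*} [Fintype σ] (p : σ → MvPolynomial σ ℂ) : Prop :=
  ∀ x μ, IsEigenpair p x μ → ∀ (w : σ → ℂ) (c : ℂ),
    (∀ i, ∑ j, eval x (pderiv j (p i)) * w j = μ * w i + c * x i) → w ∈ Submodule.span ℂ {x}

theorem isEigenpair_add_mul_X {σ : Type*} {p : σ → MvPolynomial σ ℂ} {q : MvPolynomial σ ℂ}
    {x : σ → ℂ} {μ : ℂ} :
    IsEigenpair (fun i => p i + q * X i) x (μ + eval x q) ↔ IsEigenpair p x μ := by
  simp only [IsEigenpair, map_add, map_mul, eval_X, add_mul, add_left_inj]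

theorem eigenlines_add_mul_X {σ : Type*} (p : σ → MvPolynomial σ ℂ) (q : MvPolynomial σ ℂ) :
    eigenlines (fun i => p i + q * X i) = eigenlines p := by
  ext L
  refine exists_congr fun x => ⟨?_, ?_⟩
  · rintro ⟨μ, h, hL⟩
    rw [← sub_add_cancel μ (eval x q)] at h
    exact ⟨_, isEigenpair_add_mul_X.mp h, hL⟩
  · rintro ⟨μ, h, hL⟩
    exact ⟨_, isEigenpair_add_mul_X.mpr h, hL⟩

theorem IsNondegenerate.add_mul_X {σ : Type*} [Fintype σ] {p : σ → MvPolynomial σ ℂ}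
    (hp : IsNondegenerate p) (q : MvPolynomial σ ℂ) :
    IsNondegenerate (fun i => p i + q * X i) := by
  classical
  intro x μ h w c hw
  rw [← sub_add_cancel μ (eval x q)] at h
  refine hp x _ (isEigenpair_add_mul_X.mp h) w (c - ∑ j, eval x (pderiv j q) * w j) fun i => ?_
  have h1 : ∑ j, eval x (pderiv j (p i + q * X i)) * w j =
      ∑ j, eval x (pderiv j (p i)) * w j + (∑ j, eval x (pderiv j q) * w j) * x i +
        eval x q * w i := by
    simp only [map_add, Derivation.leibniz, pderiv_X, smul_eq_mul, map_mul, eval_X, add_mul,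
      Finset.sum_add_distrib, Finset.sum_mul]
    have h2 : ∑ j, eval x q * eval x (Pi.single (M := fun _ => MvPolynomial σ ℂ) j 1 i) * w j =
        eval x q * w i := by
      rw [Finset.sum_eq_single i]
      · simp
      · intro j _ hj
        simp [hj.symm]
      · simp
    rw [h2, add_assoc, add_comm (eval x q * w i)]
    congr 2
    exact Finset.sum_congr rfl fun j _ => by ring
  have := hw i
  rw [h1] at this
  linear_combination this

theorem IsEigenpair.smul {σ : Type*} {p : σ → MvPolynomial σ ℂ} {d : ℕ}
    (hp : ∀ i, (p i).IsHomogeneous (d + 1)) {x : σ → ℂ} {μ t : ℂ} (h : IsEigenpair p x μ)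
    (ht : t ≠ 0) : IsEigenpair p (t • x) (t ^ d * μ) := by
  refine ⟨smul_ne_zero ht h.1, fun i => ?_⟩
  rw [(hp i).eval_smul, h.2, Pi.smul_apply, smul_eq_mul]
  ring

theorem IsEigenpair.eigenvalue_unique {σ : Type*} {p : σ → MvPolynomial σ ℂ} {x : σ → ℂ} {μ ν : ℂ}
    (h : IsEigenpair p x μ) (h' : IsEigenpair p x ν) : μ = ν := by
  obtain ⟨i, hi⟩ := Function.ne_iff.mp h.1
  exact mul_right_cancel₀ hi ((h.2 i).symm.trans (h'.2 i))

theorem exists_smul_eq_of_span_singleton_eq {V : Type*} [AddCommGroup V] [Module ℂ V] {x y : V}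
    (hx : x ≠ 0) (h : Submodule.span ℂ {x} = Submodule.span ℂ {y}) :
    ∃ t : ℂ, t ≠ 0 ∧ t • y = x := by
  obtain ⟨t, ht⟩ := Submodule.mem_span_singleton.mp (h ▸ Submodule.mem_span_singleton_self x)
  refine ⟨t, ?_, ht⟩
  rintro rfl
  exact hx (by rw [← ht, zero_smul])

theorem exists_eval_add_eigenvalue_ne_zero {σ : Type*} [Fintype σ] {p : σ → MvPolynomial σ ℂ}
    {d : ℕ} (hp : ∀ i, (p i).IsHomogeneous (d + 1)) (hfin : (eigenlines p).Finite) :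
    ∃ q : MvPolynomial σ ℂ, q.IsHomogeneous d ∧ ∀ x μ, IsEigenpair p x μ → μ + eval x q ≠ 0 := by
  classical
  have := hfin.to_subtype
  choose v ν hv hL using fun L : eigenlines p => L.2
  obtain ⟨f, hf⟩ := Module.exists_dual_forall_apply_ne_zero (K := ℂ) v fun L => (hv L).1
  obtain ⟨c, hc⟩ : ∃ c, c ∉ Set.range fun L => -ν L / f (v L) ^ d :=
    (Set.finite_range _).exists_notMem
  let l : MvPolynomial σ ℂ := ∑ j, C (f (Pi.single j 1)) * X j
  have hl : ∀ x, eval x l = f x := fun x => by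
    have hx : x = ∑ j, x j • (Pi.single j 1 : σ → ℂ) := pi_eq_sum_univ' x
    conv_rhs => rw [hx]
    simp [l, mul_comm]
  have hlhom : l.IsHomogeneous 1 := IsHomogeneous.sum _ _ _ fun j _ => isHomogeneous_C_mul_X _ _
  refine ⟨C c * l ^ d, by simpa using (hlhom.pow d).C_mul c, fun x μ hx h => ?_⟩
  obtain ⟨L, hLx⟩ : ∃ L : eigenlines p, (L : Submodule ℂ (σ → ℂ)) = Submodule.span ℂ {x} :=
    ⟨⟨_, x, μ, hx, rfl⟩, rfl⟩
  obtain ⟨t, ht, rfl⟩ := exists_smul_eq_of_span_singleton_eq hx.1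
    (hLx.symm.trans (hL L))
  rw [hx.eigenvalue_unique ((hv L).smul hp ht), map_mul, map_pow, hl, eval_C, map_smul,
    smul_eq_mul, mul_pow] at h
  have h' : t ^ d * (ν L + c * f (v L) ^ d) = 0 := by linear_combination h
  refine hc ⟨L, ?_⟩
  have h2 := (mul_eq_zero.mp h').resolve_left (pow_ne_zero d ht)
  have := pow_ne_zero d (hf L)
  field_simp
  linear_combination -h2

theorem card_filter_span_eq {σ : Type*} {p : σ → MvPolynomial σ ℂ} {d : ℕ} (hd : 0 < d)
    (hp : ∀ i, (p i).IsHomogeneous (d + 1)) {T : Finset (σ → ℂ)}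
    (hT : ∀ x, x ∈ T ↔ IsEigenpair p x 1) {x₀ : σ → ℂ} {μ₀ : ℂ} (h₀ : IsEigenpair p x₀ μ₀)
    (hμ₀ : μ₀ ≠ 0) [DecidablePred fun x : σ → ℂ => Submodule.span ℂ {x} = Submodule.span ℂ {x₀}] :
    (T.filter fun x => Submodule.span ℂ {x} = Submodule.span ℂ {x₀}).card = d := by
  classical
  have hζ := Complex.isPrimitiveRoot_exp d hd.ne'
  have himage : (T.filter fun x => Submodule.span ℂ {x} = Submodule.span ℂ {x₀}) =
      (Polynomial.nthRoots d μ₀⁻¹).toFinset.image fun t => t • x₀ := by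
    ext x
    simp only [Finset.mem_filter, Finset.mem_image, Multiset.mem_toFinset,
      Polynomial.mem_nthRoots hd, hT]
    constructor
    · rintro ⟨hx, hspan⟩
      obtain ⟨t, ht, rfl⟩ := exists_smul_eq_of_span_singleton_eq hx.1 hspan
      exact ⟨t, eq_inv_of_mul_eq_one_left ((h₀.smul hp ht).eigenvalue_unique hx), rfl⟩
    · rintro ⟨t, ht, rfl⟩
      have ht0 : t ≠ 0 := by
        rintro rfl
        rw [zero_pow hd.ne'] at ht
        exact inv_ne_zero hμ₀ ht.symm
      refine ⟨?_, Submodule.span_singleton_smul_eq (IsUnit.mk0 t ht0) x₀⟩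
      simpa [ht, hμ₀] using h₀.smul hp ht0
  rw [himage, Finset.card_image_of_injective _ (smul_left_injective ℂ h₀.1),
    Multiset.toFinset_card_of_nodup (hζ.nthRoots_nodup (inv_ne_zero hμ₀)), hζ.card_nthRoots,
    if_pos (IsAlgClosed.exists_pow_nat_eq _ hd)]

theorem ncard_eigenlines_of_eigenvalue_ne_zero {σ : Type*} [Fintype σ] {p : σ → MvPolynomial σ ℂ}
    {d : ℕ} (hd : 0 < d) (hp : ∀ i, (p i).IsHomogeneous (d + 1)) (hfin : (eigenlines p).Finite)
    (hnd : IsNondegenerate p) (hμ : ∀ x μ, IsEigenpair p x μ → μ ≠ 0) :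
    (eigenlines p).ncard = ∑ i ∈ Finset.range (Fintype.card σ), (d + 1) ^ i := by
  classical
  have hJ : ∀ (z w : σ → ℂ) i, ∑ j, eval z (pderiv j (p i - X i)) * w j =
      ∑ j, eval z (pderiv j (p i)) * w j - w i := by
    intro z w i
    simp only [map_sub, sub_mul, Finset.sum_sub_distrib, pderiv_X]
    congr 1
    rw [Finset.sum_eq_single i]
    · simp
    · intro j _ hj
      simp [hj.symm]
    · simp
  have hzero : ∀ i, eval (0 : σ → ℂ) (p i) = 0 := fun i => by
    simpa using (hp i).eval_smul 0 0
  have htriv : ∀ x : σ → ℂ, (∀ i, eval x (p i) = 0) → x = 0 := by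
    intro x hx
    by_contra h
    exact hμ x 0 ⟨h, by simpa using hx⟩ rfl
  have hlow : ∀ i, (p i - X i - p i).totalDegree < d + 1 := by
    intro i
    simpa using hd
  have hregular : ∀ z : σ → ℂ, (∀ i, eval z (p i - X i) = 0) → ∀ w : σ → ℂ,
      (∀ i, ∑ j, eval z (pderiv j (p i - X i)) * w j = 0) → w = 0 := by
    intro z hz w hw
    simp only [hJ, sub_eq_zero] at hw
    by_cases hz0 : z = 0
    · funext i
      rw [← hw i, hz0]
      refine Finset.sum_eq_zero fun j _ => ?_
      have := (hp i).pderiv (i := j)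
      have := this.eval_smul 0 0
      rw [Nat.add_sub_cancel, zero_pow hd.ne', zero_mul, smul_zero] at this
      rw [this, zero_mul]
    have hz1 : IsEigenpair p z 1 := ⟨hz0, fun i => by simpa [sub_eq_zero] using hz i⟩
    obtain ⟨c, rfl⟩ := Submodule.mem_span_singleton.mp
      (hnd z 1 hz1 w 0 fun i => by rw [hw i]; ring)
    have hEuler : ∀ i, ∑ j, eval z (pderiv j (p i)) * z j = (d + 1) * z i := by
      intro i
      have := congrArg (eval z) (hp i).sum_X_mul_pderiv
      simp only [map_sum, map_mul, eval_X, map_natCast, hz1.2 i, one_mul, nsmul_eq_mul] at this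
      push_cast at this
      rw [← this]
      exact Finset.sum_congr rfl fun j _ => mul_comm _ _
    obtain ⟨i, hi⟩ := Function.ne_iff.mp hz0
    have h1 : c * ((d + 1) * z i) = c * z i := by
      have := hw i
      simp only [Pi.smul_apply, smul_eq_mul, mul_left_comm _ c, ← Finset.mul_sum, hEuler] at this
      exact this
    have h2 : c * (d * z i) = 0 := by linear_combination h1
    have hc : c = 0 := (mul_eq_zero.mp h2).resolve_right
      (mul_ne_zero (Nat.cast_ne_zero.mpr hd.ne') hi)
    rw [hc, zero_smul]
  obtain ⟨Z, hZ, hcard⟩ := exists_zero_finset_card_eq_pow (Nat.succ_pos d) hp htriv hlow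
    ⟨0, fun i => by rw [map_sub, hzero, eval_X]; simp⟩ hregular
  have hZ' : ∀ x, x ∈ Z.erase 0 ↔ IsEigenpair p x 1 := fun x => by
    simp [hZ, IsEigenpair, sub_eq_zero]
  have hmaps : Set.MapsTo (fun x : σ → ℂ => Submodule.span ℂ {x}) (Z.erase 0 : Finset (σ → ℂ))
      hfin.toFinset := fun x hx => by
    rw [Finset.mem_coe, hZ'] at hx
    simpa using ⟨x, 1, hx, rfl⟩
  have hfib : (Z.erase 0).card = ∑ L ∈ hfin.toFinset, d := by
    rw [Finset.card_eq_sum_card_fiberwise hmaps]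
    refine Finset.sum_congr rfl fun L hL => ?_
    obtain ⟨x, μ, hx, rfl⟩ := hfin.mem_toFinset.mp hL
    exact card_filter_span_eq hd hp hZ' hx (hμ x μ hx)
  have h0 : (0 : σ → ℂ) ∈ Z := (hZ 0).mpr fun i => by rw [map_sub, hzero, eval_X]; simp
  rw [Finset.card_erase_of_mem h0, hcard, Finset.sum_const, smul_eq_mul] at hfib
  rw [Nat.geomSum_eq (by omega), hfib, Nat.add_sub_cancel, Nat.mul_div_cancel _ hd,
    Set.ncard_eq_toFinset_card _ hfin]

/-- A nondegenerate homogeneous polynomial map of degree `d + 1 ≥ 2` in `n` variables with finitely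
many lines of eigenvectors has exactly `∑ i < n, (d + 1) ^ i` of them. -/
theorem ncard_eigenlines {σ : Type*} [Fintype σ] {p : σ → MvPolynomial σ ℂ} {d : ℕ} (hd : 0 < d)
    (hp : ∀ i, (p i).IsHomogeneous (d + 1)) (hfin : (eigenlines p).Finite)
    (hnd : IsNondegenerate p) :
    (eigenlines p).ncard = ∑ i ∈ Finset.range (Fintype.card σ), (d + 1) ^ i := by
  obtain ⟨q, hq, hne⟩ := exists_eval_add_eigenvalue_ne_zero hp hfin
  rw [← eigenlines_add_mul_X p q]
  refine ncard_eigenlines_of_eigenvalue_ne_zero hd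
    (fun i => (hp i).add (hq.mul (isHomogeneous_X ℂ i))) ?_ (hnd.add_mul_X q) fun x μ h => ?_
  · rwa [eigenlines_add_mul_X]
  · rw [← sub_add_cancel μ (eval x q)] at h ⊢
    exact hne x _ (isEigenpair_add_mul_X.mp h)

/-- An endomorphism all of whose eigenvectors are nondegenerate has `dim V` lines of
eigenvectors. -/
theorem Module.End.ncard_eigenlines_eq_finrank {V : Type*} [AddCommGroup V] [Module ℂ V]
    [FiniteDimensional ℂ V] (f : Module.End ℂ V)
    (hf : ∀ x, x ≠ 0 → ∀ μ : ℂ, f x = μ • x → ∀ w, f w - μ • w ∈ Submodule.span ℂ {x} →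
      w ∈ Submodule.span ℂ {x}) :
    {L | ∃ x, x ≠ 0 ∧ L = Submodule.span ℂ {x} ∧ ∃ μ : ℂ, f x = μ • x}.ncard =
      Module.finrank ℂ V := by
  set S := {L | ∃ x, x ≠ 0 ∧ L = Submodule.span ℂ {x} ∧ ∃ μ : ℂ, f x = μ • x}
  choose v hv0 hL ν hν using fun L : S => L.2
  have hinj : Function.Injective ν := by
    intro L L' h
    obtain ⟨t, ht⟩ := Submodule.mem_span_singleton.mp
      (hf (v L) (hv0 L) (ν L) (hν L) (v L') (by simp [hν L', h]))
    have ht0 : t ≠ 0 := by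
      rintro rfl
      exact hv0 L' (by rw [← ht, zero_smul])
    refine Subtype.ext ?_
    rw [hL L, hL L', ← ht, Submodule.span_singleton_smul_eq (IsUnit.mk0 t ht0)]
  have hli : LinearIndependent ℂ v := f.eigenvectors_linearIndependent' ν hinj v fun L =>
    ⟨Module.End.mem_eigenspace_iff.mpr (hν L), hv0 L⟩
  have hgen : ∀ (μ : ℂ) (k : ℕ) (x : V), ((f - μ • 1) ^ k) x = 0 → f x = μ • x := by
    intro μ k
    induction k with
    | zero =>
      intro x hx
      have : x = 0 := by simpa using hx
      simp [this]
    | succ k ih =>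
      intro x hx
      rw [pow_succ, Module.End.mul_apply] at hx
      by_cases hy : (f - μ • 1) x = 0
      · simpa [sub_eq_zero] using hy
      · have hfy := ih _ hx
        obtain ⟨t, ht⟩ := Submodule.mem_span_singleton.mp
          (hf _ hy μ hfy x (by simp))
        rw [← ht, map_smul, hfy, smul_comm]
  have hspan : ⊤ ≤ Submodule.span ℂ (Set.range v) := by
    rw [← f.iSup_maxGenEigenspace_eq_top]
    refine iSup_le fun μ x hx => ?_
    obtain ⟨k, hk⟩ := (f.mem_maxGenEigenspace μ x).mp hx
    by_cases hx0 : x = 0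
    · rw [hx0]
      exact zero_mem _
    · let L : S := ⟨Submodule.span ℂ {x}, x, hx0, rfl, μ, hgen μ k x hk⟩
      have hxL : x ∈ Submodule.span ℂ {v L} := hL L ▸ Submodule.mem_span_singleton_self x
      exact Submodule.span_mono (Set.singleton_subset_iff.mpr (Set.mem_range_self L)) hxL
  rw [Module.finrank_eq_nat_card_basis (Module.Basis.mk hli hspan)]
  rfl

/-- The `i`-th coordinate of the map `x ↦ ℓ(x, …, x, -)` as a polynomial. -/
noncomputable def multilinearPolynomial {n m : ℕ}
    (ℓ : MultilinearMap ℂ (fun _ : Fin m => (Fin n → ℂ)) ℂ) (i : Fin n) : MvPolynomial (Fin n) ℂ :=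
  ∑ r : Fin m → Fin n, C (ℓ fun j => Pi.single (r j) 1) *
    ∏ j : Fin m, if (j : ℕ) = m - 1 then C (Pi.single (M := fun _ => ℂ) i 1 (r j)) else X (r j)

theorem eval_multilinearPolynomial {n m : ℕ}
    (ℓ : MultilinearMap ℂ (fun _ : Fin m => (Fin n → ℂ)) ℂ) (i : Fin n) (x : Fin n → ℂ) :
    eval x (multilinearPolynomial ℓ i) =
      ℓ (fun j : Fin m => if (j : ℕ) = m - 1 then Pi.single i 1 else x) := by
  set y : Fin m → Fin n → ℂ := fun j => if (j : ℕ) = m - 1 then Pi.single i 1 else x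
  have hy : y = fun j => ∑ k, y j k • Pi.single k 1 := funext fun j => pi_eq_sum_univ' (y j)
  rw [hy, ℓ.map_sum]
  simp only [multilinearPolynomial, map_sum, map_mul, map_prod, eval_C]
  refine Finset.sum_congr rfl fun r _ => ?_
  rw [ℓ.map_smul_univ, smul_eq_mul, mul_comm]
  congr 1
  refine Finset.prod_congr rfl fun j _ => ?_
  by_cases h : (j : ℕ) = m - 1 <;> simp [y, h]

theorem multilinearPolynomial_isHomogeneous {n m : ℕ} (hm : 0 < m)
    (ℓ : MultilinearMap ℂ (fun _ : Fin m => (Fin n → ℂ)) ℂ) (i : Fin n) :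
    (multilinearPolynomial ℓ i).IsHomogeneous (m - 1) := by
  refine IsHomogeneous.sum _ _ _ fun r _ => ?_
  have hcount : ∑ j : Fin m, (if (j : ℕ) = m - 1 then 0 else 1) = m - 1 := by
    obtain ⟨k, rfl⟩ := Nat.exists_eq_succ_of_ne_zero hm.ne'
    rw [Fin.sum_univ_castSucc]
    simp [Fin.is_lt, Nat.ne_of_lt]
  have hprod := IsHomogeneous.prod Finset.univ
    (fun j : Fin m => if (j : ℕ) = m - 1 then C (Pi.single (M := fun _ => ℂ) i 1 (r j))
      else X (r j))
    (fun j => if (j : ℕ) = m - 1 then 0 else 1) fun j _ => by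
      split_ifs
      · exact isHomogeneous_C _ _
      · exact isHomogeneous_X _ _
  rw [hcount] at hprod
  exact hprod.C_mul _

theorem fderiv_eval_apply {σ : Type*} [Fintype σ] (p : σ → MvPolynomial σ ℂ) (x w : σ → ℂ)
    (i : σ) :
    fderiv ℂ (fun (x : σ → ℂ) i => eval x (p i)) x w i = ∑ j, eval x (pderiv j (p i)) * w j := by
  have h := hasFDerivAt_pi.mpr fun i => (hasStrictFDerivAt_eval (p i) x).hasFDerivAt
  rw [h.fderiv]
  simp

/-- For a symmetric `m`-multilinear form `ℓ` on `ℂ^n`, the map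
`P(x) = ℓ(x,…,x,−)ᵀ` is a polynomial map of degree `m−1`. If its induced self-map of
`ℙ^{n−1}(ℂ)` has finitely many fixed points, all of them nondegenerate (the genericity
condition), then the number of fixed points — i.e. of eigenvector lines of `ℓ` —
equals `(m−1)^{n−1} + (m−1)^{n−2} + … + (m−1) + 1`. -/
theorem stmt13 (n m : ℕ) (hn : 1 ≤ n) (hm : 2 ≤ m)
    (ℓ : MultilinearMap ℂ (fun _ : Fin m => (Fin n → ℂ)) ℂ)
    (hsym : ∀ (σ : Equiv.Perm (Fin m)) (x : Fin m → (Fin n → ℂ)), ℓ (x ∘ σ) = ℓ x)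
    (P : (Fin n → ℂ) → (Fin n → ℂ))
    (hP : ∀ (x : Fin n → ℂ) (i : Fin n),
      P x i = ℓ (fun j : Fin m => if (j : ℕ) = m - 1 then Pi.single i 1 else x))
    (S : Set (Submodule ℂ (Fin n → ℂ)))
    (hS : S = {L | ∃ x : Fin n → ℂ, x ≠ 0 ∧ L = Submodule.span ℂ {x} ∧
      ∃ μ : ℂ, P x = μ • x})
    (hfin : S.Finite)
    (hgen : ∀ (x : Fin n → ℂ), x ≠ 0 → ∀ μ : ℂ, P x = μ • x →
      ∀ w : Fin n → ℂ, fderiv ℂ P x w - μ • w ∈ Submodule.span ℂ {x} →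
        w ∈ Submodule.span ℂ {x}) :
    S.ncard = ∑ i ∈ Finset.range n, (m - 1) ^ i := by
  obtain rfl | hm2 := hm.eq_or_lt
  · let f : Module.End ℂ (Fin n → ℂ) :=
      LinearMap.pi fun i => ℓ.toLinearMap (fun _ => Pi.single i 1) 0
    have hPf : P = f := by
      funext x i
      rw [hP]
      refine congrArg ℓ (funext fun j => ?_)
      fin_cases j <;> simp
    have hderiv : ∀ x w, fderiv ℂ P x w = f w := fun x w => by
      rw [hPf, ← LinearMap.coe_toContinuousLinearMap', ContinuousLinearMap.fderiv]
    simp only [hderiv] at hgen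
    subst hPf hS
    simpa using f.ncard_eigenlines_eq_finrank hgen
  · obtain ⟨d, rfl⟩ : ∃ d, m = d + 2 := ⟨m - 2, by omega⟩
    let p := multilinearPolynomial ℓ
    have hPp : P = fun x i => eval x (p i) := by
      funext x i
      rw [hP, eval_multilinearPolynomial]
    have hSp : S = eigenlines p := by
      rw [hS, hPp]
      ext L
      refine exists_congr fun x => ?_
      simp only [IsEigenpair, funext_iff, Pi.smul_apply, smul_eq_mul]
      tauto
    have hnd : IsNondegenerate p := by
      intro x μ hx w c hw
      refine hgen x hx.1 μ (by rw [hPp]; exact funext hx.2) w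
        (Submodule.mem_span_singleton.mpr ⟨c, funext fun i => ?_⟩)
      rw [hPp, Pi.sub_apply, fderiv_eval_apply, hw i]
      simp
    rw [hSp] at hfin ⊢
    simpa using ncard_eigenlines (d := d) (by omega)
      (fun i => multilinearPolynomial_isHomogeneous (by omega) ℓ i) hfin hnd
end

section
/- The number of fixed points of a generic self-map F : ℙ^n(ℂ) × ℙ^m(ℂ) × ℙ^s(ℂ) → ℙ^n × ℙ^m × ℙ^s with components of multidegrees (d₁,d₂,d₃), (e₁,e₂,e₃), (f₁,f₂,f₃) equals the coefficient of α^n β^m γ^s in the polynomial ∑_{i=0}^{n} ∑_{j=0}^{m} ∑_{k=0}^{s} (d₁α+d₂β+d₃γ)^{n−i}(e₁α+e₂β+e₃γ)^{m−j}(f₁α+f₂β+f₃γ)^{s−k} α^i β^j γ^k in ℤ[α,β,γ]. -/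
open MvPolynomial

/-- The derivative at `p` of the polynomial function `g` in the direction `q`. -/
noncomputable def dirDeriv {σ : Type*} [Fintype σ] (p q : σ → ℂ) (g : MvPolynomial σ ℂ) : ℂ :=
  ∑ v, eval p (pderiv v g) * q v

section Jacobian

variable {σ : Type*} [Fintype σ]

lemma sub_linear_part_mem_sq (p : σ → ℂ) (f : MvPolynomial σ ℂ) :
    f - C (eval p f) - ∑ v, C (eval p (pderiv v f)) * (X v - C (p v)) ∈
      RingHom.ker (eval p) ^ 2 := by
  classical
  have hX : ∀ v, (X v - C (p v) : MvPolynomial σ ℂ) ∈ RingHom.ker (eval p) := by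
    intro v; simp [RingHom.mem_ker]
  induction f using MvPolynomial.induction_on with
  | C a => simp
  | add f g hf hg =>
    convert add_mem hf hg using 1
    simp only [map_add, add_mul, Finset.sum_add_distrib]
    ring
  | mul_X f i hf =>
    have h1 := Ideal.mul_mem_right (X i) _ hf
    have hL : (∑ v, C (eval p (pderiv v f)) * (X v - C (p v))) * (X i - C (p i)) ∈
        RingHom.ker (eval p) ^ 2 := by
      rw [pow_two]
      exact Ideal.mul_mem_mul (Ideal.sum_mem _ fun v _ => Ideal.mul_mem_left _ _ (hX v)) (hX i)
    convert add_mem h1 hL using 1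
    have h2 : ∑ v, C (eval p (pderiv v (f * X i))) * (X v - C (p v)) =
        C (p i) * (∑ v, C (eval p (pderiv v f)) * (X v - C (p v))) +
          C (eval p f) * (X i - C (p i)) := by
      rw [Finset.mul_sum, ← Finset.sum_erase_add _ _ (Finset.mem_univ i),
        ← Finset.sum_erase_add (a := i) (s := Finset.univ)
          (f := fun v => C (p i) * (C (eval p (pderiv v f)) * (X v - C (p v))))
          (Finset.mem_univ i), add_assoc]
      congr 1
      · refine Finset.sum_congr rfl fun v hv => ?_
        have hne : i ≠ v := (Finset.ne_of_mem_erase hv).symm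
        simp [pderiv_X_of_ne hne]
        ring
      · simp
        ring
    rw [h2]
    simp only [map_mul, eval_X]
    ring

lemma ker_eval_le_sup_sq (p : σ → ℂ) (I : Ideal (MvPolynomial σ ℂ))
    (hI : ∀ g ∈ I, eval p g = 0)
    (hJ : ∀ q : σ → ℂ, (∀ g ∈ I, dirDeriv p q g = 0) → q = 0) :
    RingHom.ker (eval p) ≤ I ⊔ RingHom.ker (eval p) ^ 2 := by
  classical
  set m := RingHom.ker (eval p)
  let A : Submodule ℂ (σ → ℂ) :=
    { carrier := {a | ∑ v, C (a v) * (X v - C (p v)) ∈ I ⊔ m ^ 2}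
      add_mem' := by
        intro a b ha hb
        simp only [Set.mem_ofPred_eq] at ha hb ⊢
        simpa [add_mul, Finset.sum_add_distrib] using add_mem ha hb
      zero_mem' := by simp
      smul_mem' := by
        intro c a ha
        simp only [Set.mem_ofPred_eq] at ha ⊢
        simpa [mul_assoc, Finset.mul_sum] using Ideal.mul_mem_left _ (C c) ha }
  have hgrad : ∀ g ∈ I, (fun v => eval p (pderiv v g)) ∈ A := by
    intro g hg
    have h1 := Ideal.mem_sup_right (S := I) (sub_linear_part_mem_sq p g)
    have h2 : g ∈ I ⊔ m ^ 2 := Ideal.mem_sup_left hg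
    have h3 := sub_mem h2 h1
    rw [hI g hg] at h3
    change ∑ v, C (eval p (pderiv v g)) * (X v - C (p v)) ∈ I ⊔ m ^ 2
    simpa using h3
  have hA : A = ⊤ := by
    by_contra hne
    obtain ⟨φ, hφ0, hφ⟩ := Submodule.exists_le_ker_of_lt_top A (lt_top_iff_ne_top.2 hne)
    have hφq : ∀ a : σ → ℂ, φ a = ∑ v, a v * φ (Pi.single v 1) := by
      intro a
      conv_lhs => rw [pi_eq_sum_univ' a]
      simp [map_sum]
    have hq : (fun v => φ (Pi.single v 1)) = 0 := by
      refine hJ _ fun g hg => ?_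
      have := hφ (hgrad g hg)
      rw [LinearMap.mem_ker, hφq] at this
      exact this
    apply hφ0
    ext a
    simpa using congrFun hq a
  have hXv : ∀ v, (X v - C (p v) : MvPolynomial σ ℂ) ∈ I ⊔ m ^ 2 := by
    intro v
    have : (Pi.single v 1 : σ → ℂ) ∈ A := hA ▸ Submodule.mem_top
    have h2 : ∑ u, C ((Pi.single v 1 : σ → ℂ) u) * (X u - C (p u)) ∈ I ⊔ m ^ 2 := this
    rw [Finset.sum_eq_single v] at h2
    · simpa using h2
    · intro u _ hu; simp [Pi.single_eq_of_ne hu]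
    · simp
  intro f hf
  have h1 := Ideal.mem_sup_right (S := I) (sub_linear_part_mem_sq p f)
  have hf0 : eval p f = 0 := hf
  rw [hf0] at h1
  have h2 : ∑ v, C (eval p (pderiv v f)) * (X v - C (p v)) ∈ I ⊔ m ^ 2 :=
    Ideal.sum_mem _ fun v _ => Ideal.mul_mem_left _ _ (hXv v)
  simpa using add_mem h1 h2

/-- An ideal whose zeros are all reduced points contains every polynomial vanishing on them. -/
lemma mem_of_vanishing_of_unramified (I : Ideal (MvPolynomial σ ℂ))
    (hJ : ∀ p : σ → ℂ, (∀ g ∈ I, eval p g = 0) →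
      ∀ q : σ → ℂ, (∀ g ∈ I, dirDeriv p q g = 0) → q = 0)
    (h : MvPolynomial σ ℂ) (hh : ∀ p : σ → ℂ, (∀ g ∈ I, eval p g = 0) → eval p h = 0) :
    h ∈ I := by
  by_contra hI
  have hne : I.colon {h} ≠ ⊤ := by
    intro htop
    apply hI
    have : (1 : MvPolynomial σ ℂ) ∈ I.colon {h} := htop ▸ Submodule.mem_top
    simpa [Submodule.mem_colon_singleton] using this
  obtain ⟨M, hM, hle⟩ := Ideal.exists_le_maximal _ hne
  obtain ⟨p, rfl⟩ := isMaximal_iff_eq_vanishingIdeal_singleton.1 hM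
  have hker : vanishingIdeal ℂ {p} = RingHom.ker (eval p) := by
    ext f
    simp [RingHom.mem_ker, aeval_eq_eval]
  rw [hker] at hle hM
  have hp : ∀ g ∈ I, eval p g = 0 := by
    intro g hg
    apply hle
    rw [Submodule.mem_colon_singleton]
    exact Ideal.mul_mem_right _ _ hg
  set m := RingHom.ker (eval p)
  have hsq := ker_eval_le_sup_sq p I hp (hJ p hp)
  have hIm : I ≤ m := fun g hg => hp g hg
  let N : Submodule (MvPolynomial σ ℂ) (MvPolynomial σ ℂ ⧸ I) := Submodule.map I.mkQ m
  have hN : N ≤ m • N := by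
    rintro _ ⟨f, hf, rfl⟩
    obtain ⟨a, ha, b, hb, rfl⟩ := Submodule.mem_sup.1 (hsq hf)
    rw [map_add, show I.mkQ a = 0 from (Submodule.Quotient.mk_eq_zero I).2 ha, zero_add]
    rw [pow_two] at hb
    have : Submodule.map I.mkQ (m • m : Submodule _ _) = m • N := Submodule.map_smul'' _ _ _
    rw [← this]
    exact ⟨b, hb, rfl⟩
  obtain ⟨r, hr1, hr⟩ := Submodule.exists_sub_one_mem_and_smul_eq_zero_of_fg_of_le_smul m N
    ((IsNoetherian.noetherian m).map _) hN
  have hrh : r ∈ I.colon {h} := by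
    rw [Submodule.mem_colon_singleton]
    have := hr (I.mkQ h) ⟨h, hh p hp, rfl⟩
    rw [← map_smul] at this
    exact (Submodule.Quotient.mk_eq_zero I).1 this
  have h1 : (1 : MvPolynomial σ ℂ) ∈ m := by
    have := sub_mem (hle hrh) hr1
    simpa using this
  exact hM.ne_top ((Ideal.eq_top_iff_one _).2 h1)

end Jacobian

/-- The multigrading in which each variable has the degree of its block. -/
noncomputable def blockWeight {σ ι : Type*} (blk : σ → ι) (v : σ) : ι →₀ ℕ :=
  Finsupp.single (blk v) 1

/-- A point all of whose blocks of coordinates are nonzero. -/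
def NonzeroBlocks {σ ι : Type*} (blk : σ → ι) (p : σ → ℂ) : Prop :=
  ∀ b, ∃ v, blk v = b ∧ p v ≠ 0

section Graded

variable {σ ι : Type*} {blk : σ → ι}

lemma mem_of_homogeneous_of_mem_span {K : Type*} [Finite K] {g : K → MvPolynomial σ ℂ}
    {δ : K → ι →₀ ℕ} (hg : ∀ k, (g k).IsWeightedHomogeneous (blockWeight blk) (δ k))
    (P : Submodule ℂ (MvPolynomial σ ℂ)) {D : ι →₀ ℕ}
    (hP : ∀ k m, Finsupp.weight (blockWeight blk) m + δ k = D → monomial m 1 * g k ∈ P)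
    {f : MvPolynomial σ ℂ} (hf : f ∈ Ideal.span (Set.range g))
    (hfD : f.IsWeightedHomogeneous (blockWeight blk) D) : f ∈ P := by
  classical
  have := Fintype.ofFinite K
  obtain ⟨a, rfl⟩ := Ideal.mem_span_range_iff_exists_fun.1 hf
  rw [← weightedHomogeneousComponent_eq_self hfD, map_sum]
  refine Submodule.sum_mem _ fun k _ => ?_
  induction a k using MvPolynomial.induction_on' with
  | monomial m r =>
    have h1 : (monomial m 1 * g k : MvPolynomial σ ℂ).IsWeightedHomogeneous (blockWeight blk)
        (Finsupp.weight (blockWeight blk) m + δ k) :=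
      (isWeightedHomogeneous_monomial _ _ _ rfl).mul (hg k)
    have h2 : monomial m r * g k = r • (monomial m 1 * g k) := by
      rw [← smul_mul_assoc, smul_monomial]; simp
    rw [h2, map_smul, weightedHomogeneousComponent_of_mem h1]
    refine P.smul_mem _ ?_
    split_ifs with h
    · exact hP k m h.symm
    · exact P.zero_mem
  | add p q hp hq =>
    rw [add_mul, map_add]
    exact P.add_mem hp hq

variable [Fintype σ]

lemma weight_blockWeight_apply [DecidableEq ι] (m : σ →₀ ℕ) (b : ι) :
    Finsupp.weight (blockWeight blk) m b = ∑ v with blk v = b, m v := by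
  classical
  rw [Finsupp.weight_apply, Finsupp.sum_fintype _ _ (by simp), Finsupp.finsetSum_apply,
    Finset.sum_filter]
  refine Finset.sum_congr rfl fun v _ => ?_
  simp [blockWeight, Finsupp.single_apply]

lemma aeval_block_scale [Fintype ι] {A : Type*} [CommRing A] [Algebra ℂ A]
    {h : MvPolynomial σ ℂ} {D : ι →₀ ℕ} (hh : h.IsWeightedHomogeneous (blockWeight blk) D)
    (c : ι → A) (x : σ → A) :
    aeval (fun v => c (blk v) * x v) h = (∏ b, c b ^ D b) * aeval x h := by
  classical
  rw [aeval_def, aeval_def, eval₂_eq', eval₂_eq', Finset.mul_sum]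
  refine Finset.sum_congr rfl fun d hd => ?_
  have hD := hh (mem_support_iff.1 hd)
  have : ∏ v, c (blk v) ^ d v = ∏ b, c b ^ D b := by
    rw [← Finset.prod_fiberwise Finset.univ blk]
    refine Finset.prod_congr rfl fun b _ => ?_
    rw [← hD, weight_blockWeight_apply, ← Finset.prod_pow_eq_pow_sum]
    refine Finset.prod_congr rfl fun v hv => ?_
    rw [(Finset.mem_filter.1 hv).2]
  simp_rw [mul_pow, Finset.prod_mul_distrib, this]
  ring

lemma eval_block_scale [Fintype ι]
    {h : MvPolynomial σ ℂ} {D : ι →₀ ℕ} (hh : h.IsWeightedHomogeneous (blockWeight blk) D)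
    (c : ι → ℂ) (x : σ → ℂ) :
    eval (fun v => c (blk v) * x v) h = (∏ b, c b ^ D b) * eval x h := by
  simpa [aeval_eq_eval] using aeval_block_scale hh c x

lemma exists_pow_mul_mem_of_mem_chart [Fintype ι] {K : Type*} {g : K → MvPolynomial σ ℂ}
    {δ : K → ι →₀ ℕ} (hg : ∀ k, (g k).IsWeightedHomogeneous (blockWeight blk) (δ k))
    {h : MvPolynomial σ ℂ} {D : ι →₀ ℕ} (hh : h.IsWeightedHomogeneous (blockWeight blk) D)
    {κ : ι → σ} (hκ : ∀ b, blk (κ b) = b)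
    (hI : h ∈ Ideal.span (Set.range g) ⊔ Ideal.span (Set.range fun b => (X (κ b) - 1))) :
    ∃ N : ℕ, (∏ b, X (κ b)) ^ N * h ∈ Ideal.span (Set.range g) := by
  classical
  set I := Ideal.span (Set.range g)
  set π : MvPolynomial σ ℂ := ∏ b, X (κ b)
  let L := Localization.Away π
  let al : MvPolynomial σ ℂ →+* L := algebraMap _ L
  have hu : ∀ b, IsUnit (al (X (κ b))) := fun b =>
    isUnit_of_dvd_unit
      (map_dvd al (Finset.dvd_prod_of_mem (fun b => X (κ b)) (Finset.mem_univ b)))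
      (IsLocalization.Away.algebraMap_isUnit (S := L) π)
  choose y hy using fun b => (hu b).exists_left_inv
  let φ : MvPolynomial σ ℂ →ₐ[ℂ] L := aeval fun v => y (blk v) * al (X v)
  have hφ : ∀ {f : MvPolynomial σ ℂ} {E : ι →₀ ℕ},
      f.IsWeightedHomogeneous (blockWeight blk) E → φ f = (∏ b, y b ^ E b) * al f := by
    intro f E hf
    have h1 := aeval_block_scale hf y (fun v => al (X v))
    have h2 : aeval (fun v => al (X v)) f = al f := by
      have : (aeval fun v => al (X v) : MvPolynomial σ ℂ →ₐ[ℂ] L) =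
          IsScalarTower.toAlgHom ℂ (MvPolynomial σ ℂ) L := by
        ext v; simp [al]
      rw [this]; rfl
    rw [h2] at h1
    exact h1
  have hle : I ⊔ Ideal.span (Set.range fun b => (X (κ b) - 1)) ≤
      (I.map al).comap φ := by
    refine sup_le ?_ ?_ <;> rw [Ideal.span_le] <;> rintro _ ⟨k, rfl⟩
    · change φ (g k) ∈ I.map al
      rw [hφ (hg k)]
      exact Ideal.mul_mem_left _ _ (Ideal.mem_map_of_mem _ (Ideal.subset_span ⟨k, rfl⟩))
    · change φ (X (κ k) - 1) ∈ I.map al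
      have : φ (X (κ k) - 1) = 0 := by simp [φ, hκ, hy]
      rw [this]; exact zero_mem _
  have h1 : φ h ∈ I.map al := hle hI
  have h2 : al h ∈ I.map al := by
    have : al h = (∏ b, al (X (κ b)) ^ D b) * φ h := by
      rw [hφ hh, ← mul_assoc, ← Finset.prod_mul_distrib]
      simp [← mul_pow, mul_comm (al _), hy]
    rw [this]
    exact Ideal.mul_mem_left _ _ h1
  obtain ⟨_, ⟨N, rfl⟩, hN⟩ :=
    (IsLocalization.algebraMap_mem_map_algebraMap_iff (Submonoid.powers π) L I h).1 h2
  exact ⟨N, hN⟩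

lemma dirDeriv_sub (p q : σ → ℂ) (f g : MvPolynomial σ ℂ) :
    dirDeriv p q (f - g) = dirDeriv p q f - dirDeriv p q g := by
  simp [dirDeriv, sub_mul, Finset.sum_sub_distrib]

lemma dirDeriv_mul (p q : σ → ℂ) (f g : MvPolynomial σ ℂ) :
    dirDeriv p q (f * g) = dirDeriv p q f * eval p g + eval p f * dirDeriv p q g := by
  simp only [dirDeriv, Derivation.leibniz, smul_eq_mul, map_add, map_mul, Finset.sum_mul,
    Finset.mul_sum, ← Finset.sum_add_distrib]
  exact Finset.sum_congr rfl fun v _ => by ring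

lemma dirDeriv_C (p q : σ → ℂ) (a : ℂ) : dirDeriv p q (C a) = 0 := by
  simp [dirDeriv]

lemma dirDeriv_one (p q : σ → ℂ) : dirDeriv p q 1 = 0 := by
  simpa using dirDeriv_C p q 1

lemma dirDeriv_X (p q : σ → ℂ) (v : σ) : dirDeriv p q (X v) = q v := by
  classical
  simp [dirDeriv, pderiv_X, Pi.single_apply, apply_ite]

lemma exists_pow_mul_mem [Fintype ι] {K : Type*} {g : K → MvPolynomial σ ℂ}
    {δ : K → ι →₀ ℕ} (hg : ∀ k, (g k).IsWeightedHomogeneous (blockWeight blk) (δ k))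
    (hunram : ∀ p, NonzeroBlocks blk p → (∀ k, eval p (g k) = 0) →
      ∀ q, (∀ k, dirDeriv p q (g k) = 0) → ∃ c : ι → ℂ, ∀ v, q v = c (blk v) * p v)
    {h : MvPolynomial σ ℂ} {D : ι →₀ ℕ} (hh : h.IsWeightedHomogeneous (blockWeight blk) D)
    (hzero : ∀ p, NonzeroBlocks blk p → (∀ k, eval p (g k) = 0) → eval p h = 0)
    {κ : ι → σ} (hκ : ∀ b, blk (κ b) = b) :
    ∃ N : ℕ, (∏ b, X (κ b)) ^ N * h ∈ Ideal.span (Set.range g) := by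
  refine exists_pow_mul_mem_of_mem_chart hg hh hκ ?_
  have hsub1 : ∀ k, g k ∈ Ideal.span (Set.range g) ⊔
      Ideal.span (Set.range fun b => (X (κ b) - 1 : MvPolynomial σ ℂ)) := fun k =>
    Ideal.mem_sup_left (Ideal.subset_span ⟨k, rfl⟩)
  have hsub2 : ∀ b, (X (κ b) - 1) ∈ Ideal.span (Set.range g) ⊔
      Ideal.span (Set.range fun b => (X (κ b) - 1 : MvPolynomial σ ℂ)) := fun b =>
    Ideal.mem_sup_right (Ideal.subset_span ⟨b, rfl⟩)
  have key : ∀ p : σ → ℂ, (∀ f ∈ Ideal.span (Set.range g) ⊔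
      Ideal.span (Set.range fun b => (X (κ b) - 1 : MvPolynomial σ ℂ)), eval p f = 0) →
      (∀ b, p (κ b) = 1) ∧ NonzeroBlocks blk p ∧ ∀ k, eval p (g k) = 0 := by
    intro p hp
    have h1 : ∀ b, p (κ b) = 1 := fun b => by
      have := hp _ (hsub2 b)
      simpa [sub_eq_zero] using this
    exact ⟨h1, fun b => ⟨κ b, hκ b, by simp [h1]⟩, fun k => hp _ (hsub1 k)⟩
  refine mem_of_vanishing_of_unramified _ ?_ h ?_
  · intro p hp q hq
    obtain ⟨h1, h2, h3⟩ := key p hp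
    obtain ⟨c, hc⟩ := hunram p h2 h3 q fun k => hq _ (hsub1 k)
    have hc0 : ∀ b, c b = 0 := by
      intro b
      have h4 := hq _ (hsub2 b)
      rw [dirDeriv_sub, dirDeriv_X, dirDeriv_one, sub_zero, hc, h1, hκ, mul_one] at h4
      exact h4
    funext v
    simp [hc, hc0]
  · intro p hp
    obtain ⟨-, h2, h3⟩ := key p hp
    exact hzero p h2 h3

lemma exists_degree_bound_monomial_mul_mem [Fintype ι] {K : Type*} {g : K → MvPolynomial σ ℂ}
    {δ : K → ι →₀ ℕ} (hg : ∀ k, (g k).IsWeightedHomogeneous (blockWeight blk) (δ k))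
    (hunram : ∀ p, NonzeroBlocks blk p → (∀ k, eval p (g k) = 0) →
      ∀ q, (∀ k, dirDeriv p q (g k) = 0) → ∃ c : ι → ℂ, ∀ v, q v = c (blk v) * p v)
    {h : MvPolynomial σ ℂ} {D : ι →₀ ℕ} (hh : h.IsWeightedHomogeneous (blockWeight blk) D)
    (hzero : ∀ p, NonzeroBlocks blk p → (∀ k, eval p (g k) = 0) → eval p h = 0) :
    ∃ B : ℕ, ∀ m : σ →₀ ℕ, (∀ b, B ≤ Finsupp.weight (blockWeight blk) m b) →
      monomial m 1 * h ∈ Ideal.span (Set.range g) := by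
  classical
  choose N hN using fun κ : {κ : ι → σ // ∀ b, blk (κ b) = b} =>
    exists_pow_mul_mem hg hunram hh hzero κ.2
  set M := Finset.univ.sup N
  refine ⟨Fintype.card σ * M + 1, fun m hm => ?_⟩
  have hex : ∀ b, ∃ v, blk v = b ∧ M ≤ m v := by
    intro b
    by_contra! hcon
    have h1 := hm b
    rw [weight_blockWeight_apply] at h1
    have h2 : ∑ v with blk v = b, m v ≤ ∑ v with blk v = b, M :=
      Finset.sum_le_sum fun v hv => (hcon v (Finset.mem_filter.1 hv).2).le
    have h3 : ∑ v with blk v = b, M ≤ Fintype.card σ * M := by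
      rw [Finset.sum_const, smul_eq_mul]
      exact Nat.mul_le_mul_right _ (Finset.card_le_univ _)
    omega
  choose κ hκ hκm using hex
  have hle : N ⟨κ, hκ⟩ ≤ M := Finset.le_sup (f := N) (Finset.mem_univ _)
  have hdvd : (∏ b, X (κ b) : MvPolynomial σ ℂ) ^ N ⟨κ, hκ⟩ ∣ monomial m 1 := by
    have hinj : Function.Injective κ := fun a b hab => by rw [← hκ a, ← hκ b, hab]
    have h1 : (∏ b, X (κ b) : MvPolynomial σ ℂ) ^ N ⟨κ, hκ⟩ =
        ∏ v ∈ Finset.univ.image κ, X v ^ N ⟨κ, hκ⟩ := by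
      rw [Finset.prod_image hinj.injOn, Finset.prod_pow]
    have h2 : (monomial m 1 : MvPolynomial σ ℂ) = ∏ v, X v ^ m v := by
      rw [monomial_eq, Finsupp.prod_fintype _ _ (by simp)]
      simp
    rw [h1, h2]
    refine (Finset.prod_dvd_prod_of_dvd _ (fun v => X v ^ m v) ?_).trans
      (Finset.prod_dvd_prod_of_subset _ _ _ (Finset.subset_univ _))
    intro v hv
    obtain ⟨b, -, rfl⟩ := Finset.mem_image.1 hv
    exact pow_dvd_pow _ (hle.trans (hκm b))
  obtain ⟨r, hr⟩ := hdvd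
  rw [hr, mul_comm _ r, mul_assoc]
  exact Ideal.mul_mem_left _ _ (hN ⟨κ, hκ⟩)

/-- In large multidegrees, a form vanishing on the zero locus of a system with reduced zero locus
lies in the ideal of the system. -/
lemma exists_degree_bound_mem [Fintype ι] {K : Type*} {g : K → MvPolynomial σ ℂ}
    {δ : K → ι →₀ ℕ} (hg : ∀ k, (g k).IsWeightedHomogeneous (blockWeight blk) (δ k))
    (hunram : ∀ p, NonzeroBlocks blk p → (∀ k, eval p (g k) = 0) →
      ∀ q, (∀ k, dirDeriv p q (g k) = 0) → ∃ c : ι → ℂ, ∀ v, q v = c (blk v) * p v) :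
    ∃ B : ℕ, ∀ D : ι →₀ ℕ, (∀ b, B ≤ D b) → ∀ h : MvPolynomial σ ℂ,
      h.IsWeightedHomogeneous (blockWeight blk) D →
      (∀ p, NonzeroBlocks blk p → (∀ k, eval p (g k) = 0) → eval p h = 0) →
      h ∈ Ideal.span (Set.range g) := by
  classical
  let s : Set (MvPolynomial σ ℂ) := {h | (∃ D, h.IsWeightedHomogeneous (blockWeight blk) D) ∧
    ∀ p, NonzeroBlocks blk p → (∀ k, eval p (g k) = 0) → eval p h = 0}
  obtain ⟨s', hs', hspan⟩ := (Submodule.fg_span_iff_fg_span_finset_subset s).1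
    (IsNoetherian.noetherian (Ideal.span s))
  choose E hE using fun h : s' => (hs' h.2).1
  choose B hB using fun h : s' =>
    exists_degree_bound_monomial_mul_mem hg hunram (hE h) (hs' h.2).2
  refine ⟨Finset.univ.sup B + Finset.univ.sup fun h => ∑ b, E h b, fun D hD h hh hz => ?_⟩
  refine mem_of_homogeneous_of_mem_span (g := fun h : s' => (h : MvPolynomial σ ℂ)) hE
    ((Ideal.span (Set.range g)).restrictScalars ℂ) ?_ ?_ hh
  · intro k m hm
    refine hB k m fun b => ?_
    have h1 := hD b
    rw [← hm, Finsupp.add_apply] at h1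
    have h2 : B k ≤ Finset.univ.sup B := Finset.le_sup (Finset.mem_univ k)
    have h3 : ∑ b, E k b ≤ Finset.univ.sup fun h => ∑ b, E h b :=
      Finset.le_sup (f := fun h => ∑ b, E h b) (Finset.mem_univ k)
    have h4 : E k b ≤ ∑ b, E k b := Finset.single_le_sum (fun _ _ => Nat.zero_le _)
      (Finset.mem_univ b)
    omega
  · have h1 : Set.range (fun h : s' => (h : MvPolynomial σ ℂ)) = s' := by simp
    rw [h1]
    change h ∈ Submodule.span _ _
    rw [← hspan]
    exact Submodule.subset_span ⟨⟨D, hh⟩, hz⟩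

lemma finiteDimensional_weightedHomogeneousSubmodule (D : ι →₀ ℕ) :
    FiniteDimensional ℂ (weightedHomogeneousSubmodule ℂ (blockWeight blk) D) := by
  classical
  have hfin : {d : σ →₀ ℕ | Finsupp.weight (blockWeight blk) d = D}.Finite := by
    refine (Set.finite_Iic (Finsupp.equivFunOnFinite.symm fun v => D (blk v))).subset ?_
    rintro d rfl
    intro v
    simp only [Finsupp.equivFunOnFinite_symm_apply_apply]
    rw [weight_blockWeight_apply]
    exact Finset.single_le_sum (f := d) (fun _ _ => Nat.zero_le _) (by simp)
  have := hfin.to_subtype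
  rw [weightedHomogeneousSubmodule_eq_finsupp_supported]
  exact Module.Finite.of_basis (basisRestrictSupport ℂ _)

end Graded

section Rank

open Filter Topology

open Polynomial in
lemma eventually_finrank_span_le {E A : Type*} [AddCommGroup E] [Module ℂ E]
    (v : A → ℂ → E) (hv : ∀ a, ∀ φ : E →ₗ[ℂ] ℂ, ∃ q : ℂ[X], ∀ t, φ (v a t) = q.eval t)
    (hfin : ∀ t, FiniteDimensional ℂ (Submodule.span ℂ (Set.range fun a => v a t))) (t₀ : ℂ) :
    ∀ᶠ t in cofinite, Module.finrank ℂ (Submodule.span ℂ (Set.range fun a => v a t₀)) ≤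
      Module.finrank ℂ (Submodule.span ℂ (Set.range fun a => v a t)) := by
  classical
  have := hfin t₀
  obtain ⟨f, hf, -, hli⟩ := Submodule.exists_fun_fin_finrank_span_eq ℂ
    (Set.range fun a => v a t₀)
  generalize Module.finrank ℂ (Submodule.span ℂ (Set.range fun a => v a t₀)) = r at f hf hli ⊢
  choose a ha using hf
  obtain ⟨L, hL⟩ := LinearMap.exists_leftInverse_of_injective (Fintype.linearCombination ℂ f)
    (LinearMap.ker_eq_bot.2 (linearIndependent_iff_injective_fintypeLinearCombination.1 hli))
  have hLf : ∀ i, L (f i) = Pi.single i 1 := by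
    intro i
    have := LinearMap.congr_fun hL (Pi.single i 1)
    simpa using this
  choose q hq using fun i j => hv (a i) ((LinearMap.proj j : (Fin r → ℂ) →ₗ[ℂ] ℂ) ∘ₗ L)
  set P : ℂ[X] := (Matrix.of q).det
  have hP : ∀ t, P.eval t = (Matrix.of fun i j => L (v (a i) t) j).det := by
    intro t
    rw [← Polynomial.coe_evalRingHom, RingHom.map_det]
    congr 1
    ext i j
    simp [← hq i j t]
  have hP0 : P ≠ 0 := by
    intro h0
    have h1 := hP t₀
    have h2 : (Matrix.of fun i j => L (v (a i) t₀) j) = 1 := by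
      ext i j
      have : v (a i) t₀ = f i := ha i
      simp [this, hLf, Matrix.one_apply, Pi.single_apply, eq_comm]
    rw [h0, h2] at h1
    simp at h1
  have hroots : {t | P.eval t = 0}.Finite := by
    refine (P.roots.toFinset.finite_toSet).subset fun t ht => ?_
    simpa [hP0] using ht
  filter_upwards [hroots.compl_mem_cofinite] with t ht
  have hdet : (Matrix.of fun i j => L (v (a i) t) j).det ≠ 0 := by
    rw [← hP]; exact ht
  have hrow := Matrix.linearIndependent_rows_of_det_ne_zero hdet
  have hind : LinearIndependent ℂ fun i => v (a i) t := LinearIndependent.of_comp L hrow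
  have := hfin t
  have hind2 : LinearIndependent ℂ
      (fun i => (⟨v (a i) t, Submodule.subset_span ⟨a i, rfl⟩⟩ :
        Submodule.span ℂ (Set.range fun a => v a t))) :=
    LinearIndependent.of_comp (Submodule.subtype _) hind
  simpa using hind2.fintype_card_le_finrank

end Rank

section Conservation

open Filter Topology

variable {σ ι J : Type*} [Fintype σ] [Fintype ι] {blk : σ → ι}

lemma exists_separating_form {p q : σ → ℂ} (hp : NonzeroBlocks blk p) (hq : NonzeroBlocks blk q)
    (hpq : ¬ ∃ c : ι → ℂ, ∀ v, p v = c (blk v) * q v) :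
    ∃ h : MvPolynomial σ ℂ,
      h.IsWeightedHomogeneous (blockWeight blk) (∑ b, Finsupp.single b 1) ∧
      eval q h = 0 ∧ eval p h ≠ 0 := by
  classical
  have h1 : ∃ u v, blk u = blk v ∧ p u * q v - p v * q u ≠ 0 := by
    by_contra! hcon
    apply hpq
    choose κ hκ hκ0 using hq
    refine ⟨fun b => p (κ b) / q (κ b), fun v => ?_⟩
    have h2 := hcon v (κ (blk v)) (hκ _).symm
    have := hκ0 (blk v)
    field_simp
    linear_combination h2
  obtain ⟨u, v, huv, hne⟩ := h1
  choose κ hκ hκ0 using hp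
  refine ⟨(C (q v) * X u - C (q u) * X v) * ∏ b ∈ Finset.univ.erase (blk u), X (κ b),
    ?_, ?_, ?_⟩
  · rw [← Finset.add_sum_erase _ _ (Finset.mem_univ (blk u))]
    refine IsWeightedHomogeneous.mul (IsWeightedHomogeneous.sub ?_ ?_)
      (IsWeightedHomogeneous.prod _ _ _ fun b _ => ?_)
    · exact (isWeightedHomogeneous_X ℂ _ u).C_mul _
    · rw [huv]; exact (isWeightedHomogeneous_X ℂ _ v).C_mul _
    · have := isWeightedHomogeneous_X ℂ (blockWeight blk) (κ b)
      rwa [blockWeight, hκ] at this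
  · simp; left; ring
  · rw [map_mul, map_prod]
    refine mul_ne_zero ?_ (Finset.prod_ne_zero_iff.2 fun b _ => by simpa using hκ0 b)
    simp only [map_sub, map_mul, eval_C, eval_X]
    intro h; apply hne; linear_combination h

lemma exists_interpolation_s15 [Fintype J] [DecidableEq J] {p : J → σ → ℂ}
    (hp : ∀ j, NonzeroBlocks blk (p j))
    (hinj : ∀ i j, (∃ c : ι → ℂ, ∀ v, p i v = c (blk v) * p j v) → i = j)
    {N : ℕ} (hN : Fintype.card J ≤ N) :
    ∃ h : J → MvPolynomial σ ℂ,
      (∀ i, (h i).IsWeightedHomogeneous (blockWeight blk) (N • ∑ b, Finsupp.single b 1)) ∧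
      ∀ i j, eval (p j) (h i) = if i = j then 1 else 0 := by
  classical
  have hex : ∀ i : J, ∃ f : MvPolynomial σ ℂ,
      f.IsWeightedHomogeneous (blockWeight blk) (N • ∑ b, Finsupp.single b 1) ∧
      eval (p i) f ≠ 0 ∧ ∀ j, j ≠ i → eval (p j) f = 0 := by
    intro i
    choose! s hs hs0 hs1 using fun (j : J) (hj : j ≠ i) =>
      exists_separating_form (hp i) (hp j) fun h => hj (hinj i j h).symm
    choose κ hκ hκ0 using hp i
    refine ⟨(∏ j ∈ Finset.univ.erase i, s j) *
      (∏ b, X (κ b)) ^ (N - (Finset.univ.erase i).card), ?_, ?_, ?_⟩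
    · have hcard : (Finset.univ.erase i).card ≤ N :=
        (Finset.card_le_univ _).trans hN
      have h1 : (∏ j ∈ Finset.univ.erase i, s j).IsWeightedHomogeneous (blockWeight blk)
          ((Finset.univ.erase i).card • ∑ b, Finsupp.single b 1) := by
        rw [← Finset.sum_const]
        exact IsWeightedHomogeneous.prod _ _ _ fun j hj => hs j (Finset.ne_of_mem_erase hj)
      have h2 : (∏ b, X (κ b) : MvPolynomial σ ℂ).IsWeightedHomogeneous (blockWeight blk)
          (∑ b, Finsupp.single b 1) :=
        IsWeightedHomogeneous.prod _ _ _ fun b _ => by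
          have := isWeightedHomogeneous_X ℂ (blockWeight blk) (κ b)
          rwa [blockWeight, hκ] at this
      convert h1.mul (h2.pow (N - (Finset.univ.erase i).card)) using 1
      rw [← add_smul, Nat.add_sub_cancel' hcard]
    · rw [map_mul, map_prod, map_pow, map_prod]
      refine mul_ne_zero (Finset.prod_ne_zero_iff.2 fun j hj =>
        hs1 j (Finset.ne_of_mem_erase hj)) (pow_ne_zero _ (Finset.prod_ne_zero_iff.2
          fun b _ => by simpa using hκ0 b))
    · intro j hj
      rw [map_mul, map_prod, Finset.prod_eq_zero (Finset.mem_erase.2 ⟨hj, Finset.mem_univ j⟩)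
        (hs0 j hj), zero_mul]
  choose f hf hf1 hf0 using hex
  refine ⟨fun i => C (eval (p i) (f i))⁻¹ * f i, fun i => (hf i).C_mul _, fun i j => ?_⟩
  split_ifs with h
  · subst h; simp [hf1]
  · simp [hf0 i j (Ne.symm h)]

/-- The points `p j` represent, without repetition, all solutions of the system `g · t₀`; they are
reduced and persist under small changes of the parameter. -/
structure IsReducedSolution {K : Type*} (blk : σ → ι) (g : K → ℂ → MvPolynomial σ ℂ) (t₀ : ℂ)
    (p : J → σ → ℂ) : Prop where
  nonzero : ∀ j, NonzeroBlocks blk (p j)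
  inequiv : ∀ i j, (∃ c : ι → ℂ, ∀ v, p i v = c (blk v) * p j v) → i = j
  complete : ∀ q, NonzeroBlocks blk q → (∀ k, eval q (g k t₀) = 0) →
    ∃ j, ∃ c : ι → ℂ, ∀ v, q v = c (blk v) * p j v
  unramified : ∀ q, NonzeroBlocks blk q → (∀ k, eval q (g k t₀) = 0) →
    ∀ r, (∀ k, dirDeriv q r (g k t₀) = 0) → ∃ c : ι → ℂ, ∀ v, r v = c (blk v) * q v
  persist : ∀ j, ∃ γ : ℂ → σ → ℂ, Tendsto γ (𝓝[≠] t₀) (𝓝 (p j)) ∧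
    ∀ᶠ t in 𝓝[≠] t₀, ∀ k, eval (γ t) (g k t) = 0

lemma card_le_of_isReducedSolution {K J₀ J₁ : Type*} [Finite K] [Fintype J₀] [Fintype J₁]
    {g : K → ℂ → MvPolynomial σ ℂ} {δ : K → ι →₀ ℕ}
    (hg : ∀ k t, (g k t).IsWeightedHomogeneous (blockWeight blk) (δ k))
    (hpoly : ∀ k, ∀ φ : MvPolynomial σ ℂ →ₗ[ℂ] ℂ, ∃ q : Polynomial ℂ, ∀ t,
      φ (g k t) = q.eval t)
    {t₀ t₁ : ℂ} {p₀ : J₀ → σ → ℂ} {p₁ : J₁ → σ → ℂ}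
    (h₀ : IsReducedSolution blk g t₀ p₀) (h₁ : IsReducedSolution blk g t₁ p₁) :
    Fintype.card J₁ ≤ Fintype.card J₀ := by
  classical
  obtain ⟨B, hB⟩ := exists_degree_bound_mem (fun k => hg k t₀) h₀.unramified
  set N := max B (Fintype.card J₁)
  set D : ι →₀ ℕ := N • ∑ b, Finsupp.single b 1 with hDdef
  have hD : ∀ b, D b = N := by
    intro b
    simp [hDdef, Finsupp.single_apply]
  set V := weightedHomogeneousSubmodule ℂ (blockWeight blk) D
  have hV : FiniteDimensional ℂ V := finiteDimensional_weightedHomogeneousSubmodule D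
  let A := {a : K × (σ →₀ ℕ) // Finsupp.weight (blockWeight blk) a.2 + δ a.1 = D}
  let v : A → ℂ → MvPolynomial σ ℂ := fun a t => monomial a.1.2 1 * g a.1.1 t
  let W : ℂ → Submodule ℂ (MvPolynomial σ ℂ) := fun t => Submodule.span ℂ (Set.range fun a => v a t)
  have hWV : ∀ t, W t ≤ V := by
    intro t
    refine Submodule.span_le.2 ?_
    rintro _ ⟨a, rfl⟩
    change (v a t).IsWeightedHomogeneous _ _
    rw [← a.2]
    exact (isWeightedHomogeneous_monomial _ _ _ rfl).mul (hg _ _)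
  have hWfin : ∀ t, FiniteDimensional ℂ (W t) := fun t =>
    Submodule.finiteDimensional_of_le (hWV t)
  have hgen : ∀ᶠ t in 𝓝[≠] t₁, Module.finrank ℂ (W t₀) ≤ Module.finrank ℂ (W t) := by
    refine nhdsNE_le_cofinite t₁ (eventually_finrank_span_le v (fun a φ => ?_) hWfin t₀)
    exact hpoly a.1.1 (φ ∘ₗ LinearMap.mulLeft ℂ (monomial a.1.2 1))
  have hlower : Module.finrank ℂ V ≤ Fintype.card J₀ + Module.finrank ℂ (W t₀) := by
    let ev : V →ₗ[ℂ] (J₀ → ℂ) :=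
      (LinearMap.pi fun j => (aeval (p₀ j) : MvPolynomial σ ℂ →ₐ[ℂ] ℂ).toLinearMap) ∘ₗ V.subtype
    rw [← LinearMap.finrank_range_add_finrank_ker ev]
    refine add_le_add ((Submodule.finrank_le _).trans (by simp)) ?_
    have hker : (LinearMap.ker ev).map V.subtype ≤ W t₀ := by
      rintro _ ⟨⟨f, hf⟩, hfk, rfl⟩
      have hfD : f.IsWeightedHomogeneous (blockWeight blk) D := hf
      have hf0 : ∀ j, eval (p₀ j) f = 0 := fun j => by
        have := congrFun (LinearMap.mem_ker.1 hfk) j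
        simpa [ev, aeval_eq_eval] using this
      refine mem_of_homogeneous_of_mem_span (fun k => hg k t₀) (W t₀) ?_
        (hB D (fun b => by rw [hD]; exact le_max_left _ _) f hfD ?_) hfD
      · intro k m hkm
        exact Submodule.subset_span ⟨⟨(k, m), hkm⟩, rfl⟩
      · intro q hq hq0
        obtain ⟨j, c, hc⟩ := h₀.complete q hq hq0
        obtain rfl : q = fun v => c (blk v) * p₀ j v := funext hc
        rw [eval_block_scale hfD, hf0, mul_zero]
    rw [(Submodule.equivMapOfInjective V.subtype V.injective_subtype (LinearMap.ker ev)).finrank_eq]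
    exact Submodule.finrank_mono hker
  have hupper : ∀ᶠ t in 𝓝[≠] t₁,
      Fintype.card J₁ + Module.finrank ℂ (W t) ≤ Module.finrank ℂ V := by
    obtain ⟨h, hhD, hh⟩ := exists_interpolation_s15 h₁.nonzero h₁.inequiv
      (le_max_right B (Fintype.card J₁))
    choose γ hγ hγ0 using h₁.persist
    have hdet : ∀ᶠ t in 𝓝[≠] t₁, (Matrix.of fun i j => eval (γ j t) (h i)).det ≠ 0 := by
      have hlim : Tendsto (fun t => (Matrix.of fun i j => eval (γ j t) (h i)).det) (𝓝[≠] t₁)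
          (𝓝 (Matrix.of fun i j => eval (p₁ j) (h i)).det) := by
        simp only [Matrix.det_apply, Matrix.of_apply]
        refine tendsto_finsetSum _ fun τ _ => ?_
        refine Tendsto.const_smul ?_ _
        refine tendsto_finsetProd _ fun i _ => ?_
        exact ((MvPolynomial.continuous_eval (h (τ i))).tendsto _).comp (hγ i)
      have hone : (Matrix.of fun i j => eval (p₁ j) (h i)) = 1 := by
        ext i j; simp [hh, Matrix.one_apply]
      rw [hone, Matrix.det_one] at hlim
      exact hlim.eventually_ne one_ne_zero
    filter_upwards [hdet, eventually_all.2 hγ0] with t ht hz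
    let ev : V →ₗ[ℂ] (J₁ → ℂ) :=
      (LinearMap.pi fun j => (aeval (γ j t) : MvPolynomial σ ℂ →ₐ[ℂ] ℂ).toLinearMap) ∘ₗ V.subtype
    have hrange : LinearMap.range ev = ⊤ := by
      have hli := Matrix.linearIndependent_rows_of_det_ne_zero ht
      rw [eq_top_iff, ← hli.span_eq_top_of_card_eq_finrank' (by simp), Submodule.span_le]
      rintro _ ⟨i, rfl⟩
      refine ⟨⟨h i, hhD i⟩, ?_⟩
      ext j
      simp [ev, aeval_eq_eval]
    rw [← LinearMap.finrank_range_add_finrank_ker ev, hrange, finrank_top,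
      Module.finrank_fintype_fun_eq_card]
    refine add_le_add le_rfl ?_
    have hker : W t ≤ (LinearMap.ker ev).map V.subtype := by
      refine Submodule.span_le.2 ?_
      rintro _ ⟨a, rfl⟩
      refine ⟨⟨v a t, hWV t (Submodule.subset_span ⟨a, rfl⟩)⟩, ?_, rfl⟩
      rw [SetLike.mem_coe, LinearMap.mem_ker]
      ext j
      simp [ev, v, aeval_eq_eval, hz]
    rw [(Submodule.equivMapOfInjective V.subtype V.injective_subtype (LinearMap.ker ev)).finrank_eq]
    exact Submodule.finrank_mono hker
  obtain ⟨t, ht1, ht2⟩ := (hgen.and hupper).exists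
  omega

/-- Conservation of number. -/
lemma card_eq_of_isReducedSolution {K J₀ J₁ : Type*} [Finite K] [Fintype J₀] [Fintype J₁]
    {g : K → ℂ → MvPolynomial σ ℂ} {δ : K → ι →₀ ℕ}
    (hg : ∀ k t, (g k t).IsWeightedHomogeneous (blockWeight blk) (δ k))
    (hpoly : ∀ k, ∀ φ : MvPolynomial σ ℂ →ₗ[ℂ] ℂ, ∃ q : Polynomial ℂ, ∀ t,
      φ (g k t) = q.eval t)
    {t₀ t₁ : ℂ} {p₀ : J₀ → σ → ℂ} {p₁ : J₁ → σ → ℂ}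
    (h₀ : IsReducedSolution blk g t₀ p₀) (h₁ : IsReducedSolution blk g t₁ p₁) :
    Fintype.card J₀ = Fintype.card J₁ :=
  le_antisymm (card_le_of_isReducedSolution hg hpoly h₁ h₀)
    (card_le_of_isReducedSolution hg hpoly h₀ h₁)

end Conservation

section Persistence

open Filter Topology

variable {σ : Type*} [Fintype σ]

lemma dirDeriv_add (p q : σ → ℂ) (f g : MvPolynomial σ ℂ) :
    dirDeriv p q (f + g) = dirDeriv p q f + dirDeriv p q g := by
  simp [dirDeriv, add_mul, Finset.sum_add_distrib]

lemma exists_hasFDerivAt_eval (g : MvPolynomial σ ℂ) (p : σ → ℂ) :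
    ∃ D : (σ → ℂ) →L[ℂ] ℂ, HasFDerivAt (fun x : σ → ℂ => eval x g) D p ∧
      ∀ q, D q = dirDeriv p q g := by
  induction g using MvPolynomial.induction_on with
  | C a =>
    simp only [eval_C, dirDeriv_C]
    exact ⟨0, hasFDerivAt_const a p, fun q => rfl⟩
  | add f g hf hg =>
    obtain ⟨D, hD, hD'⟩ := hf
    obtain ⟨E, hE, hE'⟩ := hg
    simp only [map_add, dirDeriv_add]
    exact ⟨D + E, hD.add hE, fun q => by simp [hD', hE']⟩
  | mul_X f v hf =>
    obtain ⟨D, hD, hD'⟩ := hf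
    simp only [map_mul, eval_X, dirDeriv_mul, dirDeriv_X]
    refine ⟨_, hD.mul (hasFDerivAt_apply (𝕜 := ℂ) v p), fun q => ?_⟩
    simp only [add_apply, smul_apply, ContinuousLinearMap.proj_apply, smul_eq_mul, hD']
    ring

lemma fderiv_eval_apply_s15 (g : MvPolynomial σ ℂ) (p q : σ → ℂ) :
    fderiv ℂ (fun x : σ → ℂ => eval x g) p q = dirDeriv p q g := by
  obtain ⟨D, hD, hD'⟩ := exists_hasFDerivAt_eval g p
  rw [hD.fderiv, hD']

lemma contDiff_eval (g : MvPolynomial σ ℂ) : ContDiff ℂ 1 (fun x : σ → ℂ => eval x g) := by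
  induction g using MvPolynomial.induction_on with
  | C a => simpa using contDiff_const
  | add f g hf hg => simpa using hf.add hg
  | mul_X f v hf => simpa using hf.mul (contDiff_apply ℂ ℂ v)

lemma exists_zero_curve {ι : Type*} {blk : σ → ι} {G : σ → ℂ → MvPolynomial σ ℂ}
    (hG : ∀ v, ContDiff ℂ 1 (fun x : ℂ × (σ → ℂ) => eval x.2 (G v x.1))) {t₀ : ℂ} {p : σ → ℂ}
    (hz : ∀ v, eval p (G v t₀) = 0) {κ : ι → σ} (hp : ∀ b, p (κ b) ≠ 0)
    (hκ : ∀ b, blk (κ b) = b) (hGκ : ∀ b t, G (κ b) t = 0)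
    (hinj : ∀ q, (∀ v, dirDeriv p q (G v t₀) = 0) → ∃ c : ι → ℂ, ∀ v, q v = c (blk v) * p v) :
    ∃ γ : ℂ → σ → ℂ, Tendsto γ (𝓝 t₀) (𝓝 p) ∧ ∀ᶠ t in 𝓝 t₀, ∀ v, eval (γ t) (G v t) = 0 := by
  classical
  let Φ : ℂ × (σ → ℂ) → σ → ℂ := fun x v =>
    if v = κ (blk v) then x.2 v - p v else eval x.2 (G v x.1)
  have hΦ : ContDiff ℂ 1 Φ := by
    refine contDiff_pi.2 fun v => ?_
    by_cases hv : v = κ (blk v)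
    · simp only [Φ, if_pos hv]
      exact ((contDiff_apply ℂ ℂ v).comp contDiff_snd).sub contDiff_const
    · simp only [Φ, if_neg hv]
      exact hG v
  have hstrict : HasStrictFDerivAt Φ (fderiv ℂ Φ (t₀, p)) (t₀, p) :=
    hΦ.contDiffAt.hasStrictFDerivAt one_ne_zero
  have hpart : ∀ q v, (fderiv ℂ Φ (t₀, p) ∘L .inr ℂ ℂ (σ → ℂ)) q v =
      if v = κ (blk v) then q v else dirDeriv p q (G v t₀) := by
    intro q v
    have h1 : HasFDerivAt (fun y : σ → ℂ => Φ (t₀, y))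
        (fderiv ℂ Φ (t₀, p) ∘L .inr ℂ ℂ (σ → ℂ)) p :=
      hstrict.hasFDerivAt.comp p (hasFDerivAt_prodMk_right t₀ p)
    have h2 := hasFDerivAt_pi'.1 h1 v
    by_cases hv : v = κ (blk v)
    · simp only [Φ, if_pos hv] at h2 ⊢
      have h3 := h2.unique ((hasFDerivAt_apply (𝕜 := ℂ) v p).sub_const (p v))
      exact DFunLike.congr_fun h3 q
    · simp only [Φ, if_neg hv] at h2 ⊢
      rw [← fderiv_eval_apply_s15, h2.fderiv]
      rfl
  have hker : ∀ q, (fderiv ℂ Φ (t₀, p) ∘L .inr ℂ ℂ (σ → ℂ)) q = 0 → q = 0 := by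
    intro q hq
    have hq' := fun v => (hpart q v).symm.trans (congrFun hq v)
    obtain ⟨c, hc⟩ := hinj q fun v => by
      by_cases hv : v = κ (blk v)
      · rw [hv, hGκ]; simp [dirDeriv]
      · simpa [hv] using hq' v
    funext v
    have h1 := hq' (κ (blk v))
    rw [if_pos (by rw [hκ]), hc, hκ] at h1
    rw [hc, (mul_eq_zero.1 h1).resolve_right (hp _)]
    simp
  have hinv : (fderiv ℂ Φ (t₀, p) ∘L .inr ℂ ℂ (σ → ℂ)).IsInvertible := by
    have hinj' := (injective_iff_map_eq_zero
      (fderiv ℂ Φ (t₀, p) ∘L .inr ℂ ℂ (σ → ℂ)).toLinearMap).2 hker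
    refine ⟨(LinearEquiv.ofInjectiveEndo _ hinj').toContinuousLinearEquiv, ?_⟩
    ext q v
    rfl
  have hzero : Φ (t₀, p) = 0 := by
    funext v
    by_cases hv : v = κ (blk v)
    · simp only [Φ, if_pos hv]; simp
    · simp only [Φ, if_neg hv]; exact hz v
  refine ⟨hstrict.implicitFunctionOfProdDomain hinv,
    hstrict.tendsto_implicitFunctionOfProdDomain hinv, ?_⟩
  filter_upwards [hstrict.eventually_apply_implicitFunctionOfProdDomain hinv] with t ht v
  by_cases hv : v = κ (blk v)
  · rw [hv, hGκ, map_zero]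
  · have := congrFun (ht.trans hzero) v
    simpa only [Φ, if_neg hv, Pi.zero_apply] using this

end Persistence

section Pencil

open Filter Topology

variable {σ ι : Type*} {blk : σ → ι} {pos : σ → ℕ}
  {P F : σ → MvPolynomial σ ℂ} {deg : ι → ι →₀ ℕ}

/-- The pencil through `P` (at `t = 0`) and `F` (at `t = 1`). -/
noncomputable def pencil (P F : σ → MvPolynomial σ ℂ) (v : σ) (t : ℂ) : MvPolynomial σ ℂ :=
  C (1 - t) * P v + C t * F v

/-- The `2 × 2` minors, within each block, of the matrix with rows `(t ^ pos v * H v)` and `(X v)`,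
where `H` is the pencil through `P` and `F`, divided by the largest possible power of `t`. -/
noncomputable def weightedMinor (pos : σ → ℕ) (P F : σ → MvPolynomial σ ℂ) (u v : σ) (t : ℂ) :
    MvPolynomial σ ℂ :=
  C (t ^ (pos u - pos v)) * pencil P F u t * X v - C (t ^ (pos v - pos u)) * pencil P F v t * X u

lemma weightedMinor_self (u : σ) (t : ℂ) : weightedMinor pos P F u u t = 0 := by
  simp [weightedMinor]

lemma isWeightedHomogeneous_pencil {w : σ → ι →₀ ℕ} {v : σ} {D : ι →₀ ℕ}
    (hP : (P v).IsWeightedHomogeneous w D) (hF : (F v).IsWeightedHomogeneous w D) (t : ℂ) :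
    (pencil P F v t).IsWeightedHomogeneous w D :=
  (hP.C_mul _).add (hF.C_mul _)

lemma isWeightedHomogeneous_weightedMinor
    (hP : ∀ v, (P v).IsWeightedHomogeneous (blockWeight blk) (deg (blk v)))
    (hF : ∀ v, (F v).IsWeightedHomogeneous (blockWeight blk) (deg (blk v))) {u v : σ}
    (huv : blk u = blk v) (t : ℂ) :
    (weightedMinor pos P F u v t).IsWeightedHomogeneous (blockWeight blk)
      (deg (blk u) + Finsupp.single (blk u) 1) := by
  refine IsWeightedHomogeneous.sub ?_ ?_
  · refine ((isWeightedHomogeneous_pencil (hP u) (hF u) t).C_mul _).mul ?_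
    rw [huv]
    exact isWeightedHomogeneous_X ℂ _ v
  · refine IsWeightedHomogeneous.mul ?_ (isWeightedHomogeneous_X ℂ (blockWeight blk) u)
    rw [huv]
    exact (isWeightedHomogeneous_pencil (hP v) (hF v) t).C_mul _

lemma exists_polynomial_weightedMinor (u v : σ) (φ : MvPolynomial σ ℂ →ₗ[ℂ] ℂ) :
    ∃ q : Polynomial ℂ, ∀ t, φ (weightedMinor pos P F u v t) = q.eval t := by
  refine ⟨.X ^ (pos u - pos v) * ((1 - .X) * .C (φ (P u * X v)) + .X * .C (φ (F u * X v))) -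
    .X ^ (pos v - pos u) * ((1 - .X) * .C (φ (P v * X u)) + .X * .C (φ (F v * X u))),
    fun t => ?_⟩
  have h : weightedMinor pos P F u v t =
      (t ^ (pos u - pos v) * (1 - t)) • (P u * X v) + (t ^ (pos u - pos v) * t) • (F u * X v) -
      ((t ^ (pos v - pos u) * (1 - t)) • (P v * X u) +
        (t ^ (pos v - pos u) * t) • (F v * X u)) := by
    simp only [weightedMinor, pencil, MvPolynomial.smul_eq_C_mul, MvPolynomial.C_mul]
    ring
  simp only [h, map_sub, map_add, map_smul, smul_eq_mul, Polynomial.eval_sub, Polynomial.eval_mul,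
    Polynomial.eval_pow, Polynomial.eval_X, Polynomial.eval_add, Polynomial.eval_one,
    Polynomial.eval_C]
  ring

lemma eval_weightedMinor (p : σ → ℂ) (u v : σ) (t : ℂ) :
    eval p (weightedMinor pos P F u v t) =
      t ^ (pos u - pos v) * ((1 - t) * eval p (P u) + t * eval p (F u)) * p v -
      t ^ (pos v - pos u) * ((1 - t) * eval p (P v) + t * eval p (F v)) * p u := by
  simp [weightedMinor, pencil]

lemma pow_mul_eval_weightedMinor (p : σ → ℂ) (u v : σ) (t : ℂ) :
    t ^ min (pos u) (pos v) * eval p (weightedMinor pos P F u v t) =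
      t ^ pos u * ((1 - t) * eval p (P u) + t * eval p (F u)) * p v -
      t ^ pos v * ((1 - t) * eval p (P v) + t * eval p (F v)) * p u := by
  have h1 : t ^ pos u = t ^ min (pos u) (pos v) * t ^ (pos u - pos v) := by
    rw [← pow_add]; congr 1; omega
  have h2 : t ^ pos v = t ^ min (pos u) (pos v) * t ^ (pos v - pos u) := by
    rw [← pow_add]; congr 1; omega
  rw [eval_weightedMinor, h1, h2]
  ring

lemma eval_weightedMinor_eq_zero_of_pivot {p : σ → ℂ} {u v w : σ} {t : ℂ} (ht : t ≠ 0)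
    (hw : p w ≠ 0) (hu : eval p (weightedMinor pos P F u w t) = 0)
    (hv : eval p (weightedMinor pos P F v w t) = 0) :
    eval p (weightedMinor pos P F u v t) = 0 := by
  have h1 := pow_mul_eval_weightedMinor (pos := pos) (P := P) (F := F) p u w t
  have h2 := pow_mul_eval_weightedMinor (pos := pos) (P := P) (F := F) p v w t
  have h3 := pow_mul_eval_weightedMinor (pos := pos) (P := P) (F := F) p u v t
  rw [hu, mul_zero] at h1
  rw [hv, mul_zero] at h2
  have h4 : t ^ min (pos u) (pos v) * p w * eval p (weightedMinor pos P F u v t) = 0 := by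
    linear_combination p w * h3 - p v * h1 + p u * h2
  exact (mul_eq_zero.1 h4).resolve_left (mul_ne_zero (pow_ne_zero _ ht) hw)

variable [Fintype σ]

lemma contDiff_eval_weightedMinor (u v : σ) :
    ContDiff ℂ 1 (fun x : ℂ × (σ → ℂ) => eval x.2 (weightedMinor pos P F u v x.1)) := by
  simp only [eval_weightedMinor]
  have hev : ∀ g : MvPolynomial σ ℂ, ContDiff ℂ 1 (fun x : ℂ × (σ → ℂ) => eval x.2 g) :=
    fun g => (contDiff_eval g).comp contDiff_snd
  have hX : ∀ v, ContDiff ℂ 1 (fun x : ℂ × (σ → ℂ) => x.2 v) := fun v => by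
    simpa using hev (X v)
  have h1 := hev (P u)
  have h2 := hev (P v)
  have h3 := hev (F u)
  have h4 := hev (F v)
  have h5 := hX u
  have h6 := hX v
  fun_prop

/-- A system of representatives of the zeros of the weighted minors is reduced as soon as at each
zero the minors against suitable pivots have injective differential modulo scaling. -/
lemma isReducedSolution_of_pivot {J : Type*} {t₀ : ℂ} {p : J → σ → ℂ}
    (hnz : ∀ j, NonzeroBlocks blk (p j))
    (hsol : ∀ j u v, blk u = blk v → eval (p j) (weightedMinor pos P F u v t₀) = 0)
    (hinj : ∀ i j, (∃ c : ι → ℂ, ∀ v, p i v = c (blk v) * p j v) → i = j)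
    (hcomplete : ∀ q, NonzeroBlocks blk q →
      (∀ u v, blk u = blk v → eval q (weightedMinor pos P F u v t₀) = 0) →
      ∃ j, ∃ c : ι → ℂ, ∀ v, q v = c (blk v) * p j v)
    (hpivot : ∀ q, NonzeroBlocks blk q →
      (∀ u v, blk u = blk v → eval q (weightedMinor pos P F u v t₀) = 0) →
      ∃ κ : ι → σ, (∀ b, blk (κ b) = b) ∧ (∀ b, q (κ b) ≠ 0) ∧
        ∀ r, (∀ v, dirDeriv q r (weightedMinor pos P F v (κ (blk v)) t₀) = 0) →
          ∃ c : ι → ℂ, ∀ v, r v = c (blk v) * q v) [Finite ι] :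
    IsReducedSolution blk
      (fun (k : {x : σ × σ // blk x.1 = blk x.2}) t => weightedMinor pos P F k.1.1 k.1.2 t)
      t₀ p where
  nonzero := hnz
  inequiv := hinj
  complete q hq h := hcomplete q hq fun u v huv => h ⟨(u, v), huv⟩
  unramified q hq h r hr := by
    obtain ⟨κ, hκ, -, h1⟩ := hpivot q hq fun u v huv => h ⟨(u, v), huv⟩
    exact h1 r fun v => hr ⟨(v, κ (blk v)), (hκ _).symm⟩
  persist j := by
    obtain ⟨κ, hκ, hκ0, h1⟩ := hpivot (p j) (hnz j) (hsol j)
    obtain ⟨γ, hγ, hγ0⟩ := exists_zero_curve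
      (G := fun v t => weightedMinor pos P F v (κ (blk v)) t)
      (fun v => contDiff_eval_weightedMinor _ _) (fun v => hsol j _ _ (hκ _).symm) hκ0 hκ
      (fun b t => by simp only [hκ, weightedMinor_self]) h1
    refine ⟨γ, hγ.mono_left nhdsWithin_le_nhds, ?_⟩
    have hne : ∀ᶠ t in 𝓝[≠] t₀, t ≠ 0 := by
      by_cases h0 : t₀ = 0
      · subst h0; exact self_mem_nhdsWithin
      · exact nhdsWithin_le_nhds (isOpen_ne.mem_nhds h0)
    have hγκ : ∀ᶠ t in 𝓝 t₀, ∀ b, γ t (κ b) ≠ 0 :=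
      eventually_all.2 fun b => ((tendsto_pi_nhds.1 hγ) (κ b)).eventually_ne (hκ0 b)
    filter_upwards [hne, nhdsWithin_le_nhds hγκ, nhdsWithin_le_nhds hγ0] with t h2 h3 h4
    rintro ⟨⟨u, v⟩, huv⟩
    refine eval_weightedMinor_eq_zero_of_pivot h2 (h3 (blk u)) (h4 u) ?_
    have h5 := h4 v
    rwa [← show blk u = blk v from huv] at h5

end Pencil

section FinalSystem

variable {σ ι : Type*} {blk : σ → ι} {pos : σ → ℕ} {P F : σ → MvPolynomial σ ℂ}

lemma weightedMinor_one (u v : σ) : weightedMinor pos P F u v 1 = F u * X v - F v * X u := by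
  simp [weightedMinor, pencil]

lemma weightedMinor_zero_of_lt {u v : σ} (h : pos u < pos v) :
    weightedMinor pos P F u v 0 = P u * X v := by
  have h1 : pos u - pos v = 0 := by omega
  have h2 : pos v - pos u ≠ 0 := by omega
  simp [weightedMinor, pencil, h1, h2]

lemma weightedMinor_zero_of_gt {u v : σ} (h : pos v < pos u) :
    weightedMinor pos P F u v 0 = -(P v * X u) := by
  have h1 : pos v - pos u = 0 := by omega
  have h2 : pos u - pos v ≠ 0 := by omega
  simp [weightedMinor, pencil, h1, h2]

lemma exists_eigenvalues {q : σ → ℂ} (hq : NonzeroBlocks blk q)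
    (h : ∀ u v, blk u = blk v → eval q (weightedMinor pos P F u v 1) = 0) :
    ∃ μ : ι → ℂ, ∀ v, eval q (F v) = μ (blk v) * q v := by
  choose κ hκ hκ0 using hq
  refine ⟨fun b => eval q (F (κ b)) / q (κ b), fun v => ?_⟩
  have h1 := h v (κ (blk v)) (hκ _).symm
  have h2 := hκ0 (blk v)
  simp only [weightedMinor_one, map_sub, map_mul, eval_X] at h1
  field_simp
  linear_combination h1

lemma isReducedSolution_one [Fintype σ] [Finite ι] {J : Type*} {p : J → σ → ℂ}
    (hnz : ∀ j, NonzeroBlocks blk (p j))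
    (hsol : ∀ j, ∃ μ : ι → ℂ, ∀ v, eval (p j) (F v) = μ (blk v) * p j v)
    (hinj : ∀ i j, (∃ c : ι → ℂ, ∀ v, p i v = c (blk v) * p j v) → i = j)
    (hcomplete : ∀ q, NonzeroBlocks blk q → (∃ μ : ι → ℂ, ∀ v, eval q (F v) = μ (blk v) * q v) →
      ∃ j, ∃ c : ι → ℂ, ∀ v, q v = c (blk v) * p j v)
    (hnondeg : ∀ q, NonzeroBlocks blk q → ∀ μ : ι → ℂ, (∀ v, eval q (F v) = μ (blk v) * q v) →
      ∀ r, (∃ c : ι → ℂ, ∀ v, dirDeriv q r (F v) - μ (blk v) * r v = c (blk v) * q v) →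
        ∃ c : ι → ℂ, ∀ v, r v = c (blk v) * q v) :
    IsReducedSolution blk
      (fun (k : {x : σ × σ // blk x.1 = blk x.2}) t => weightedMinor pos P F k.1.1 k.1.2 t)
      1 p := by
  refine isReducedSolution_of_pivot hnz ?_ hinj
    (fun q hq h => hcomplete q hq (exists_eigenvalues hq h)) ?_
  · intro j u v huv
    obtain ⟨μ, hμ⟩ := hsol j
    simp only [weightedMinor_one, map_sub, map_mul, eval_X, hμ, huv]
    ring
  · intro q hq h
    obtain ⟨μ, hμ⟩ := exists_eigenvalues hq h
    obtain ⟨κ, hκ⟩ := Classical.skolem.1 hq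
    refine ⟨κ, fun b => (hκ b).1, fun b => (hκ b).2, fun r hr => hnondeg q hq μ hμ r ?_⟩
    refine ⟨fun b => (dirDeriv q r (F (κ b)) - μ b * r (κ b)) / q (κ b), fun v => ?_⟩
    have h1 := hr v
    have h2 := (hκ (blk v)).2
    simp only [weightedMinor_one, dirDeriv_sub, dirDeriv_mul, dirDeriv_X, eval_X, hμ,
      (hκ (blk v)).1] at h1
    field_simp
    linear_combination h1

end FinalSystem

section StartSystem

/-- Each block `b` of variables is enumerated by `0, …, n b`, through `pos` and its inverse
`var`. -/
structure IsBlockEnumeration {σ ι : Type*} (blk : σ → ι) (pos : σ → ℕ) (n : ι → ℕ)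
    (var : ι → ℕ → σ) : Prop where
  blk_var : ∀ b i, i ≤ n b → blk (var b i) = b
  pos_var : ∀ b i, i ≤ n b → pos (var b i) = i
  var_eq : ∀ v, var (blk v) (pos v) = v
  pos_le : ∀ v, pos v ≤ n (blk v)

variable {σ ι : Type*} {blk : σ → ι} {pos : σ → ℕ} {n : ι → ℕ} {var : ι → ℕ → σ}

/-- The polynomial whose coefficients are the coordinates of `p` in block `b`. -/
noncomputable def blockPoly (n : ι → ℕ) (var : ι → ℕ → σ) (p : σ → ℂ) (b : ι) : Polynomial ℂ :=
  ∑ i ∈ Finset.range (n b + 1), Polynomial.monomial i (p (var b i))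

/-- The linear form evaluating `blockPoly` at `z`. -/
noncomputable def blockForm (n : ι → ℕ) (var : ι → ℕ → σ) (b : ι) (z : ℂ) : MvPolynomial σ ℂ :=
  ∑ i ∈ Finset.range (n b + 1), C (z ^ i) * X (var b i)

lemma coeff_blockPoly (p : σ → ℂ) (b : ι) (i : ℕ) :
    (blockPoly n var p b).coeff i = if i ≤ n b then p (var b i) else 0 := by
  simp [blockPoly, Polynomial.finsetSum_coeff, Polynomial.coeff_monomial]

lemma eval_blockForm (p : σ → ℂ) (b : ι) (z : ℂ) :
    eval p (blockForm n var b z) = (blockPoly n var p b).eval z := by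
  simp [blockForm, blockPoly, Polynomial.eval_finsetSum, mul_comm]

lemma dirDeriv_blockForm [Fintype σ] (p q : σ → ℂ) (b : ι) (z : ℂ) :
    dirDeriv p q (blockForm n var b z) = (blockPoly n var q b).eval z := by
  classical
  simp only [blockForm, blockPoly, Polynomial.eval_finsetSum, Polynomial.eval_monomial]
  have hsum : ∀ (s : Finset ℕ) (f : ℕ → MvPolynomial σ ℂ),
      dirDeriv p q (∑ i ∈ s, f i) = ∑ i ∈ s, dirDeriv p q (f i) := fun s f => by
    induction s using Finset.induction_on with
    | empty => simp [dirDeriv]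
    | insert a s ha ih => rw [Finset.sum_insert ha, dirDeriv_add, ih, Finset.sum_insert ha]
  rw [hsum]
  refine Finset.sum_congr rfl fun i _ => ?_
  rw [dirDeriv_mul, dirDeriv_C, dirDeriv_X, eval_C, eval_X]
  ring

lemma natDegree_blockPoly_le (p : σ → ℂ) (b : ι) : (blockPoly n var p b).natDegree ≤ n b := by
  refine Polynomial.natDegree_le_iff_coeff_eq_zero.2 fun i hi => ?_
  rw [coeff_blockPoly, if_neg (by omega)]

lemma eq_C_mul_prod_X_sub_C {A : Type*} {s : Finset A} {T : A → ℂ} (hT : Set.InjOn T s)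
    {f : Polynomial ℂ} (hdeg : f.natDegree ≤ s.card) (hf : ∀ a ∈ s, f.eval (T a) = 0) :
    f = .C (f.coeff s.card) * ∏ a ∈ s, (.X - .C (T a)) := by
  have hmonic : (∏ a ∈ s, (.X - .C (T a)) : Polynomial ℂ).Monic :=
    Polynomial.monic_prod_of_monic _ _ fun a _ => Polynomial.monic_X_sub_C _
  have hnat : (∏ a ∈ s, (.X - .C (T a)) : Polynomial ℂ).natDegree = s.card := by
    rw [Polynomial.natDegree_prod_of_monic _ _ fun a _ => Polynomial.monic_X_sub_C _]
    simp
  rw [← sub_eq_zero]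
  refine Polynomial.eq_zero_of_degree_lt_of_eval_index_eq_zero s hT ?_ ?_
  · refine (Polynomial.degree_lt_iff_coeff_zero _ _).2 fun i hi => ?_
    rw [Polynomial.coeff_sub, Polynomial.coeff_C_mul]
    rcases hi.eq_or_lt with rfl | hi
    · have h1 := hmonic.coeff_natDegree
      rw [hnat] at h1
      rw [h1, mul_one, sub_self]
    · rw [Polynomial.coeff_eq_zero_of_natDegree_lt (by omega),
        Polynomial.coeff_eq_zero_of_natDegree_lt (hnat.trans_lt hi)]
      simp
  · intro a ha
    rw [Polynomial.eval_sub, hf a ha, Polynomial.eval_mul, Polynomial.eval_prod,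
      Finset.prod_eq_zero ha (by simp)]
    simp

variable {deg : ι → ι →₀ ℕ}

/-- The factors of the polynomial attached to `u` in the start system. -/
abbrev FactorIndex (blk : σ → ι) (deg : ι → ι →₀ ℕ) (u : σ) : Type _ :=
  Σ b, Fin (deg (blk u) b)

/-- The start system: products of linear forms with pairwise distinct parameters. -/
noncomputable def startPoly [Fintype ι] (n : ι → ℕ) (var : ι → ℕ → σ)
    (T : (Σ u, FactorIndex blk deg u) → ℂ) (u : σ) : MvPolynomial σ ℂ :=
  ∏ x : FactorIndex blk deg u, blockForm n var x.1 (T ⟨u, x⟩)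

namespace IsBlockEnumeration

variable (h : IsBlockEnumeration blk pos n var)

include h

lemma coeff_blockPoly_pos (p : σ → ℂ) (v : σ) :
    (blockPoly n var p (blk v)).coeff (pos v) = p v := by
  rw [coeff_blockPoly, if_pos (h.pos_le v), h.var_eq]

lemma blockPoly_ne_zero {p : σ → ℂ} (hp : NonzeroBlocks blk p) (b : ι) :
    blockPoly n var p b ≠ 0 := by
  obtain ⟨v, rfl, hv⟩ := hp b
  intro h0
  apply hv
  rw [← h.coeff_blockPoly_pos p v, h0, Polynomial.coeff_zero]

lemma isWeightedHomogeneous_blockForm (b : ι) (z : ℂ) :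
    (blockForm n var b z).IsWeightedHomogeneous (blockWeight blk) (Finsupp.single b 1) := by
  refine IsWeightedHomogeneous.sum _ _ _ fun i hi => ?_
  have h1 := isWeightedHomogeneous_X ℂ (blockWeight blk) (var b i)
  rw [blockWeight, h.blk_var b i (by simpa [Nat.lt_succ_iff] using hi)] at h1
  exact h1.C_mul _

lemma isWeightedHomogeneous_startPoly [Fintype ι] (T : (Σ u, FactorIndex blk deg u) → ℂ) (u : σ) :
    (startPoly n var T u).IsWeightedHomogeneous (blockWeight blk) (deg (blk u)) := by
  classical
  have h1 : ∑ x : FactorIndex blk deg u, Finsupp.single x.1 1 = deg (blk u) := by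
    rw [Fintype.sum_sigma]
    ext b
    simp
  rw [← h1]
  exact IsWeightedHomogeneous.prod _ _ _ fun x _ => h.isWeightedHomogeneous_blockForm _ _

lemma exists_equiv_lt (k : ι → ℕ) (hk : ∀ b, k b ≤ n b) :
    ∃ e : {u // pos u < k (blk u)} ≃ Σ b, Fin (k b), ∀ u, (e u).1 = blk u :=
  ⟨{  toFun := fun u => ⟨blk u, pos u, u.2⟩
      invFun := fun x => ⟨var x.1 x.2, by
        have hx : (x.2 : ℕ) ≤ n x.1 := x.2.2.le.trans (hk _)
        rw [h.blk_var _ _ hx, h.pos_var _ _ hx]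
        exact x.2.2⟩
      left_inv := fun u => Subtype.ext (h.var_eq u)
      right_inv := fun x => by
        obtain ⟨b, i⟩ := x
        have hx : (i : ℕ) ≤ n b := i.2.le.trans (hk _)
        have h1 := h.blk_var _ _ hx
        have h2 := h.pos_var _ _ hx
        refine Sigma.ext h1 ?_
        refine (Fin.heq_ext_iff (by simp only [h1])).2 h2 }, fun _ => rfl⟩

lemma card_lt [Fintype σ] [Fintype ι] (k : ι → ℕ) (hk : ∀ b, k b ≤ n b) :
    Fintype.card {u // pos u < k (blk u)} = ∑ b, k b := by
  obtain ⟨e, -⟩ := h.exists_equiv_lt k hk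
  rw [Fintype.card_congr e]
  simp

end IsBlockEnumeration

end StartSystem

section StartSolutions

open Filter Topology

variable {σ ι : Type*} {blk : σ → ι} {pos : σ → ℕ}
  {n : ι → ℕ} {var : ι → ℕ → σ} {deg : ι → ι →₀ ℕ} {F : σ → MvPolynomial σ ℂ}

lemma injOn_choice {T : (Σ u, FactorIndex blk deg u) → ℂ} (hT : Function.Injective T)
    {k : ι → ℕ} (c : ∀ u : {u // pos u < k (blk u)}, FactorIndex blk deg u.1)
    (s : Set {u // pos u < k (blk u)}) : Set.InjOn (fun u => T ⟨u.1, c u⟩) s := by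
  intro u _ v _ huv
  have h1 := hT huv
  exact Subtype.ext (congrArg Sigma.fst h1)

variable [Fintype σ] [DecidableEq ι]

/-- For each variable below the pivots, a vanishing factor in the start system, such that the number
of chosen factors in each block is the position of its pivot. -/
abbrev FactorChoice (blk : σ → ι) (pos : σ → ℕ) (deg : ι → ι →₀ ℕ) (k : ι → ℕ) : Type _ :=
  {c : ∀ u : {u // pos u < k (blk u)}, FactorIndex blk deg u.1 //
    ∀ b, (Finset.univ.filter fun u => (c u).1 = b).card = k b}

/-- The block polynomials of the solution of the start system belonging to a factor choice. -/
noncomputable def choicePoly (T : (Σ u, FactorIndex blk deg u) → ℂ) {k : ι → ℕ}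
    (c : FactorChoice blk pos deg k) (b : ι) : Polynomial ℂ :=
  ∏ u with (c.1 u).1 = b, (.X - .C (T ⟨u.1, c.1 u⟩))

lemma monic_choicePoly (T : (Σ u, FactorIndex blk deg u) → ℂ) {k : ι → ℕ}
    (c : FactorChoice blk pos deg k) (b : ι) : (choicePoly T c b).Monic :=
  Polynomial.monic_prod_of_monic _ _ fun _ _ => Polynomial.monic_X_sub_C _

lemma natDegree_choicePoly (T : (Σ u, FactorIndex blk deg u) → ℂ) {k : ι → ℕ}
    (c : FactorChoice blk pos deg k) (b : ι) : (choicePoly T c b).natDegree = k b := by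
  rw [choicePoly, Polynomial.natDegree_prod_of_monic _ _ fun a _ => Polynomial.monic_X_sub_C _]
  simpa using c.2 b

lemma eval_choicePoly_eq_zero {T : (Σ u, FactorIndex blk deg u) → ℂ}
    {k : ι → ℕ} (c : FactorChoice blk pos deg k) (b : ι) (z : ℂ) :
    (choicePoly T c b).eval z = 0 ↔ ∃ u, (c.1 u).1 = b ∧ z = T ⟨u.1, c.1 u⟩ := by
  simp [choicePoly, Polynomial.eval_prod, Finset.prod_eq_zero_iff, sub_eq_zero]

lemma eq_C_mul_choicePoly {T : (Σ u, FactorIndex blk deg u) → ℂ} (hT : Function.Injective T)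
    {k : ι → ℕ} (c : FactorChoice blk pos deg k) {b : ι} {f : Polynomial ℂ}
    (hdeg : f.natDegree ≤ k b) (hf : ∀ u, (c.1 u).1 = b → f.eval (T ⟨u.1, c.1 u⟩) = 0) :
    f = .C (f.coeff (k b)) * choicePoly T c b := by
  have h := eq_C_mul_prod_X_sub_C (f := f) (T := fun u => T ⟨u.1, c.1 u⟩)
    (s := Finset.univ.filter fun u => (c.1 u).1 = b) (injOn_choice hT c.1 _)
    (by rwa [c.2 b]) (by simpa using hf)
  rwa [c.2 b] at h

namespace IsBlockEnumeration

variable (h : IsBlockEnumeration blk pos n var)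

include h

lemma blockPoly_choice (T : (Σ u, FactorIndex blk deg u) → ℂ) {k : ι → ℕ}
    (hk : ∀ b, k b ≤ n b) (c : FactorChoice blk pos deg k) (b : ι) :
    blockPoly n var (fun v => (choicePoly T c (blk v)).coeff (pos v)) b = choicePoly T c b := by
  ext i
  rw [coeff_blockPoly]
  split_ifs with hi
  · rw [h.blk_var _ _ hi, h.pos_var _ _ hi]
  · rw [Polynomial.coeff_eq_zero_of_natDegree_lt]
    rw [natDegree_choicePoly]
    have := hk b
    omega

lemma nonzeroBlocks_choice (T : (Σ u, FactorIndex blk deg u) → ℂ) {k : ι → ℕ}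
    (hk : ∀ b, k b ≤ n b) (c : FactorChoice blk pos deg k) :
    NonzeroBlocks blk (fun v => (choicePoly T c (blk v)).coeff (pos v)) := by
  intro b
  refine ⟨var b (k b), h.blk_var _ _ (hk b), ?_⟩
  dsimp only
  rw [h.blk_var _ _ (hk b), h.pos_var _ _ (hk b), ← natDegree_choicePoly T c b,
    (monic_choicePoly T c b).coeff_natDegree]
  exact one_ne_zero

variable [Fintype ι]

lemma exists_factorChoice {T : (Σ u, FactorIndex blk deg u) → ℂ} (hT : Function.Injective T)
    {q : σ → ℂ} (hq : NonzeroBlocks blk q)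
    (hz : ∀ u v, blk u = blk v →
      eval q (weightedMinor pos (startPoly n var T) F u v 0) = 0) {k : ι → ℕ}
    (hk : ∀ b, (blockPoly n var q b).natDegree = k b) :
    ∃ c : FactorChoice blk pos deg k, ∀ b,
      blockPoly n var q b = .C ((blockPoly n var q b).coeff (k b)) * choicePoly T c b := by
  have hkn : ∀ b, k b ≤ n b := fun b => hk b ▸ natDegree_blockPoly_le q b
  have hroot : ∀ u : {u // pos u < k (blk u)}, ∃ x : FactorIndex blk deg u.1,
      (blockPoly n var q x.1).eval (T ⟨u, x⟩) = 0 := by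
    rintro ⟨u, hu⟩
    have h1 := hz u (var (blk u) (k (blk u))) (h.blk_var _ _ (hkn _)).symm
    rw [weightedMinor_zero_of_lt (by rwa [h.pos_var _ _ (hkn _)]), map_mul, eval_X] at h1
    have h2 : q (var (blk u) (k (blk u))) ≠ 0 := by
      have h3 := h.blockPoly_ne_zero hq (blk u)
      rw [← Polynomial.leadingCoeff_ne_zero, Polynomial.leadingCoeff, hk, coeff_blockPoly,
        if_pos (hkn _)] at h3
      exact h3
    have h3 := (mul_eq_zero.1 h1).resolve_right h2
    rw [startPoly, map_prod, Finset.prod_eq_zero_iff] at h3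
    obtain ⟨x, -, hx⟩ := h3
    exact ⟨x, by rwa [eval_blockForm] at hx⟩
  choose c hc using hroot
  have hle : ∀ b, (Finset.univ.filter fun u => (c u).1 = b).card ≤ k b := by
    intro b
    rw [← hk b]
    have hinj := injOn_choice hT c ((Finset.univ.filter fun u => (c u).1 = b : Finset _) : Set _)
    rw [← Finset.card_image_of_injOn hinj]
    refine Polynomial.card_le_degree_of_subset_roots ?_
    intro z hz
    simp only [Finset.mem_val, Finset.mem_image, Finset.mem_filter, Finset.mem_univ,
      true_and] at hz
    obtain ⟨u, rfl, rfl⟩ := hz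
    exact (Polynomial.mem_roots (h.blockPoly_ne_zero hq _)).2 (hc u)
  have hsum : ∑ b, (Finset.univ.filter fun u => (c u).1 = b).card = ∑ b, k b := by
    rw [← h.card_lt k hkn, ← Finset.card_univ]
    exact (Finset.card_eq_sum_card_fiberwise fun u _ => Finset.mem_coe.2 (Finset.mem_univ _)).symm
  have heq := (Finset.sum_eq_sum_iff_of_le fun b _ => hle b).1 hsum
  refine ⟨⟨c, fun b => heq b (Finset.mem_univ b)⟩, fun b => ?_⟩
  refine eq_C_mul_choicePoly hT _ (hk b).le ?_
  rintro u rfl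
  exact hc u

lemma eval_weightedMinor_choice (T : (Σ u, FactorIndex blk deg u) → ℂ) {k : ι → ℕ}
    (hk : ∀ b, k b ≤ n b) (c : FactorChoice blk pos deg k) {u v : σ} (huv : blk u = blk v) :
    eval (fun v => (choicePoly T c (blk v)).coeff (pos v))
      (weightedMinor pos (startPoly n var T) F u v 0) = 0 := by
  have key : ∀ u v, blk u = blk v → pos u < pos v →
      eval (fun v => (choicePoly T c (blk v)).coeff (pos v)) (startPoly n var T u) *
        (choicePoly T c (blk v)).coeff (pos v) = 0 := by
    intro u v huv hlt
    by_cases hv : k (blk v) < pos v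
    · rw [Polynomial.coeff_eq_zero_of_natDegree_lt, mul_zero]
      rwa [natDegree_choicePoly]
    · have hu : pos u < k (blk u) := by rw [huv]; omega
      rw [startPoly, map_prod, Finset.prod_eq_zero (Finset.mem_univ (c.1 ⟨u, hu⟩)), zero_mul]
      rw [eval_blockForm, h.blockPoly_choice T hk, eval_choicePoly_eq_zero]
      exact ⟨⟨u, hu⟩, rfl, rfl⟩
  rcases lt_trichotomy (pos u) (pos v) with hlt | heq | hgt
  · rw [weightedMinor_zero_of_lt hlt, map_mul, eval_X]
    exact key u v huv hlt
  · have : u = v := by rw [← h.var_eq u, ← h.var_eq v, huv, heq]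
    rw [this, weightedMinor_self, map_zero]
  · rw [weightedMinor_zero_of_gt hgt, map_neg, map_mul, eval_X, key v u huv.symm hgt, neg_zero]

lemma exists_pivot_start {T : (Σ u, FactorIndex blk deg u) → ℂ} (hT : Function.Injective T)
    {q : σ → ℂ} (hq : NonzeroBlocks blk q)
    (hz : ∀ u v, blk u = blk v →
      eval q (weightedMinor pos (startPoly n var T) F u v 0) = 0) :
    ∃ κ : ι → σ, (∀ b, blk (κ b) = b) ∧ (∀ b, q (κ b) ≠ 0) ∧
      ∀ r, (∀ v, dirDeriv q r
          (weightedMinor pos (startPoly n var T) F v (κ (blk v)) 0) = 0) →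
        ∃ c : ι → ℂ, ∀ v, r v = c (blk v) * q v := by
  classical
  obtain ⟨k, hk⟩ : ∃ k : ι → ℕ, ∀ b, (blockPoly n var q b).natDegree = k b := ⟨_, fun _ => rfl⟩
  have hkn : ∀ b, k b ≤ n b := fun b => hk b ▸ natDegree_blockPoly_le q b
  obtain ⟨c, hc⟩ := h.exists_factorChoice hT hq hz hk
  have hlead : ∀ b, (blockPoly n var q b).coeff (k b) ≠ 0 := fun b => by
    rw [← hk b]
    exact Polynomial.leadingCoeff_ne_zero.2 (h.blockPoly_ne_zero hq b)
  have hroot : ∀ u x, (blockPoly n var q x.1).eval (T ⟨u, x⟩) = 0 ↔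
      ∃ hu : pos u < k (blk u), c.1 ⟨u, hu⟩ = x := by
    intro u x
    rw [hc, Polynomial.eval_mul, Polynomial.eval_C, mul_eq_zero, or_iff_right (hlead _),
      eval_choicePoly_eq_zero]
    constructor
    · rintro ⟨⟨u', hu'⟩, -, h2⟩
      obtain ⟨rfl, h3⟩ := Sigma.mk.inj_iff.1 (hT h2)
      exact ⟨hu', (eq_of_heq h3).symm⟩
    · rintro ⟨hu, rfl⟩
      exact ⟨⟨u, hu⟩, rfl, rfl⟩
  have hq0 : ∀ b, q (var b (k b)) ≠ 0 := fun b => by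
    have := hlead b
    rwa [coeff_blockPoly, if_pos (hkn b)] at this
  refine ⟨fun b => var b (k b), fun b => h.blk_var _ _ (hkn b), hq0, fun r hr => ?_⟩
  have hrzero : ∀ v, k (blk v) < pos v → r v = 0 := by
    intro v hv
    have h1 := hr v
    have hqv : q v = 0 := by
      rw [← h.coeff_blockPoly_pos q v]
      exact Polynomial.coeff_eq_zero_of_natDegree_lt (by rwa [hk])
    rw [weightedMinor_zero_of_gt (by rwa [h.pos_var _ _ (hkn _)]), ← zero_sub, dirDeriv_sub,
      dirDeriv_mul, dirDeriv_X, eval_X, hqv] at h1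
    simp only [dirDeriv, map_zero, zero_mul, Finset.sum_const_zero, mul_zero, zero_add,
      zero_sub, neg_eq_zero, mul_eq_zero] at h1
    refine h1.resolve_left ?_
    rw [startPoly, map_prod]
    refine Finset.prod_ne_zero_iff.2 fun x _ => ?_
    rw [eval_blockForm, Ne, hroot]
    rintro ⟨hlt, -⟩
    rw [h.blk_var _ _ (hkn _), h.pos_var _ _ (hkn _)] at hlt
    exact lt_irrefl _ hlt
  have hrdeg : ∀ b, (blockPoly n var r b).natDegree ≤ k b := by
    intro b
    refine Polynomial.natDegree_le_iff_coeff_eq_zero.2 fun i hi => ?_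
    rw [coeff_blockPoly]
    split_ifs with hin
    · exact hrzero _ (by rwa [h.blk_var _ _ hin, h.pos_var _ _ hin])
    · rfl
  have hreval : ∀ u, (blockPoly n var r (c.1 u).1).eval (T ⟨u.1, c.1 u⟩) = 0 := by
    rintro ⟨u, hu⟩
    have h1 := hr u
    have h0 : (blockPoly n var q (c.1 ⟨u, hu⟩).1).eval (T ⟨u, c.1 ⟨u, hu⟩⟩) = 0 :=
      (hroot u _).2 ⟨hu, rfl⟩
    rw [weightedMinor_zero_of_lt (by rwa [h.pos_var _ _ (hkn _)]), dirDeriv_mul, startPoly,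
      ← Finset.mul_prod_erase _ _ (Finset.mem_univ (c.1 ⟨u, hu⟩)), dirDeriv_mul, map_mul,
      dirDeriv_blockForm, eval_blockForm, h0, eval_X] at h1
    simp only [zero_mul, add_zero, mul_eq_zero, hq0, or_false] at h1
    refine h1.resolve_right ?_
    rw [map_prod]
    refine Finset.prod_ne_zero_iff.2 fun x hx => ?_
    rw [eval_blockForm, Ne, hroot]
    rintro ⟨_, rfl⟩
    exact Finset.ne_of_mem_erase hx rfl
  refine ⟨fun b => (blockPoly n var r b).coeff (k b) / (blockPoly n var q b).coeff (k b),
    fun v => ?_⟩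
  have h1 := eq_C_mul_choicePoly hT c (hrdeg (blk v)) (by rintro u hu; rw [← hu]; exact hreval u)
  have h2 := congrArg (fun f => f.coeff (pos v)) h1
  have h3 := congrArg (fun f => f.coeff (pos v)) (hc (blk v))
  simp only [Polynomial.coeff_C_mul, h.coeff_blockPoly_pos] at h2 h3
  have h4 := hlead (blk v)
  rw [h2, h3]
  field_simp

/-- The solutions of the start system. -/
lemma isReducedSolution_zero {T : (Σ u, FactorIndex blk deg u) → ℂ} (hT : Function.Injective T) :
    IsReducedSolution blk
      (fun (k : {x : σ × σ // blk x.1 = blk x.2}) t =>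
        weightedMinor pos (startPoly n var T) F k.1.1 k.1.2 t) 0
      (fun (j : Σ k : ∀ b, Fin (n b + 1), FactorChoice blk pos deg fun b => (k b : ℕ)) v =>
        (choicePoly T j.2 (blk v)).coeff (pos v)) := by
  have hkn : ∀ (k : ∀ b, Fin (n b + 1)) b, (k b : ℕ) ≤ n b := fun k b => Nat.lt_succ_iff.1 (k b).2
  refine isReducedSolution_of_pivot (fun j => h.nonzeroBlocks_choice T (hkn j.1) j.2)
    (fun j u v huv => h.eval_weightedMinor_choice T (hkn j.1) j.2 huv) ?_ ?_
    (fun q hq hz => h.exists_pivot_start hT hq hz)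
  · rintro ⟨k, c⟩ ⟨k', c'⟩ ⟨a, ha⟩
    dsimp only at ha
    have h1 : ∀ b, choicePoly T c b = .C (a b) * choicePoly T c' b := by
      intro b
      rw [← h.blockPoly_choice T (hkn k) c b, ← h.blockPoly_choice T (hkn k') c' b]
      ext i
      rw [Polynomial.coeff_C_mul, coeff_blockPoly, coeff_blockPoly]
      split_ifs with hi
      · rw [ha, h.blk_var _ _ hi]
      · simp
    have h2 : ∀ b, a b = 1 := by
      intro b
      have h3 := congrArg Polynomial.leadingCoeff (h1 b)
      rw [Polynomial.leadingCoeff_mul, (monic_choicePoly T c b).leadingCoeff,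
        (monic_choicePoly T c' b).leadingCoeff, Polynomial.leadingCoeff_C, mul_one] at h3
      exact h3.symm
    have h3 : ∀ b, choicePoly T c b = choicePoly T c' b := fun b => by
      rw [h1, h2, Polynomial.C_1, one_mul]
    obtain rfl : k = k' := by
      funext b
      have h4 := congrArg Polynomial.natDegree (h3 b)
      rw [natDegree_choicePoly, natDegree_choicePoly] at h4
      exact Fin.ext h4
    congr 1
    refine Subtype.ext (funext fun u => ?_)
    have h4 : (choicePoly T c' (c.1 u).1).eval (T ⟨u.1, c.1 u⟩) = 0 := by
      rw [← h3, eval_choicePoly_eq_zero]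
      exact ⟨u, rfl, rfl⟩
    obtain ⟨u', -, h5⟩ := (eval_choicePoly_eq_zero c' _ _).1 h4
    obtain ⟨h6, h7⟩ := Sigma.mk.inj_iff.1 (hT h5)
    obtain rfl : u = u' := Subtype.ext h6
    exact eq_of_heq h7
  · intro q hq hz
    refine ⟨⟨fun b => ⟨(blockPoly n var q b).natDegree,
      Nat.lt_succ_iff.2 (natDegree_blockPoly_le q b)⟩, ?_⟩, ?_⟩
    · exact (h.exists_factorChoice hT hq hz fun b => rfl).choose
    · have h1 := (h.exists_factorChoice hT hq hz fun b => rfl).choose_spec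
      refine ⟨fun b => (blockPoly n var q b).coeff (blockPoly n var q b).natDegree, fun v => ?_⟩
      have h2 := congrArg (fun f => f.coeff (pos v)) (h1 (blk v))
      simpa only [Polynomial.coeff_C_mul, h.coeff_blockPoly_pos] using h2

end IsBlockEnumeration

end StartSolutions

section Counting

open Filter Topology

lemma card_choice_eq_coeff {U ι : Type*} [Fintype U] [Fintype ι] [DecidableEq U] [DecidableEq ι]
    (a : U → ι →₀ ℕ) (k : ι →₀ ℕ) :
    (Fintype.card {c : ∀ u, Σ b, Fin (a u b) //
      ∀ b, (Finset.univ.filter fun u => (c u).1 = b).card = k b} : ℤ) =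
      coeff k (∏ u, ∑ b, C (a u b : ℤ) * X b) := by
  have h1 : ∀ u, ∑ b, C (a u b : ℤ) * X b =
      ∑ x : Σ b, Fin (a u b), (X x.1 : MvPolynomial ι ℤ) := by
    intro u
    rw [Fintype.sum_sigma]
    simp
  have h2 : ∀ c : ∀ u, Σ b, Fin (a u b), ∏ u, (X (c u).1 : MvPolynomial ι ℤ) =
      monomial (∑ u, Finsupp.single (c u).1 1) 1 := fun c => by
    rw [monomial_sum_one]
    rfl
  have h3 : ∀ (c : ∀ u, Σ b, Fin (a u b)) b,
      (∑ u, Finsupp.single (c u).1 1 : ι →₀ ℕ) b =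
        (Finset.univ.filter fun u => (c u).1 = b).card := by
    intro c b
    rw [Finsupp.finsetSum_apply, Finset.card_filter]
    exact Finset.sum_congr rfl fun u _ => by rw [Finsupp.single_apply]
  simp only [h1, Fintype.prod_sum, h2, coeff_sum, coeff_monomial]
  rw [Finset.sum_boole, Fintype.card_subtype]
  simp only [Finsupp.ext_iff, h3]

/-- The number of solutions of the system of eigenvector equations of `F` blockwise. -/
lemma IsBlockEnumeration.card_eigenpoints {σ ι J : Type*} [Fintype σ] [Fintype ι] [DecidableEq ι]
    [Fintype J] {blk : σ → ι} {pos : σ → ℕ} {n : ι → ℕ} {var : ι → ℕ → σ}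
    (h : IsBlockEnumeration blk pos n var) {deg : ι → ι →₀ ℕ} {F : σ → MvPolynomial σ ℂ}
    (hF : ∀ v, (F v).IsWeightedHomogeneous (blockWeight blk) (deg (blk v))) {p : J → σ → ℂ}
    (hnz : ∀ j, NonzeroBlocks blk (p j))
    (hsol : ∀ j, ∃ μ : ι → ℂ, ∀ v, eval (p j) (F v) = μ (blk v) * p j v)
    (hinj : ∀ i j, (∃ c : ι → ℂ, ∀ v, p i v = c (blk v) * p j v) → i = j)
    (hcomplete : ∀ q, NonzeroBlocks blk q → (∃ μ : ι → ℂ, ∀ v, eval q (F v) = μ (blk v) * q v) →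
      ∃ j, ∃ c : ι → ℂ, ∀ v, q v = c (blk v) * p j v)
    (hnondeg : ∀ q, NonzeroBlocks blk q → ∀ μ : ι → ℂ, (∀ v, eval q (F v) = μ (blk v) * q v) →
      ∀ r, (∃ c : ι → ℂ, ∀ v, dirDeriv q r (F v) - μ (blk v) * r v = c (blk v) * q v) →
        ∃ c : ι → ℂ, ∀ v, r v = c (blk v) * q v) :
    (Fintype.card J : ℤ) = ∑ k : ∀ b, Fin (n b + 1),
      coeff (Finsupp.equivFunOnFinite.symm fun b => (k b : ℕ))
        (∏ b, (∑ b', C (deg b b' : ℤ) * X b') ^ (k b : ℕ)) := by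
  classical
  obtain ⟨T, hT⟩ : ∃ T : (Σ u, FactorIndex blk deg u) → ℂ, Function.Injective T := by
    obtain ⟨f, hf⟩ := exists_injective_nat (Σ u, FactorIndex blk deg u)
    exact ⟨fun x => f x, Nat.cast_injective.comp hf⟩
  have hconserved := card_eq_of_isReducedSolution
    (fun (k : {x : σ × σ // blk x.1 = blk x.2}) t => isWeightedHomogeneous_weightedMinor
      (pos := pos) (h.isWeightedHomogeneous_startPoly T) hF k.2 t)
    (fun k φ => exists_polynomial_weightedMinor k.1.1 k.1.2 φ)
    (h.isReducedSolution_zero hT)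
    (isReducedSolution_one hnz hsol hinj hcomplete hnondeg)
  rw [← hconserved, Fintype.card_sigma, Nat.cast_sum]
  refine Finset.sum_congr rfl fun k _ => ?_
  obtain ⟨e, he⟩ := h.exists_equiv_lt (fun b => (k b : ℕ)) fun b => Nat.lt_succ_iff.1 (k b).2
  have h1 := card_choice_eq_coeff (fun u : {u // pos u < k (blk u)} => deg (blk u))
    (Finsupp.equivFunOnFinite.symm fun b => (k b : ℕ))
  have h2 : ∏ u : {u // pos u < k (blk u)}, ∑ b', C (deg (blk u) b' : ℤ) * X b' =
      ∏ b, (∑ b', C (deg b b' : ℤ) * X b') ^ (k b : ℕ) := by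
    rw [Fintype.prod_equiv e _ (fun x => ∑ b', C (deg x.1 b' : ℤ) * X b')
      fun u => by rw [he], Fintype.prod_sigma]
    simp
  rw [← h2, ← h1]
  congr!

end Counting

section Triple

variable {n m s : ℕ}

/-- The factor of `ℙ^n × ℙ^m × ℙ^s` to which a homogeneous coordinate belongs. -/
def tripleBlk : Fin (n + 1) ⊕ Fin (m + 1) ⊕ Fin (s + 1) → Fin 3 :=
  Sum.elim (fun _ => 0) (Sum.elim (fun _ => 1) (fun _ => 2))

/-- The position of a homogeneous coordinate in its factor. -/
def triplePos : Fin (n + 1) ⊕ Fin (m + 1) ⊕ Fin (s + 1) → ℕ :=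
  Sum.elim (fun i => i) (Sum.elim (fun i => i) (fun i => i))

/-- The homogeneous coordinate in a given position of a given factor. -/
def tripleVar : Fin 3 → ℕ → Fin (n + 1) ⊕ Fin (m + 1) ⊕ Fin (s + 1) :=
  ![fun i => .inl (Fin.ofNat _ i), fun i => .inr (.inl (Fin.ofNat _ i)),
    fun i => .inr (.inr (Fin.ofNat _ i))]

lemma isBlockEnumeration_triple :
    IsBlockEnumeration (tripleBlk (n := n) (m := m) (s := s)) triplePos ![n, m, s] tripleVar where
  blk_var b i _ := by fin_cases b <;> rfl
  pos_var b i hi := by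
    fin_cases b <;> exact Nat.mod_eq_of_lt (Nat.lt_succ_iff.2 hi)
  var_eq v := by
    rcases v with v | v | v <;> simp [tripleBlk, triplePos, tripleVar]
  pos_le v := by
    rcases v with v | v | v <;> exact Nat.lt_succ_iff.1 v.2

lemma nonzeroBlocks_triple {q : Fin (n + 1) ⊕ Fin (m + 1) ⊕ Fin (s + 1) → ℂ} :
    NonzeroBlocks tripleBlk q ↔
      (fun i => q (.inl i)) ≠ 0 ∧ (fun i => q (.inr (.inl i))) ≠ 0 ∧
        (fun i => q (.inr (.inr i))) ≠ 0 := by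
  simp [NonzeroBlocks, Fin.forall_fin_succ, tripleBlk, Function.ne_iff]

lemma exists_scale_triple {f g : Fin (n + 1) ⊕ Fin (m + 1) ⊕ Fin (s + 1) → ℂ} :
    (∃ c : Fin 3 → ℂ, ∀ v, f v = c (tripleBlk v) * g v) ↔
      (∃ c : ℂ, ∀ i, f (.inl i) = c * g (.inl i)) ∧
      (∃ c : ℂ, ∀ i, f (.inr (.inl i)) = c * g (.inr (.inl i))) ∧
        ∃ c : ℂ, ∀ i, f (.inr (.inr i)) = c * g (.inr (.inr i)) := by
  constructor
  · rintro ⟨c, hc⟩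
    exact ⟨⟨c 0, fun i => hc _⟩, ⟨c 1, fun i => hc _⟩, ⟨c 2, fun i => hc _⟩⟩
  · rintro ⟨⟨a, ha⟩, ⟨b, hb⟩, ⟨c, hc⟩⟩
    refine ⟨![a, b, c], ?_⟩
    rintro (i | i | i)
    exacts [ha i, hb i, hc i]

lemma span_singleton_eq_iff_exists_mul {A : Type*} {x y : A → ℂ} (hx : x ≠ 0) :
    Submodule.span ℂ {x} = Submodule.span ℂ {y} ↔ ∃ c : ℂ, ∀ i, x i = c * y i := by
  constructor
  · intro h
    have h1 : x ∈ Submodule.span ℂ {y} := h ▸ Submodule.mem_span_singleton_self x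
    obtain ⟨c, rfl⟩ := Submodule.mem_span_singleton.1 h1
    exact ⟨c, fun i => rfl⟩
  · rintro ⟨c, hc⟩
    obtain rfl : x = c • y := funext hc
    have h0 : c ≠ 0 := by rintro rfl; simp at hx
    exact Submodule.span_singleton_smul_eq (IsUnit.mk0 c h0) y

lemma fderiv_triple_apply
    {F₁ : Fin (n + 1) → MvPolynomial (Fin (n + 1) ⊕ Fin (m + 1) ⊕ Fin (s + 1)) ℂ}
    {F₂ : Fin (m + 1) → MvPolynomial (Fin (n + 1) ⊕ Fin (m + 1) ⊕ Fin (s + 1)) ℂ}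
    {F₃ : Fin (s + 1) → MvPolynomial (Fin (n + 1) ⊕ Fin (m + 1) ⊕ Fin (s + 1)) ℂ}
    (p q : (Fin (n + 1) → ℂ) × (Fin (m + 1) → ℂ) × (Fin (s + 1) → ℂ)) :
    fderiv ℂ (fun p : (Fin (n + 1) → ℂ) × (Fin (m + 1) → ℂ) × (Fin (s + 1) → ℂ) =>
      ((fun i => eval (Sum.elim p.1 (Sum.elim p.2.1 p.2.2)) (F₁ i),
        fun j => eval (Sum.elim p.1 (Sum.elim p.2.1 p.2.2)) (F₂ j),
        fun k => eval (Sum.elim p.1 (Sum.elim p.2.1 p.2.2)) (F₃ k)) :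
        (Fin (n + 1) → ℂ) × (Fin (m + 1) → ℂ) × (Fin (s + 1) → ℂ))) p q =
      (fun i => dirDeriv (Sum.elim p.1 (Sum.elim p.2.1 p.2.2))
          (Sum.elim q.1 (Sum.elim q.2.1 q.2.2)) (F₁ i),
        fun j => dirDeriv (Sum.elim p.1 (Sum.elim p.2.1 p.2.2))
          (Sum.elim q.1 (Sum.elim q.2.1 q.2.2)) (F₂ j),
        fun k => dirDeriv (Sum.elim p.1 (Sum.elim p.2.1 p.2.2))
          (Sum.elim q.1 (Sum.elim q.2.1 q.2.2)) (F₃ k)) := by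
  let E : (Fin (n + 1) → ℂ) × (Fin (m + 1) → ℂ) × (Fin (s + 1) → ℂ) →L[ℂ]
      (Fin (n + 1) ⊕ Fin (m + 1) ⊕ Fin (s + 1) → ℂ) :=
    LinearMap.toContinuousLinearMap
      { toFun := fun p => Sum.elim p.1 (Sum.elim p.2.1 p.2.2)
        map_add' := fun p q => by ext (i | i | i) <;> rfl
        map_smul' := fun a p => by ext (i | i | i) <;> rfl }
  choose D hD hD' using fun g : MvPolynomial (Fin (n + 1) ⊕ Fin (m + 1) ⊕ Fin (s + 1)) ℂ =>
    exists_hasFDerivAt_eval g (E p)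
  have hcomp : ∀ g, HasFDerivAt (fun x => eval (E x) g) (D g ∘L E) p := fun g =>
    (hD g).comp p E.hasFDerivAt
  have h := (hasFDerivAt_pi.2 fun i => hcomp (F₁ i)).prodMk
    ((hasFDerivAt_pi.2 fun i => hcomp (F₂ i)).prodMk (hasFDerivAt_pi.2 fun i => hcomp (F₃ i)))
  have h1 := DFunLike.congr_fun h.fderiv q
  refine h1.trans ?_
  refine Prod.ext (funext fun i => hD' _ _) (Prod.ext (funext fun i => hD' _ _)
    (funext fun i => hD' _ _))

lemma sum_pi_fin_three {M : Type*} [AddCommMonoid M] (N : Fin 3 → ℕ) (f : (Fin 3 → ℕ) → M) :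
    ∑ k : ∀ b, Fin (N b + 1), f (fun b => k b) =
      ∑ i ∈ Finset.range (N 0 + 1), ∑ j ∈ Finset.range (N 1 + 1), ∑ k ∈ Finset.range (N 2 + 1),
        f ![i, j, k] := by
  simp only [Finset.sum_range]
  let e : (∀ b, Fin (N b + 1)) ≃ Fin (N 0 + 1) × Fin (N 1 + 1) × Fin (N 2 + 1) :=
    { toFun := fun k => (k 0, k 1, k 2)
      invFun := fun x => Fin.cons x.1 (Fin.cons x.2.1 (Fin.cons x.2.2 finZeroElim))
      left_inv := fun k => by funext b; fin_cases b <;> rfl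
      right_inv := fun x => rfl }
  rw [Fintype.sum_equiv e _ (fun x => f ![x.1, x.2.1, x.2.2]) fun k => ?_]
  · simp only [Fintype.sum_prod_type]
  congr 1
  funext b
  fin_cases b <;> rfl

lemma coeff_fixedPoint_sum (A B D : MvPolynomial (Fin 3) ℤ) :
    coeff (Finsupp.single 0 n + Finsupp.single 1 m + Finsupp.single 2 s)
      (∑ i ∈ Finset.range (n + 1), ∑ j ∈ Finset.range (m + 1), ∑ k ∈ Finset.range (s + 1),
        A ^ (n - i) * B ^ (m - j) * D ^ (s - k) * X 0 ^ i * X 1 ^ j * X 2 ^ k) =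
    ∑ i ∈ Finset.range (n + 1), ∑ j ∈ Finset.range (m + 1), ∑ k ∈ Finset.range (s + 1),
      coeff (Finsupp.single 0 i + Finsupp.single 1 j + Finsupp.single 2 k)
        (A ^ i * B ^ j * D ^ k) := by
  simp only [coeff_sum]
  rw [← Finset.sum_range_reflect]
  refine Finset.sum_congr rfl fun i hi => ?_
  rw [← Finset.sum_range_reflect]
  refine Finset.sum_congr rfl fun j hj => ?_
  rw [← Finset.sum_range_reflect]
  refine Finset.sum_congr rfl fun k hk => ?_
  rw [Finset.mem_range] at hi hj hk
  have h1 : (X 0 ^ (n + 1 - 1 - i) * X 1 ^ (m + 1 - 1 - j) * X 2 ^ (s + 1 - 1 - k) :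
      MvPolynomial (Fin 3) ℤ) = monomial (Finsupp.single 0 (n - i) + Finsupp.single 1 (m - j) +
        Finsupp.single 2 (s - k)) 1 := by
    simp [X_pow_eq_monomial, monomial_mul]
  have h2 : (Finsupp.single 0 n + Finsupp.single 1 m + Finsupp.single 2 s : Fin 3 →₀ ℕ) =
      (Finsupp.single 0 i + Finsupp.single 1 j + Finsupp.single 2 k) +
        (Finsupp.single 0 (n - i) + Finsupp.single 1 (m - j) + Finsupp.single 2 (s - k)) := by
    ext b
    fin_cases b <;> simp <;> omega
  have h3 : n - (n + 1 - 1 - i) = i := by omega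
  have h4 : m - (m + 1 - 1 - j) = j := by omega
  have h5 : s - (s + 1 - 1 - k) = k := by omega
  rw [h2, h3, h4, h5, mul_assoc, mul_assoc, ← mul_assoc (X 0 ^ _), h1, coeff_mul_monomial, mul_one]

end Triple

section FixedPoints

variable {n m s : ℕ}

lemma sum_elim_blocks (q : Fin (n + 1) ⊕ Fin (m + 1) ⊕ Fin (s + 1) → ℂ) :
    Sum.elim (fun i => q (.inl i)) (Sum.elim (fun i => q (.inr (.inl i)))
      (fun i => q (.inr (.inr i)))) = q := by
  ext (i | i | i) <;> rfl

lemma equivFunOnFinite_symm_fin_three (i j k : ℕ) :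
    Finsupp.equivFunOnFinite.symm ![i, j, k] =
      Finsupp.single 0 i + Finsupp.single 1 j + Finsupp.single 2 k := by
  ext b
  fin_cases b <;> simp

lemma mem_span_blocks_iff {x : Fin (n + 1) → ℂ} {y : Fin (m + 1) → ℂ} {z : Fin (s + 1) → ℂ}
    {q : (Fin (n + 1) → ℂ) × (Fin (m + 1) → ℂ) × (Fin (s + 1) → ℂ)} :
    q ∈ Submodule.span ℂ {(x, 0, 0), (0, y, 0), (0, 0, z)} ↔
      (∃ c : ℂ, ∀ i, q.1 i = c * x i) ∧ (∃ c : ℂ, ∀ i, q.2.1 i = c * y i) ∧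
        ∃ c : ℂ, ∀ i, q.2.2 i = c * z i := by
  rw [Submodule.mem_span_triple]
  constructor
  · rintro ⟨a, b, c, rfl⟩
    exact ⟨⟨a, by simp⟩, ⟨b, by simp⟩, ⟨c, by simp⟩⟩
  · rintro ⟨⟨a, ha⟩, ⟨b, hb⟩, ⟨c, hc⟩⟩
    refine ⟨a, b, c, ?_⟩
    ext i
    · simp [ha]
    · simp [hb]
    · simp [hc]

lemma coeff_rename_val_fin_three (i j k : ℕ) (P : MvPolynomial (Fin 3) ℤ) :
    coeff (Finsupp.single 0 i + Finsupp.single 1 j + Finsupp.single 2 k)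
      (rename (Fin.val : Fin 3 → ℕ) P) =
    coeff (Finsupp.single 0 i + Finsupp.single 1 j + Finsupp.single 2 k) P := by
  rw [← coeff_rename_mapDomain _ (Fin.val_injective (n := 3))]
  simp [Finsupp.mapDomain_add]


/-- The projection of a point of affine space to its three blocks of coordinates. -/
def blocks (q : Fin (n + 1) ⊕ Fin (m + 1) ⊕ Fin (s + 1) → ℂ) :
    (Fin (n + 1) → ℂ) × (Fin (m + 1) → ℂ) × (Fin (s + 1) → ℂ) :=
  (fun i => q (.inl i), fun i => q (.inr (.inl i)), fun i => q (.inr (.inr i)))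

variable {F : Fin (n + 1) ⊕ Fin (m + 1) ⊕ Fin (s + 1) →
    MvPolynomial (Fin (n + 1) ⊕ Fin (m + 1) ⊕ Fin (s + 1)) ℂ}
  {G : (Fin (n + 1) → ℂ) × (Fin (m + 1) → ℂ) × (Fin (s + 1) → ℂ) →
    (Fin (n + 1) → ℂ) × (Fin (m + 1) → ℂ) × (Fin (s + 1) → ℂ)}

lemma eq_smul_blocks_iff (hG : ∀ q, G (blocks q) = blocks fun v => eval q (F v))
    {q : Fin (n + 1) ⊕ Fin (m + 1) ⊕ Fin (s + 1) → ℂ} {μ : Fin 3 → ℂ} :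
    G (blocks q) = (μ 0 • (blocks q).1, μ 1 • (blocks q).2.1, μ 2 • (blocks q).2.2) ↔
      ∀ v, eval q (F v) = μ (tripleBlk v) * q v := by
  rw [hG]
  simp [blocks, tripleBlk, funext_iff]

/-- The number of fixed points of a self-map of `ℙ^n × ℙ^m × ℙ^s` with nondegenerate fixed
points. -/
lemma ncard_fixedPoints {deg : Fin 3 → Fin 3 →₀ ℕ}
    (hF : ∀ v, (F v).IsWeightedHomogeneous (blockWeight tripleBlk) (deg (tripleBlk v)))
    (hG : ∀ q, G (blocks q) = blocks fun v => eval q (F v))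
    (hG' : ∀ q r, fderiv ℂ G (blocks q) (blocks r) = blocks fun v => dirDeriv q r (F v))
    {S : Set (Submodule ℂ (Fin (n + 1) → ℂ) × Submodule ℂ (Fin (m + 1) → ℂ) ×
      Submodule ℂ (Fin (s + 1) → ℂ))}
    (hS : S = {T | ∃ x y z, x ≠ 0 ∧ y ≠ 0 ∧ z ≠ 0 ∧
      T = (Submodule.span ℂ {x}, Submodule.span ℂ {y}, Submodule.span ℂ {z}) ∧
      ∃ μ₁ μ₂ μ₃ : ℂ, G (x, y, z) = (μ₁ • x, μ₂ • y, μ₃ • z)})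
    (hfin : S.Finite)
    (hgen : ∀ x y z, x ≠ 0 → y ≠ 0 → z ≠ 0 → ∀ μ₁ μ₂ μ₃ : ℂ,
      G (x, y, z) = (μ₁ • x, μ₂ • y, μ₃ • z) →
      ∀ q : ((Fin (n + 1) → ℂ) × (Fin (m + 1) → ℂ) × (Fin (s + 1) → ℂ)),
        fderiv ℂ G (x, y, z) q - (μ₁ • q.1, μ₂ • q.2.1, μ₃ • q.2.2) ∈
          Submodule.span ℂ {((x, 0, 0) : _), (0, y, 0), (0, 0, z)} →
        q ∈ Submodule.span ℂ {((x, 0, 0) : _), (0, y, 0), (0, 0, z)}) :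
    (S.ncard : ℤ) = ∑ i ∈ Finset.range (n + 1), ∑ j ∈ Finset.range (m + 1),
      ∑ k ∈ Finset.range (s + 1),
        coeff (Finsupp.single 0 i + Finsupp.single 1 j + Finsupp.single 2 k)
          ((∑ b, C (deg 0 b : ℤ) * X b) ^ i * (∑ b, C (deg 1 b : ℤ) * X b) ^ j *
            (∑ b, C (deg 2 b : ℤ) * X b) ^ k) := by
  have : Fintype S := hfin.fintype
  have hmem : ∀ T : S, ∃ q, NonzeroBlocks tripleBlk q ∧
      T.1 = (Submodule.span ℂ {(blocks q).1}, Submodule.span ℂ {(blocks q).2.1},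
        Submodule.span ℂ {(blocks q).2.2}) ∧
      ∃ μ : Fin 3 → ℂ, ∀ v, eval q (F v) = μ (tripleBlk v) * q v := by
    rintro ⟨T, hT⟩
    rw [hS] at hT
    obtain ⟨x, y, z, hx, hy, hz, rfl, μ₁, μ₂, μ₃, hμ⟩ := hT
    exact ⟨Sum.elim x (Sum.elim y z), nonzeroBlocks_triple.2 ⟨hx, hy, hz⟩, rfl, ![μ₁, μ₂, μ₃],
      (eq_smul_blocks_iff hG).1 hμ⟩
  choose p hp hT hμ using hmem
  have key := isBlockEnumeration_triple.card_eigenpoints hF hp hμ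
    (fun T U h => ?_) (fun q hq h => ?_) (fun q hq μ hqμ r hr => ?_)
  · rw [← Nat.card_coe_set_eq, Nat.card_eq_fintype_card, key]
    refine (sum_pi_fin_three ![n, m, s] fun k => coeff (Finsupp.equivFunOnFinite.symm k)
      (∏ b, (∑ b', C (deg b b' : ℤ) * X b') ^ k b)).trans ?_
    simp [Fin.prod_univ_three, equivFunOnFinite_symm_fin_three]
  · obtain ⟨h1, h2, h3⟩ := nonzeroBlocks_triple.1 (hp T)
    rw [exists_scale_triple] at h
    refine Subtype.ext ((hT T).trans (.trans ?_ (hT U).symm))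
    exact Prod.ext ((span_singleton_eq_iff_exists_mul h1).2 h.1) (Prod.ext
      ((span_singleton_eq_iff_exists_mul h2).2 h.2.1)
      ((span_singleton_eq_iff_exists_mul h3).2 h.2.2))
  · obtain ⟨h1, h2, h3⟩ := nonzeroBlocks_triple.1 hq
    obtain ⟨μ, h⟩ := h
    have hmem : (Submodule.span ℂ {(blocks q).1}, Submodule.span ℂ {(blocks q).2.1},
        Submodule.span ℂ {(blocks q).2.2}) ∈ S := by
      rw [hS]
      exact ⟨_, _, _, h1, h2, h3, rfl, μ 0, μ 1, μ 2, (eq_smul_blocks_iff hG).2 h⟩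
    refine ⟨⟨_, hmem⟩, exists_scale_triple.2 ?_⟩
    have h := hT ⟨_, hmem⟩
    simp only [Prod.mk.injEq] at h
    exact ⟨(span_singleton_eq_iff_exists_mul h1).1 h.1,
      (span_singleton_eq_iff_exists_mul h2).1 h.2.1,
      (span_singleton_eq_iff_exists_mul h3).1 h.2.2⟩
  · obtain ⟨h1, h2, h3⟩ := nonzeroBlocks_triple.1 hq
    have h := hgen _ _ _ h1 h2 h3 (μ 0) (μ 1) (μ 2) ((eq_smul_blocks_iff hG).2 hqμ)
        (blocks r) <| by
      rw [mem_span_blocks_iff]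
      have h := hG' q r
      rw [blocks] at h
      rw [h]
      exact exists_scale_triple.1 hr
    exact exists_scale_triple.2 (mem_span_blocks_iff.1 h)

end FixedPoints

/-- Fixed-point count for a generic self-map of `ℙ^n × ℙ^m × ℙ^s` whose three
components are given by multihomogeneous polynomials of multidegrees `(d₁,d₂,d₃)`,
`(e₁,e₂,e₃)`, `(f₁,f₂,f₃)`: the number of fixed points equals the coefficient of
`α^n β^m γ^s` in
`∑_{i,j,k} (d₁α+d₂β+d₃γ)^{n−i}(e₁α+e₂β+e₃γ)^{m−j}(f₁α+f₂β+f₃γ)^{s−k} α^i β^j γ^k`. -/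
theorem stmt15 (n m s : ℕ) (d e f : Fin 3 → ℕ)
    (F₁ : Fin (n + 1) → MvPolynomial (Fin (n + 1) ⊕ Fin (m + 1) ⊕ Fin (s + 1)) ℂ)
    (F₂ : Fin (m + 1) → MvPolynomial (Fin (n + 1) ⊕ Fin (m + 1) ⊕ Fin (s + 1)) ℂ)
    (F₃ : Fin (s + 1) → MvPolynomial (Fin (n + 1) ⊕ Fin (m + 1) ⊕ Fin (s + 1)) ℂ)
    (w : Fin (n + 1) ⊕ Fin (m + 1) ⊕ Fin (s + 1) → (Fin 3 →₀ ℕ))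
    (hw : w = Sum.elim (fun _ => Finsupp.single 0 1)
      (Sum.elim (fun _ => Finsupp.single 1 1) (fun _ => Finsupp.single 2 1)))
    (hF₁ : ∀ i, (F₁ i).IsWeightedHomogeneous w
      (Finsupp.single 0 (d 0) + Finsupp.single 1 (d 1) + Finsupp.single 2 (d 2)))
    (hF₂ : ∀ j, (F₂ j).IsWeightedHomogeneous w
      (Finsupp.single 0 (e 0) + Finsupp.single 1 (e 1) + Finsupp.single 2 (e 2)))
    (hF₃ : ∀ k, (F₃ k).IsWeightedHomogeneous w
      (Finsupp.single 0 (f 0) + Finsupp.single 1 (f 1) + Finsupp.single 2 (f 2)))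
    (G : ((Fin (n + 1) → ℂ) × (Fin (m + 1) → ℂ) × (Fin (s + 1) → ℂ)) →
         ((Fin (n + 1) → ℂ) × (Fin (m + 1) → ℂ) × (Fin (s + 1) → ℂ)))
    (hG : ∀ p, G p = (fun i => eval (Sum.elim p.1 (Sum.elim p.2.1 p.2.2)) (F₁ i),
                      fun j => eval (Sum.elim p.1 (Sum.elim p.2.1 p.2.2)) (F₂ j),
                      fun k => eval (Sum.elim p.1 (Sum.elim p.2.1 p.2.2)) (F₃ k)))
    (S : Set (Submodule ℂ (Fin (n + 1) → ℂ) × Submodule ℂ (Fin (m + 1) → ℂ) ×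
              Submodule ℂ (Fin (s + 1) → ℂ)))
    (hS : S = {T | ∃ x y z, x ≠ 0 ∧ y ≠ 0 ∧ z ≠ 0 ∧
      T = (Submodule.span ℂ {x}, Submodule.span ℂ {y}, Submodule.span ℂ {z}) ∧
      ∃ μ₁ μ₂ μ₃ : ℂ, G (x, y, z) = (μ₁ • x, μ₂ • y, μ₃ • z)})
    (hfin : S.Finite)
    -- genericity: every fixed point is nondegenerate (the graph of `G` meets the
    -- diagonal transversally)
    (hgen : ∀ x y z, x ≠ 0 → y ≠ 0 → z ≠ 0 → ∀ μ₁ μ₂ μ₃ : ℂ,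
      G (x, y, z) = (μ₁ • x, μ₂ • y, μ₃ • z) →
      ∀ q : ((Fin (n + 1) → ℂ) × (Fin (m + 1) → ℂ) × (Fin (s + 1) → ℂ)),
        fderiv ℂ G (x, y, z) q - (μ₁ • q.1, μ₂ • q.2.1, μ₃ • q.2.2) ∈
          Submodule.span ℂ {((x, 0, 0) : _), (0, y, 0), (0, 0, z)} →
        q ∈ Submodule.span ℂ {((x, 0, 0) : _), (0, y, 0), (0, 0, z)}) :
    (S.ncard : ℤ) =
      MvPolynomial.coeff
        (Finsupp.single 0 n + Finsupp.single 1 m + Finsupp.single 2 s)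
        (∑ i ∈ Finset.range (n + 1), ∑ j ∈ Finset.range (m + 1),
          ∑ k ∈ Finset.range (s + 1),
          (C (d 0 : ℤ) * X 0 + C (d 1 : ℤ) * X 1 + C (d 2 : ℤ) * X 2) ^ (n - i) *
          (C (e 0 : ℤ) * X 0 + C (e 1 : ℤ) * X 1 + C (e 2 : ℤ) * X 2) ^ (m - j) *
          (C (f 0 : ℤ) * X 0 + C (f 1 : ℤ) * X 1 + C (f 2 : ℤ) * X 2) ^ (s - k) *
          X 0 ^ i * X 1 ^ j * X 2 ^ k) := by
  have hw' : w = blockWeight tripleBlk := by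
    rw [hw]
    ext (i | i | i) <;> rfl
  have hG₀ := funext hG
  have hcard := ncard_fixedPoints (F := Sum.elim F₁ (Sum.elim F₂ F₃)) (G := G)
    (deg := ![Finsupp.single 0 (d 0) + Finsupp.single 1 (d 1) + Finsupp.single 2 (d 2),
      Finsupp.single 0 (e 0) + Finsupp.single 1 (e 1) + Finsupp.single 2 (e 2),
      Finsupp.single 0 (f 0) + Finsupp.single 1 (f 1) + Finsupp.single 2 (f 2)])
    (by
      rw [← hw']
      rintro (i | i | i)
      exacts [hF₁ i, hF₂ i, hF₃ i])
    (fun q => by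
      rw [hG]
      simp only [blocks, sum_elim_blocks]
      rfl)
    (fun q r => by
      rw [hG₀, fderiv_triple_apply]
      simp only [blocks, sum_elim_blocks]
      rfl)
    hS hfin hgen
  have hpoly : ∀ g : Fin 3 → ℕ, rename (Fin.val : Fin 3 → ℕ) (∑ b, C (g b : ℤ) * X b) =
      C (g 0 : ℤ) * X 0 + C (g 1 : ℤ) * X 1 + C (g 2 : ℤ) * X 2 := fun g => by
    simp [Fin.sum_univ_three]
  trans coeff (Finsupp.single 0 n + Finsupp.single 1 m + Finsupp.single 2 s)
    (rename (Fin.val : Fin 3 → ℕ) (∑ i ∈ Finset.range (n + 1), ∑ j ∈ Finset.range (m + 1),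
      ∑ k ∈ Finset.range (s + 1), (∑ b, C (d b : ℤ) * X b) ^ (n - i) *
        (∑ b, C (e b : ℤ) * X b) ^ (m - j) * (∑ b, C (f b : ℤ) * X b) ^ (s - k) *
        X 0 ^ i * X 1 ^ j * X 2 ^ k))
  · rw [coeff_rename_val_fin_three, coeff_fixedPoint_sum, hcard]
    simp [Fin.sum_univ_three]
  · simp only [map_sum, map_mul, map_pow, hpoly, rename_X]
    rfl
end
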